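/- Let a and b be positive real numbers with max{a, 2−a} < b ≤ a + 3/2. Then for every ε > 0 there is a constant C = C(a,b,ε) such that for all positive integers n, | S_{a,b}(n) − [Γ(a+1)Γ(b+1)/Γ(a+b+2)]·[ζ(a+1)ζ(b+1)/ζ(a+b+2)]·σ_{a+b+1}(n) − [ζ(1−a)ζ(b+1)/((b+1)ζ(b−a+2))]·n^a·σ_{b−a+1}(n) | ≤ C·n^{(a+b)/2 + 1 + ε}. -/

import Mathlib

open Finset


/-- `σ_a(n) = ∑_{d ∣ n} d^a` for real `a`. -/
noncomputable def sigmaR (a : ℝ) (n : ℕ) : ℝ := ∑ d ∈ n.divisors, (d : ℝ) ^ a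

/-- `S_{a,b}(n) = ∑_{k=1}^{n-1} σ_a(k) σ_b(n-k)`. -/
noncomputable def SR (a b : ℝ) (n : ℕ) : ℝ :=
  ∑ k ∈ Finset.Ico 1 n, sigmaR a k * sigmaR b (n - k)

/-- The Riemann zeta function at a real argument (it takes real values there). -/
noncomputable def zetaR (x : ℝ) : ℝ := (riemannZeta (x : ℂ)).re

noncomputable def ee (z : ℂ) : ℂ := Complex.exp (2 * Real.pi * Complex.I * z)

noncomputable def pw (s : ℝ) (z : ℂ) : ℂ := (-Complex.I * z) ^ ((-s : ℝ) : ℂ)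

noncomputable def cG (s : ℝ) : ℝ := Real.Gamma s * (2 * Real.pi) ^ (-s)

noncomputable def lam (s : ℝ) (z : ℂ) : ℂ := ∑' d : ℕ+, (((d : ℝ) ^ s : ℝ) : ℂ) * ee (d * z)

lemma norm_pw (s : ℝ) (z : ℂ) : ‖pw s z‖ = ‖z‖ ^ (-s) := by
  rw [pw, Complex.norm_cpow_real]; simp

lemma norm_ee (z : ℂ) : ‖ee z‖ = Real.exp (-(2 * Real.pi * z.im)) := by
  rw [ee, Complex.norm_exp]; congr 1; simp

lemma real_mul_cpow {c : ℝ} (hc : 0 < c) (z w : ℂ) (hw : w ≠ 0) :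
    ((c : ℂ) * z) ^ w = (c : ℂ) ^ w * z ^ w := by
  rcases eq_or_ne z 0 with rfl | hz
  · simp [Complex.zero_cpow hw]
  · have hc' : (c : ℂ) ≠ 0 := by exact_mod_cast hc.ne'
    rw [Complex.cpow_def_of_ne_zero (mul_ne_zero hc' hz), Complex.cpow_def_of_ne_zero hc',
      Complex.cpow_def_of_ne_zero hz, ← Complex.exp_add, Complex.log_ofReal_mul hc hz,
      Complex.ofReal_log hc.le]
    ring_nf

lemma pw_smul {s : ℝ} (hs : 0 < s) {c : ℝ} (hc : 0 < c) (z : ℂ) :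
    pw s (c * z) = ((c ^ (-s) : ℝ) : ℂ) * pw s z := by
  unfold pw
  rw [show -Complex.I * (c * z) = (c : ℂ) * (-Complex.I * z) by ring,
    real_mul_cpow hc _ _ (by rw [Complex.ofReal_ne_zero]; linarith)]
  rw [Complex.ofReal_cpow hc.le]

lemma slit_of {z : ℂ} (h : 0 ≤ z.im) (h0 : z ≠ 0) : -Complex.I * z ∈ Complex.slitPlane := by
  rw [Complex.mem_slitPlane_iff]
  rcases h.lt_or_eq with h | h
  · left; simpa using h
  · right
    simp only [neg_mul, Complex.neg_im, Complex.mul_im, Complex.I_re, zero_mul, Complex.I_im, one_mul, zero_add, ne_eq, neg_eq_zero]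
    intro h1
    exact h0 (Complex.ext (by simpa using h1) (by simpa using h.symm))

lemma ee_add_int (z : ℂ) (k : ℤ) : ee (z + k) = ee z := by
  unfold ee
  rw [mul_add, Complex.exp_add, show 2 * (Real.pi:ℂ) * Complex.I * k = k * (2 * Real.pi * Complex.I) by ring, Complex.exp_int_mul_two_pi_mul_I, mul_one]

lemma pw_hasDeriv (s : ℝ) {z : ℂ} (h : 0 ≤ z.im) (h0 : z ≠ 0) :
    HasDerivAt (pw s) (Complex.I * s * pw (s + 1) z) z := by
  have h1 : HasDerivAt (fun z : ℂ => -Complex.I * z) (-Complex.I) z := by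
    simpa using (hasDerivAt_id z).const_mul (-Complex.I)
  have := h1.cpow_const (c := ((-s : ℝ) : ℂ)) (slit_of h h0)
  unfold pw
  convert this using 1
  push_cast
  rw [show (-(s + 1) : ℂ) = -s - 1 by ring]; ring


lemma gamma_int_aux {s : ℝ} (hs : 0 < s) {c : ℝ} (hc : 0 < c) :
    MeasureTheory.IntegrableOn (fun t : ℝ => t ^ (s - 1) * Real.exp (-(c * t))) (Set.Ioi 0) := by
  have := integrableOn_rpow_mul_exp_neg_mul_rpow (p := 1) (s := s - 1) (b := c) (by linarith) one_pos hc
  simpa using this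

lemma gamma_int_norm {s : ℝ} {r : ℂ} {t : ℝ} (ht : 0 < t) :
    ‖((t ^ (s - 1) : ℝ) : ℂ) * Complex.exp (-(r * t))‖ = t ^ (s - 1) * Real.exp (-(r.re * t)) := by
  rw [norm_mul, Complex.norm_exp, Complex.norm_real, Real.norm_of_nonneg (by positivity)]
  simp

lemma gamma_int_integrable {s : ℝ} (hs : 0 < s) {r : ℂ} (hr : 0 < r.re) :
    MeasureTheory.IntegrableOn (fun t : ℝ => ((t ^ (s - 1) : ℝ) : ℂ) * Complex.exp (-(r * t))) (Set.Ioi 0) := by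
  refine MeasureTheory.Integrable.mono' (gamma_int_aux hs hr) ?_ ?_
  · refine ContinuousOn.aestronglyMeasurable ?_ measurableSet_Ioi
    refine ContinuousOn.mul ?_ (by fun_prop)
    refine Complex.continuous_ofReal.comp_continuousOn ?_
    exact ContinuousOn.rpow_const continuousOn_id (fun x hx => Or.inl (ne_of_gt hx))
  · refine (MeasureTheory.ae_restrict_iff' measurableSet_Ioi).2 (Filter.Eventually.of_forall ?_)
    intro t ht
    rw [gamma_int_norm ht]

lemma gamma_int {s : ℝ} (hs : 0 < s) {r : ℂ} (hr : 0 < r.re) :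
    ∫ t in Set.Ioi (0:ℝ), ((t ^ (s - 1) : ℝ) : ℂ) * Complex.exp (-(r * t))
      = Real.Gamma s * r ^ ((-s : ℝ) : ℂ) := by
  set U : Set ℂ := {c | 0 < c.re}
  have hU : IsOpen U := isOpen_lt continuous_const Complex.continuous_re
  have hdiff : DifferentiableOn ℂ (fun r : ℂ => ∫ t in Set.Ioi (0:ℝ), ((t ^ (s - 1) : ℝ) : ℂ) * Complex.exp (-(r * t))) U := by
    intro r0 hr0
    have hr0' : 0 < r0.re := hr0
    have key := hasDerivAt_integral_of_dominated_loc_of_deriv_le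
      (μ := MeasureTheory.volume.restrict (Set.Ioi (0:ℝ)))
      (F := fun (r : ℂ) (t : ℝ) => ((t ^ (s - 1) : ℝ) : ℂ) * Complex.exp (-(r * t)))
      (F' := fun (r : ℂ) (t : ℝ) => -(((t ^ (s + 1 - 1) : ℝ) : ℂ) * Complex.exp (-(r * t))))
      (x₀ := r0) (s := {c : ℂ | r0.re / 2 < c.re})
      (bound := fun t => t ^ (s + 1 - 1) * Real.exp (-(r0.re / 2 * t)))
      ((isOpen_lt continuous_const Complex.continuous_re).mem_nhds (by simp; linarith))
      (by
        filter_upwards [hU.mem_nhds hr0] with r hr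
        exact (gamma_int_integrable hs hr).aestronglyMeasurable)
      (gamma_int_integrable hs hr0)
      ((gamma_int_integrable (s := s + 1) (by linarith) hr0).aestronglyMeasurable.neg)
      (by
        refine (MeasureTheory.ae_restrict_iff' measurableSet_Ioi).2 (Filter.Eventually.of_forall ?_)
        intro t ht r hr
        have ht' : (0:ℝ) < t := ht
        have hr' : r0.re / 2 < r.re := hr
        rw [norm_neg, gamma_int_norm ht]
        gcongr)
      (gamma_int_aux (by linarith) (by linarith))
      (by
        refine (MeasureTheory.ae_restrict_iff' measurableSet_Ioi).2 (Filter.Eventually.of_forall ?_)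
        intro t ht r hr
        have ht' : (0:ℝ) < t := ht
        have h1 : HasDerivAt (fun r : ℂ => -(r * t)) (-(t:ℂ)) r := by
          have h0 := (hasDerivAt_id' r).mul_const (-(t:ℂ))
          simpa only [one_mul, mul_neg] using h0
        have h2 := (h1.cexp).const_mul ((t ^ (s - 1) : ℝ) : ℂ)
        refine h2.congr_deriv ?_
        rw [show s + 1 - 1 = (s - 1) + 1 by ring, Real.rpow_add_one ht'.ne']
        push_cast; ring)
    exact key.2.differentiableAt.differentiableWithinAt
  have hdiff2 : DifferentiableOn ℂ (fun r : ℂ => (Real.Gamma s : ℂ) * r ^ ((-s : ℝ) : ℂ)) U := by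
    intro r0 hr0
    refine DifferentiableAt.differentiableWithinAt ?_
    refine DifferentiableAt.const_mul ?_ _
    exact (differentiableAt_id).cpow_const (Or.inl hr0)
  have heq := AnalyticOnNhd.eqOn_of_preconnected_of_frequently_eq (z₀ := 1)
    (hdiff.analyticOnNhd hU) (hdiff2.analyticOnNhd hU)
    (convex_halfSpace_re_gt 0).isPreconnected (by simp [U]) ?_
  · exact heq hr
  · have hreal : ∀ c : ℝ, 0 < c → ∫ t in Set.Ioi (0:ℝ), ((t ^ (s - 1) : ℝ) : ℂ) * Complex.exp (-((c:ℂ) * t))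
      = Real.Gamma s * (c:ℂ) ^ ((-s : ℝ) : ℂ) := by
      intro c hc
      have := Real.integral_rpow_mul_exp_neg_mul_Ioi hs hc
      have h2 := congrArg Complex.ofReal this
      rw [← integral_complex_ofReal] at h2
      push_cast at h2 ⊢
      rw [h2, ← Complex.ofReal_neg, ← Complex.ofReal_cpow hc.le, mul_comm]
      congr 1
      norm_cast
      rw [one_div, Real.inv_rpow hc.le, Real.rpow_neg hc.le]
    have hseq : Filter.Tendsto (fun n : ℕ => (((1 + 1 / ((n:ℝ) + 1)) : ℝ) : ℂ)) Filter.atTop (nhdsWithin 1 {1}ᶜ) := by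
      refine tendsto_nhdsWithin_iff.2 ⟨?_, ?_⟩
      · have := (tendsto_one_div_add_atTop_nhds_zero_nat (𝕜 := ℝ)).const_add 1
        have h3 := (Complex.continuous_ofReal.tendsto _).comp this
        simp only [add_zero, Complex.ofReal_one] at h3
        exact h3
      · refine Filter.Eventually.of_forall (fun n => ?_)
        simp only [Set.mem_compl_iff, Set.mem_singleton_iff]
        rw [← Complex.ofReal_one, Complex.ofReal_inj]
        have : (0:ℝ) < 1 / ((n:ℝ) + 1) := by positivity
        linarith
    refine hseq.frequently (Filter.Frequently.of_forall (fun n => ?_))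
    exact hreal _ (by positivity)

lemma dist_line (ξ t : ℝ) (X : ℂ) (hX : 0 < X.im) :
    |ξ| * (X.im / ‖X‖) ≤ ‖(ξ : ℂ) + t * X‖ := by
  have hX0 : 0 < ‖X‖ := norm_pos_iff.2 (by rintro rfl; simp at hX)
  rw [← mul_div_assoc, div_le_iff₀ hX0]
  have h := Complex.abs_im_le_norm (((ξ : ℂ) + t * X) * (starRingEnd ℂ) X)
  rw [norm_mul, Complex.norm_conj] at h
  refine le_trans (le_of_eq ?_) h
  conv_lhs => rw [← abs_of_pos hX, ← abs_mul, ← abs_neg]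
  congr 1
  simp
  try ring

lemma summable_pw_norm {s : ℝ} (hs : 1 < s) {z : ℂ} (hz : 0 < z.im) :
    Summable (fun l : ℤ => ‖z + l‖ ^ (-s)) := by
  have hX0 : 0 < ‖z‖ := norm_pos_iff.2 (by rintro rfl; simp at hz)
  have h1 := (Real.summable_abs_int_rpow hs).mul_left ((z.im / ‖z‖) ^ (-s))
  refine Summable.of_norm_bounded_eventually h1 ?_
  have : ∀ᶠ l : ℤ in Filter.cofinite, l ≠ 0 := by
    exact Filter.eventually_cofinite_ne 0
  filter_upwards [this] with l hl
  rw [Real.norm_of_nonneg (by positivity), ← Real.mul_rpow (by positivity) (by positivity)]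
  have h2 := dist_line l 1 z hz
  have hl' : 0 < |(l:ℝ)| := by positivity
  refine Real.rpow_le_rpow_of_nonpos (by positivity) ?_ (by linarith)
  rw [mul_comm]
  refine h2.trans (le_of_eq ?_)
  push_cast; rw [one_mul, add_comm]

lemma lip_fourier {s : ℝ} (hs : 1 < s) {z : ℂ} (hz : 0 < z.im) (ξ : ℝ) :
    FourierTransform.fourier (fun x : ℝ => (((max x 0) ^ (s - 1) : ℝ) : ℂ) * ee (x * z)) ξ
      = cG s * pw s (z - ξ) := by
  rw [Real.fourier_real_eq_integral_exp_smul]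
  rw [← MeasureTheory.setIntegral_eq_integral_of_forall_compl_eq_zero (s := Set.Ioi 0)]
  · have hr : 0 < (2 * Real.pi * (-Complex.I * (z - ξ)) : ℂ).re := by
      have : (2 * Real.pi * (-Complex.I * (z - ξ)) : ℂ).re = 2 * Real.pi * z.im := by
        simp
      rw [this]; positivity
    have h := gamma_int (s := s) (by linarith) hr
    have h2 : (Real.Gamma s : ℂ) * (2 * Real.pi * (-Complex.I * (z - ξ)) : ℂ) ^ ((-s : ℝ) : ℂ)
        = cG s * pw s (z - ξ) := by
      rw [show (2 * Real.pi * (-Complex.I * (z - ξ)) : ℂ) = ((2 * Real.pi : ℝ) : ℂ) * (-Complex.I * (z - ξ)) by push_cast; ring,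
        real_mul_cpow (by positivity) _ _ (by rw [Complex.ofReal_ne_zero]; linarith), ← Complex.ofReal_cpow (by positivity), cG, pw]
      push_cast; ring
    rw [← h2, ← h]
    refine MeasureTheory.setIntegral_congr_fun measurableSet_Ioi (fun v hv => ?_)
    have hv' : (0:ℝ) < v := hv
    simp only [max_eq_left hv'.le, smul_eq_mul, ee]
    rw [mul_left_comm, ← Complex.exp_add]
    congr 2
    push_cast; ring
  · intro x hx
    have : x ≤ 0 := by simpa using hx
    rw [max_eq_right this, Real.zero_rpow (by linarith)]
    simp

lemma lipschitz {s : ℝ} (hs : 1 < s) {z : ℂ} (hz : 0 < z.im) :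
    HasSum (fun l : ℤ => (cG s : ℂ) * pw s (z + l)) (lam (s - 1) z) := by
  have hsum : Summable (fun l : ℤ => (cG s : ℂ) * pw s (z + l)) := by
    refine Summable.mul_left _ (Summable.of_norm ?_)
    simp only [norm_pw]
    exact summable_pw_norm hs hz
  have hsum' : Summable (fun l : ℤ => (cG s : ℂ) * pw s (z - l)) := by
    rw [← (Equiv.neg ℤ).summable_iff]
    convert hsum using 2 with l
    simp
  set f : ℝ → ℂ := fun x : ℝ => (((max x 0) ^ (s - 1) : ℝ) : ℂ) * ee (x * z) with hf
  have hc : Continuous f := by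
    refine Continuous.mul ?_ ?_
    · refine Complex.continuous_ofReal.comp ?_
      exact (continuous_id.max continuous_const).rpow_const (fun x => Or.inr (by linarith))
    · unfold ee; fun_prop
  have hO : f =O[Filter.cocompact ℝ] fun x : ℝ => |x| ^ (-(2:ℝ)) := by
    rw [cocompact_eq_atBot_atTop, Asymptotics.isBigO_sup]
    constructor
    · refine Asymptotics.IsBigO.of_bound 1 ?_
      filter_upwards [Filter.eventually_le_atBot 0] with x hx
      rw [hf]
      simp only [max_eq_right hx, Real.zero_rpow (show s - 1 ≠ 0 by linarith)]
      simp; positivity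
    · have h1 := (isLittleO_exp_neg_mul_rpow_atTop (a := 2 * Real.pi * z.im) (by positivity) (-2 - (s - 1))).isBigO
      have h2 := (Asymptotics.isBigO_refl (fun x : ℝ => x ^ (s - 1)) Filter.atTop).mul h1
      refine (Asymptotics.IsBigO.trans ?_ h2).trans ?_
      · refine Asymptotics.IsBigO.of_bound 1 ?_
        filter_upwards [Filter.eventually_gt_atTop 0] with x hx
        rw [hf]
        simp only [max_eq_left hx.le, norm_mul, norm_ee, one_mul, Complex.norm_real]
        refine mul_le_mul_of_nonneg_left (le_of_eq ?_) (norm_nonneg _)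
        rw [Real.norm_of_nonneg (Real.exp_pos _).le]
        congr 1
        simp; ring
      · refine Asymptotics.IsBigO.of_bound 1 ?_
        filter_upwards [Filter.eventually_gt_atTop 0] with x hx
        rw [← Real.rpow_add hx, abs_of_pos hx, one_mul]
        apply le_of_eq; congr 2; ring
  have hP := Real.tsum_eq_tsum_fourier_of_rpow_decay_of_summable hc one_lt_two hO
    (by simp only [hf, lip_fourier hs hz]; exact_mod_cast hsum') 0
  have hP2 : ∑' n : ℤ, f n = ∑' l : ℤ, (cG s : ℂ) * pw s (z - l) := by
    simp only [hf, lip_fourier hs hz] at hP ⊢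
    simpa using hP
  have h3 : ∑' l : ℤ, (cG s : ℂ) * pw s (z - l) = ∑' l : ℤ, (cG s : ℂ) * pw s (z + l) := by
    rw [← (Equiv.neg ℤ).tsum_eq]
    simp
  have h4 : ∑' n : ℤ, f n = lam (s - 1) z := by
    have hinj : Function.Injective (fun d : ℕ+ => ((d : ℕ) : ℤ)) := fun a b h => by
      simpa using h
    rw [← hinj.tsum_eq]
    · unfold lam
      refine tsum_congr (fun d => ?_)
      simp [hf]
    · intro n hn
      rw [Function.mem_support] at hn
      have : 0 < n := by
        by_contra hcon
        apply hn
        have : (n:ℝ) ≤ 0 := by exact_mod_cast not_lt.1 hcon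
        simp only [hf, max_eq_right this, Real.zero_rpow (show s - 1 ≠ 0 by linarith)]
        simp
      exact ⟨⟨n.toNat, by omega⟩, by simp [this.le]⟩
  rw [← h4, hP2, h3]
  exact hsum.hasSum


lemma ne_int_add {y : ℝ} (hy : 0 ≤ y) {l : ℤ} (hl : l ≠ 0) :
    ((y : ℂ) * Complex.I + l) ≠ 0 ∧ 0 ≤ ((y : ℂ) * Complex.I + l).im := by
  constructor
  · intro h
    have := congrArg Complex.re h
    simp at this
    exact hl this
  · simpa using hy

lemma pw_one_add (a : ℝ) : pw a 1 + pw a (-1) = 2 * Complex.cos (Real.pi * a / 2) := by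
  have h1 : pw a 1 = Complex.exp (Real.pi * a / 2 * Complex.I) := by
    unfold pw
    rw [mul_one, Complex.cpow_def_of_ne_zero (by simp), Complex.log_neg_I]
    congr 1; push_cast; ring
  have h2 : pw a (-1) = Complex.exp (-(Real.pi * a / 2) * Complex.I) := by
    unfold pw
    rw [neg_mul_neg, mul_one, Complex.cpow_def_of_ne_zero (by simp), Complex.log_I]
    congr 1; push_cast; ring
  rw [h1, h2, Complex.two_cos]

lemma pw_nat_hasSum {a : ℝ} (ha : 1 < a) (w : ℂ) :
    HasSum (fun n : ℕ => if n = 0 then 0 else pw a (n * w)) (riemannZeta a * pw a w) := by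
  have h1 : Summable (fun n : ℕ => 1 / (n : ℂ) ^ (a : ℂ)) := by
    rw [Complex.summable_one_div_nat_cpow]; simpa using ha
  have h2 := h1.hasSum
  rw [← zeta_eq_tsum_one_div_nat_cpow (by simpa using ha)] at h2
  have h3 := h2.mul_right (pw a w)
  refine h3.congr_fun ?_ |> fun h => h
  intro n
  rcases Nat.eq_zero_or_pos n with rfl | hn
  · have : (a:ℂ) ≠ 0 := by rw [Complex.ofReal_ne_zero]; linarith
    simp [this]
  · rw [if_neg hn.ne']
    have := pw_smul (s := a) (by linarith) (c := n) (by exact_mod_cast hn) w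
    rw [Complex.ofReal_natCast] at this
    rw [this, Real.rpow_neg (by positivity)]
    push_cast
    rw [Complex.ofReal_cpow (by positivity)]
    simp

lemma L3_gt {a : ℝ} (ha : 1 < a) :
    Filter.Tendsto (fun y : ℝ => lam (a - 1) (y * Complex.I) - cG a * pw a (y * Complex.I))
      (nhdsWithin 0 (Set.Ioi 0)) (nhds (riemannZeta (1 - a))) := by
  have hlim : HasSum (fun l : ℤ => if l = 0 then 0 else (cG a : ℂ) * pw a l) (riemannZeta (1 - a)) := by
    have h1 := pw_nat_hasSum ha 1
    have h2 := pw_nat_hasSum ha (-1)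
    have h3 := HasSum.of_nat_of_neg (f := fun l : ℤ => if l = 0 then 0 else pw a l)
      (g := riemannZeta a * pw a 1) (g' := riemannZeta a * pw a (-1))
      (by simpa using h1) (by simpa using h2)
    have h4 := h3.mul_left (cG a : ℂ)
    have h5 : (cG a : ℂ) * (riemannZeta a * pw a 1 + riemannZeta a * pw a (-1) - (if (0:ℤ) = 0 then 0 else pw a (0:ℤ))) = riemannZeta (1 - a) := by
      rw [riemannZeta_one_sub]
      · simp only [if_true, sub_zero]
        rw [← mul_add, pw_one_add, cG]
        rw [Complex.Gamma_ofReal]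
        push_cast
        rw [Complex.ofReal_cpow (by positivity)]
        push_cast
        ring
      · intro n hn
        have : a = -(n:ℝ) := by exact_mod_cast hn
        have h0 : (0:ℝ) ≤ n := by positivity
        linarith
      · intro h
        have : a = 1 := by exact_mod_cast h
        linarith
    rw [h5] at h4
    refine h4.congr_fun ?_ |> fun h => h
    intro l
    split_ifs <;> simp
  rw [← hlim.tsum_eq]
  have hev : (fun y : ℝ => lam (a - 1) (y * Complex.I) - cG a * pw a (y * Complex.I)) =ᶠ[nhdsWithin 0 (Set.Ioi 0)]
      (fun y : ℝ => ∑' l : ℤ, if l = 0 then 0 else (cG a : ℂ) * pw a (y * Complex.I + l)) := by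
    filter_upwards [self_mem_nhdsWithin] with y hy
    have h := lipschitz ha (z := y * Complex.I) (by simpa using hy)
    have h2 := hasSum_ite_sub_hasSum h 0
    rw [h2.tsum_eq]
    simp
  refine Filter.Tendsto.congr' hev.symm ?_
  refine tendsto_tsum_of_dominated_convergence (bound := fun l : ℤ => |cG a| * |(l:ℝ)| ^ (-a))
    ((Real.summable_abs_int_rpow ha).mul_left _) ?_ ?_
  · intro l
    by_cases hl : l = 0
    · simp [hl]
    · simp only [hl, if_false]
      have h0 := ne_int_add (le_refl (0:ℝ)) hl
      have hc := (pw_hasDeriv a h0.2 h0.1).continuousAt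
      have hm : Filter.Tendsto (fun y : ℝ => (y : ℂ) * Complex.I + l) (nhdsWithin 0 (Set.Ioi 0)) (nhds (((0:ℝ) : ℂ) * Complex.I + l)) := by
        refine Filter.Tendsto.mono_left ?_ nhdsWithin_le_nhds
        exact Continuous.tendsto (f := fun y : ℝ => (y : ℂ) * Complex.I + l) (by fun_prop) 0
      have h3 := (hc.tendsto.comp hm).const_mul (cG a : ℂ)
      simpa using h3
  · filter_upwards [self_mem_nhdsWithin] with y hy l
    by_cases hl : l = 0
    · simp only [hl, if_true, norm_zero]; positivity
    · simp only [hl, if_false, norm_mul, Complex.norm_real, norm_pw, Real.norm_eq_abs]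
      have hl' : 0 < |(l:ℝ)| := by positivity
      refine mul_le_mul_of_nonneg_left ?_ (abs_nonneg _)
      refine Real.rpow_le_rpow_of_nonpos hl' ?_ (by linarith)
      have := Complex.abs_re_le_norm ((y : ℂ) * Complex.I + l)
      simpa using this

lemma lam_I (s y : ℝ) :
    lam s (y * Complex.I) = ((∑' d : ℕ+, (d : ℝ) ^ s * Real.exp (-(2 * Real.pi * y) * d) : ℝ) : ℂ) := by
  unfold lam
  rw [Complex.ofReal_tsum]
  refine tsum_congr (fun d => ?_)
  rw [ee]; push_cast
  congr 2
  linear_combination (2 * Real.pi * d * y) * Complex.I_sq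

lemma cGpw_I {s y : ℝ} (hy : 0 < y) :
    cG s * pw s (y * Complex.I) = ((Real.Gamma s * (2 * Real.pi * y) ^ (-s) : ℝ) : ℂ) := by
  unfold cG pw
  rw [show -Complex.I * (y * Complex.I) = y by linear_combination -y * Complex.I_sq,
    ← Complex.ofReal_cpow hy.le, Real.mul_rpow (by positivity) hy.le]
  push_cast; ring

/-- reduction to a real limit -/
lemma L3_of_real {a L : ℝ} (h : Filter.Tendsto (fun t : ℝ => ∑' d : ℕ+, (d : ℝ) ^ (a - 1) * Real.exp (-t * d) - Real.Gamma a * t ^ (-a))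
      (nhdsWithin 0 (Set.Ioi 0)) (nhds L)) :
    Filter.Tendsto (fun y : ℝ => lam (a - 1) (y * Complex.I) - cG a * pw a (y * Complex.I))
      (nhdsWithin 0 (Set.Ioi 0)) (nhds (L : ℂ)) := by
  have hm : Filter.Tendsto (fun y : ℝ => 2 * Real.pi * y) (nhdsWithin 0 (Set.Ioi 0)) (nhdsWithin 0 (Set.Ioi 0)) := by
    refine tendsto_nhdsWithin_iff.2 ⟨?_, ?_⟩
    · refine Filter.Tendsto.mono_left ?_ nhdsWithin_le_nhds
      have := Continuous.tendsto (f := fun y : ℝ => 2 * Real.pi * y) (by fun_prop) 0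
      simpa using this
    · filter_upwards [self_mem_nhdsWithin] with y hy
      have : 0 < y := hy
      simp only [Set.mem_Ioi]; positivity
  have h2 := (Complex.continuous_ofReal.tendsto L).comp (h.comp hm)
  refine h2.congr' ?_
  filter_upwards [self_mem_nhdsWithin] with y hy
  have : 0 < y := hy
  rw [lam_I, cGpw_I this, ← Complex.ofReal_sub]
  simp [Function.comp]

lemma L3_one :
    Filter.Tendsto (fun y : ℝ => lam (1 - 1) (y * Complex.I) - cG 1 * pw 1 (y * Complex.I))
      (nhdsWithin 0 (Set.Ioi 0)) (nhds (riemannZeta (1 - (1:ℝ)))) := by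
  have hz : riemannZeta (1 - (1:ℝ)) = ((-1/2 : ℝ) : ℂ) := by
    simp [riemannZeta_zero]
  rw [hz]
  refine L3_of_real ?_
  have key : ∀ t : ℝ, 0 < t → t ≤ 1 → |∑' d : ℕ+, (d : ℝ) ^ ((1:ℝ) - 1) * Real.exp (-t * d) - Real.Gamma 1 * t ^ (-(1:ℝ)) - (-1/2)| ≤ 5 * t := by
    intro t ht ht1
    have h1 : ∑' d : ℕ+, (d : ℝ) ^ ((1:ℝ) - 1) * Real.exp (-t * d) = 1 / (Real.exp t - 1) := by
      have hg := hasSum_geometric_of_lt_one (Real.exp_pos (-t)).le (Real.exp_lt_one_iff.2 (by linarith))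
      rw [tsum_pnat_eq_tsum_succ (f := fun d : ℕ => (d : ℝ) ^ ((1:ℝ) - 1) * Real.exp (-t * d))]
      have hg2 := hg.mul_left (Real.exp (-t))
      have : ∀ n : ℕ, ((n+1 : ℕ) : ℝ) ^ ((1:ℝ) - 1) * Real.exp (-t * ((n + 1 : ℕ) : ℝ)) = Real.exp (-t) * Real.exp (-t) ^ n := by
        intro n
        rw [sub_self, Real.rpow_zero, one_mul, ← Real.exp_nat_mul, ← Real.exp_add]
        congr 1; push_cast; ring
      simp only [this]
      rw [hg2.tsum_eq, Real.exp_neg]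
      have : Real.exp t - 1 > 0 := by have := Real.add_one_lt_exp ht.ne'; linarith
      field_simp
    rw [h1, Real.Gamma_one, Real.rpow_neg_one, one_mul]
    set E := Real.exp t - 1 with hE
    have hb := Real.exp_bound (x := t) (by rw [abs_of_pos ht]; exact ht1) (n := 3) (by norm_num)
    simp [Finset.sum_range_succ] at hb
    norm_num [Nat.factorial] at hb
    rw [abs_of_pos ht] at hb
    have hE0 : t ≤ E := by have := Real.add_one_le_exp t; linarith
    have hEp : 0 < E := by linarith
    obtain ⟨r, hr⟩ : ∃ r, Real.exp t = 1 + t + t^2/2 + r := ⟨Real.exp t - (1 + t + t^2/2), by ring⟩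
    rw [hr] at hb
    have hb' : |r| ≤ t^3 := by
      have : |r| ≤ t ^ 3 * (2/9) := by convert hb using 2; ring
      have h3 : 0 < t^3 := by positivity
      linarith
    have hEr : E = t + t^2/2 + r := by rw [hE, hr]; ring
    have e1 : 1 / E - t⁻¹ - (-1/2) = (t^3/2 + (t-2)*r) / (2 * t * E) := by
      field_simp
      rw [hEr]; ring
    rw [e1, abs_div, abs_of_pos (show 0 < 2 * t * E by positivity), div_le_iff₀ (by positivity)]
    have h5 : |t^3/2 + (t-2)*r| ≤ t^3/2 + 2 * t^3 := by
      refine (abs_add_le _ _).trans ?_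
      rw [abs_of_pos (by positivity), abs_mul]
      have : |t - 2| ≤ 2 := by rw [abs_le]; constructor <;> linarith
      have := mul_le_mul this hb' (abs_nonneg _) (by norm_num)
      linarith
    have h6 : t * t * t ≤ t * t * E := by gcongr
    nlinarith
  rw [tendsto_iff_dist_tendsto_zero]
  refine squeeze_zero' (g := fun t : ℝ => 5 * t) (Filter.Eventually.of_forall (fun t => dist_nonneg)) ?_ ?_
  · have : Set.Ioc (0:ℝ) 1 ∈ nhdsWithin (0:ℝ) (Set.Ioi 0) := Ioc_mem_nhdsGT one_pos
    filter_upwards [this] with t ht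
    rw [Real.dist_eq]
    exact key t ht.1 ht.2
  · refine Filter.Tendsto.mono_left ?_ nhdsWithin_le_nhds
    have := Continuous.tendsto (f := fun y : ℝ => 5 * y) (by fun_prop) 0
    simpa using this


noncomputable def zt (s : ℂ) (d : ℕ) : ℂ :=
  (s - 1) * ((d:ℂ) + 1) ^ (-s) + (((d:ℂ) + 2) ^ (1 - s) - ((d:ℂ) + 1) ^ (1 - s))

lemma cpow_hasDeriv_real {x : ℝ} (hx : 0 < x) (s : ℂ) :
    HasDerivAt (fun x : ℝ => (x : ℂ) ^ s) (s * (x : ℂ) ^ (s - 1)) x := by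
  have h1 : HasDerivAt (fun z : ℂ => z ^ s) (s * (x:ℂ) ^ (s - 1) * 1) (x : ℂ) :=
    (hasDerivAt_id (x:ℂ)).cpow_const (Or.inl (by simpa using hx))
  rw [mul_one] at h1
  exact h1.comp_ofReal

lemma zt_norm {s : ℂ} (hs : 0 < s.re) (d : ℕ) :
    ‖zt s d‖ ≤ ‖1 - s‖ * ‖s‖ * ((d:ℝ) + 1) ^ (-s.re - 1) := by
  set D : ℝ := (d:ℝ) + 1 with hD
  have hD0 : 0 < D := by positivity
  -- first
  have h1 : ∀ x ∈ Set.Icc D (D + 1), ‖(x:ℂ) ^ (-s) - (D:ℂ) ^ (-s)‖ ≤ ‖s‖ * D ^ (-s.re - 1) := by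
    intro x hx
    have := Convex.norm_image_sub_le_of_norm_hasDerivWithin_le (𝕜 := ℝ)
      (f := fun x : ℝ => (x : ℂ) ^ (-s)) (f' := fun x : ℝ => -s * (x:ℂ) ^ (-s - 1))
      (s := Set.Icc D (D+1)) (C := ‖s‖ * D ^ (-s.re - 1)) (x := D) (y := x)
      (fun y hy => (cpow_hasDeriv_real (lt_of_lt_of_le hD0 hy.1) (-s)).hasDerivWithinAt)
      (by
        intro y hy
        have hy0 : 0 < y := lt_of_lt_of_le hD0 hy.1
        rw [norm_mul, norm_neg, Complex.norm_cpow_eq_rpow_re_of_pos hy0]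
        refine mul_le_mul_of_nonneg_left ?_ (norm_nonneg _)
        simp only [Complex.sub_re, Complex.neg_re, Complex.one_re]
        exact Real.rpow_le_rpow_of_nonpos hD0 hy.1 (by linarith))
      (convex_Icc _ _) ⟨le_refl _, by linarith⟩ hx
    refine this.trans ?_
    refine mul_le_of_le_one_right (by positivity) ?_
    rw [Real.norm_eq_abs, abs_le]
    constructor <;> linarith [hx.1, hx.2]
  have h2 := Convex.norm_image_sub_le_of_norm_hasDerivWithin_le (𝕜 := ℝ)
      (f := fun x : ℝ => (x : ℂ) ^ (1 - s) - (x:ℂ) * ((1 - s) * (D:ℂ) ^ (-s)))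
      (f' := fun x : ℝ => (1 - s) * (x:ℂ) ^ (1 - s - 1) - 1 * ((1 - s) * (D:ℂ) ^ (-s)))
      (s := Set.Icc D (D+1)) (C := ‖1 - s‖ * (‖s‖ * D ^ (-s.re - 1))) (x := D) (y := D + 1)
      (fun y hy => ((cpow_hasDeriv_real (lt_of_lt_of_le hD0 hy.1) (1-s)).sub
        ((Complex.ofRealCLM.hasDerivAt).mul_const _)).hasDerivWithinAt)
      (by
        intro y hy
        rw [show 1 - s - 1 = -s by ring, one_mul, ← mul_sub, norm_mul]
        exact mul_le_mul_of_nonneg_left (h1 y hy) (norm_nonneg _))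
      (convex_Icc _ _) ⟨le_refl _, by linarith⟩ ⟨by linarith, le_refl _⟩
  rw [show D + 1 - D = 1 by ring, norm_one, mul_one] at h2
  rw [mul_assoc]
  refine le_trans (le_of_eq ?_) h2
  congr 1
  rw [zt, hD]; push_cast
  rw [show (d:ℂ) + 1 + 1 = d + 2 by ring]
  ring

lemma zt_diff (d : ℕ) : Differentiable ℂ (fun s => zt s d) := by
  unfold zt
  have h1 : ((d:ℂ) + 1) ≠ 0 := by exact_mod_cast (Nat.succ_ne_zero d)
  have h2 : ((d:ℂ) + 2) ≠ 0 := by exact_mod_cast (Nat.succ_ne_zero (d+1))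
  intro s
  refine DifferentiableAt.add (DifferentiableAt.mul (by fun_prop) ?_) (DifferentiableAt.sub ?_ ?_)
  · exact DifferentiableAt.const_cpow (by fun_prop) (Or.inl h1)
  · exact DifferentiableAt.const_cpow (by fun_prop) (Or.inl h2)
  · exact DifferentiableAt.const_cpow (by fun_prop) (Or.inl h1)

lemma summable_succ_rpow {p : ℝ} (hp : p < -1) : Summable (fun d : ℕ => ((d:ℝ) + 1) ^ p) := by
  have := (summable_nat_add_iff 1).2 (Real.summable_nat_rpow.2 hp)
  simpa using this

lemma zt_summable {s : ℂ} (hs : 0 < s.re) : Summable (zt s) := by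
  refine Summable.of_norm_bounded ?_ (zt_norm hs)
  exact (summable_succ_rpow (by linarith)).mul_left _

lemma zt_hasSum {s : ℂ} (hs : 0 < s.re) : HasSum (zt s) (riemannZeta₁ s - 1) := by
  have hU : IsOpen {s : ℂ | 0 < s.re} := isOpen_lt continuous_const Complex.continuous_re
  have hd : DifferentiableOn ℂ (fun s => ∑' d, zt s d) {s : ℂ | 0 < s.re} := by
    intro s0 hs0
    have hs0' : 0 < s0.re := hs0
    set V : Set ℂ := {s | s0.re / 2 < s.re} ∩ Metric.ball 0 (‖s0‖ + 1) with hV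
    have hVo : IsOpen V := (isOpen_lt continuous_const Complex.continuous_re).inter Metric.isOpen_ball
    have hmem : s0 ∈ V := ⟨by simp; linarith, by simp⟩
    have := Complex.differentiableOn_tsum_of_summable_norm (F := fun d s => zt s d) (U := V)
      (u := fun d : ℕ => (1 + (‖s0‖ + 1)) * (‖s0‖ + 1) * ((d:ℝ) + 1) ^ (-(s0.re / 2) - 1))
      ((summable_succ_rpow (by linarith)).mul_left _)
      (fun d => (zt_diff d).differentiableOn) hVo
      (by
        intro d s hsV
        have h1 : s0.re / 2 < s.re := hsV.1
        have h2 : ‖s‖ < ‖s0‖ + 1 := by simpa using hsV.2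
        refine (zt_norm (by linarith) d).trans ?_
        have h3 : ‖1 - s‖ ≤ 1 + (‖s0‖ + 1) := by
          refine (norm_sub_le _ _).trans ?_
          rw [norm_one]; linarith
        gcongr
        · linarith)
    exact (this.differentiableAt (hVo.mem_nhds hmem)).differentiableWithinAt
  have hd2 : DifferentiableOn ℂ (fun s => riemannZeta₁ s - 1) {s : ℂ | 0 < s.re} :=
    (differentiable_riemannZeta₁.sub_const 1).differentiableOn
  have heq := AnalyticOnNhd.eqOn_of_preconnected_of_eventuallyEq
    (hd.analyticOnNhd hU) (hd2.analyticOnNhd hU)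
    (convex_halfSpace_re_gt 0).isPreconnected (z₀ := 2) (by simp) ?_
  · have := heq hs
    simp only at this
    rw [← this]
    exact (zt_summable hs).hasSum
  · filter_upwards [(isOpen_lt continuous_const Complex.continuous_re).mem_nhds (show (2:ℂ) ∈ {s : ℂ | 1 < s.re} by simp)] with s hs
    have hs1 : 1 < s.re := hs
    have ht := (zt_summable (s := s) (by linarith)).hasSum.tendsto_sum_nat
    refine tendsto_nhds_unique ht ?_
    have hp : ∀ N : ℕ, ∑ d ∈ range N, zt s d = (s - 1) * ∑ d ∈ range N, 1 / ((d:ℂ) + 1) ^ s + (((N:ℂ) + 1) ^ (1 - s) - 1) := by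
      intro N
      induction N with
      | zero => simp
      | succ N ih =>
        rw [sum_range_succ, ih, sum_range_succ, zt, Complex.cpow_neg]
        push_cast
        rw [show (N:ℂ) + 1 + 1 = N + 2 by ring]
        ring
    simp only [hp]
    have hz : HasSum (fun d : ℕ => 1 / ((d:ℂ) + 1) ^ s) (riemannZeta s) := by
      rw [zeta_eq_tsum_one_div_nat_add_one_cpow hs1]
      refine Summable.hasSum ?_
      have := (summable_nat_add_iff 1).2 ((Complex.summable_one_div_nat_cpow).2 hs1)
      simpa using this
    have h1 := (hz.tendsto_sum_nat.const_mul (s - 1))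
    have h2 : Filter.Tendsto (fun N : ℕ => ((N:ℂ) + 1) ^ (1 - s)) Filter.atTop (nhds 0) := by
      rw [tendsto_zero_iff_norm_tendsto_zero]
      have h3 := (tendsto_rpow_neg_atTop (y := s.re - 1) (by linarith)).comp
        (tendsto_natCast_atTop_atTop.comp (Filter.tendsto_add_atTop_nat 1))
      refine h3.congr (fun N => ?_)
      have := Complex.norm_cpow_eq_rpow_re_of_pos (x := (N:ℝ) + 1) (by positivity) (1 - s)
      push_cast at this
      rw [this]; simp
    have h3 := h1.add (h2.sub_const 1)
    convert h3 using 2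
    have hne : s ≠ 1 := by rintro rfl; simp at hs1
    have : s - 1 ≠ 0 := sub_ne_zero.2 hne
    rw [riemannZeta_eq_inv_sub_mul hne]
    field_simp; ring

noncomputable def gg (a t x : ℝ) : ℝ := x ^ (a - 1) * Real.exp (-t * x)

lemma gg_anti {a t : ℝ} (ha1 : a < 1) (ht : 0 < t) {x y : ℝ} (hx : 0 < x) (hxy : x ≤ y) :
    gg a t y ≤ gg a t x := by
  unfold gg
  have h1 := Real.rpow_le_rpow_of_nonpos hx hxy (show a - 1 ≤ 0 by linarith)
  have h2 : Real.exp (-t * y) ≤ Real.exp (-t * x) := by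
    apply Real.exp_le_exp.2; nlinarith
  exact mul_le_mul h1 h2 (Real.exp_pos _).le (by positivity)

lemma gg_intOn {a t : ℝ} (ha : 0 < a) (ht : 0 < t) :
    MeasureTheory.IntegrableOn (gg a t) (Set.Ioi 0) := by
  have := gamma_int_aux ha ht
  unfold gg
  simpa using this

lemma gg_intv {a t : ℝ} (ha : 0 < a) (ht : 0 < t) {u v : ℝ} (hu : 0 ≤ u) (hv : u ≤ v) :
    IntervalIntegrable (gg a t) MeasureTheory.volume u v := by
  rw [intervalIntegrable_iff_integrableOn_Ioc_of_le hv]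
  refine (gg_intOn ha ht).mono_set ?_
  intro x hx
  exact lt_of_le_of_lt hu hx.1

lemma gg_tendsto {a : ℝ} (ha : 0 < a) {u v : ℝ} (hu : 0 ≤ u) (hv : u ≤ v) :
    Filter.Tendsto (fun t => ∫ x in u..v, gg a t x) (nhdsWithin 0 (Set.Ioi 0)) (nhds ((v ^ a - u ^ a) / a)) := by
  have hI : ∫ x in u..v, x ^ (a - 1) = (v ^ a - u ^ a) / a := by
    rw [integral_rpow (Or.inl (by linarith))]; simp
  have hii : IntervalIntegrable (fun x : ℝ => x ^ (a - 1)) MeasureTheory.volume u v :=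
    intervalIntegral.intervalIntegrable_rpow' (by linarith)
  have hup : ∀ t, 0 < t → ∫ x in u..v, gg a t x ≤ (v ^ a - u ^ a) / a := by
    intro t ht
    rw [← hI]
    refine intervalIntegral.integral_mono_on hv (gg_intv ha ht hu hv) hii ?_
    intro x hx
    have hx0 : 0 ≤ x := hu.trans hx.1
    unfold gg
    refine mul_le_of_le_one_right (by positivity) ?_
    rw [Real.exp_le_one_iff]; nlinarith
  have hlo : ∀ t, 0 < t → Real.exp (-t * v) * ((v ^ a - u ^ a) / a) ≤ ∫ x in u..v, gg a t x := by
    intro t ht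
    rw [← hI, ← intervalIntegral.integral_const_mul]
    refine intervalIntegral.integral_mono_on hv (hii.const_mul _) (gg_intv ha ht hu hv) ?_
    intro x hx
    have hx0 : 0 ≤ x := hu.trans hx.1
    unfold gg
    rw [mul_comm]
    refine mul_le_mul_of_nonneg_left ?_ (by positivity)
    apply Real.exp_le_exp.2; nlinarith [hx.2]
  refine tendsto_of_tendsto_of_tendsto_of_le_of_le' (g := fun t => Real.exp (-t * v) * ((v ^ a - u ^ a) / a)) (h := fun _ => (v ^ a - u ^ a) / a) ?_ tendsto_const_nhds ?_ ?_
  · refine Filter.Tendsto.mono_left ?_ nhdsWithin_le_nhds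
    have := Continuous.tendsto (f := fun t : ℝ => Real.exp (-t * v) * ((v ^ a - u ^ a) / a)) (by fun_prop) 0
    simpa using this
  · filter_upwards [self_mem_nhdsWithin] with t ht using hlo t ht
  · filter_upwards [self_mem_nhdsWithin] with t ht using hup t ht

noncomputable def qq (a t : ℝ) (d : ℕ) : ℝ := gg a t ((d:ℝ) + 1) - ∫ x in ((d:ℝ) + 1)..((d:ℝ) + 2), gg a t x

lemma qq_bound {a t : ℝ} (ha : 0 < a) (ha1 : a < 1) (ht : 0 < t) (d : ℕ) :
    ‖qq a t d‖ ≤ 2 * ((d:ℝ) + 1) ^ (a - 2) := by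
  set D : ℝ := (d:ℝ) + 1 with hD
  have hD0 : 0 < D := by positivity
  have hD2 : (d:ℝ) + 2 = D + 1 := by rw [hD]; ring
  have hi := gg_intv ha ht hD0.le (show D ≤ D + 1 by linarith)
  have h1 : ∫ x in D..(D + 1), gg a t x ≤ gg a t D := by
    have := intervalIntegral.integral_mono_on (show D ≤ D + 1 by linarith) hi (intervalIntegrable_const (c := gg a t D))
      (fun x hx => gg_anti ha1 ht hD0 hx.1)
    simpa using this
  have h2 : gg a t (D + 1) ≤ ∫ x in D..(D + 1), gg a t x := by
    have := intervalIntegral.integral_mono_on (show D ≤ D + 1 by linarith) (intervalIntegrable_const (c := gg a t (D+1))) hi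
      (fun x hx => gg_anti ha1 ht (lt_of_lt_of_le hD0 hx.1) hx.2)
    simpa using this
  have h3 : gg a t D - gg a t (D + 1) ≤ 2 * D ^ (a - 2) := by
    have e1 : D ^ (a - 2) = D ^ (a - 1) / D := by
      rw [show a - 2 = (a - 1) - 1 by ring, Real.rpow_sub_one hD0.ne']
    have b1 : D ^ (a - 1) - (D + 1) ^ (a - 1) ≤ D ^ (a - 2) := by
      have hx : D / (D + 1) ≤ (D / (D + 1)) ^ (1 - a) := by
        have := Real.rpow_le_rpow_of_exponent_ge (x := D / (D+1)) (y := 1) (z := 1 - a) (by positivity)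
          (by rw [div_le_one (by positivity)]; linarith) (by linarith)
        simpa using this
      have e2 : (D + 1) ^ (a - 1) = D ^ (a - 1) * (D / (D + 1)) ^ (1 - a) := by
        rw [Real.div_rpow hD0.le (by positivity), show a - 1 = -(1 - a) by ring, Real.rpow_neg hD0.le, Real.rpow_neg (by positivity)]
        field_simp
      rw [e2, e1]
      have h4 : D ^ (a - 1) * (1 - D / (D + 1)) ≤ D ^ (a - 1) * (1 / D) := by
        refine mul_le_mul_of_nonneg_left ?_ (by positivity)
        rw [show 1 - D / (D + 1) = 1 / (D + 1) by field_simp; ring]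
        exact one_div_le_one_div_of_le hD0 (by linarith)
      have h5 : D ^ (a - 1) * (D / (D + 1)) ≤ D ^ (a - 1) * (D / (D + 1)) ^ (1 - a) := by gcongr
      have h6 : D ^ (a - 1) * (1 / D) = D ^ (a - 1) / D := by ring
      linarith
    have b2 : t * Real.exp (-t * D) ≤ 1 / D := by
      have h7 : t * D * Real.exp (-(t * D)) ≤ 1 := by
        rw [Real.exp_neg, ← div_eq_mul_inv, div_le_one (Real.exp_pos _)]
        linarith [Real.add_one_le_exp (t * D)]
      rw [le_div_iff₀ hD0, show -t * D = -(t * D) by ring]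
      linarith
    have b3 : 1 - Real.exp (-t) ≤ t := by linarith [Real.add_one_le_exp (-t)]
    have e3 : gg a t D - gg a t (D + 1) = (D ^ (a - 1) - (D + 1) ^ (a - 1)) * Real.exp (-t * D)
        + (D + 1) ^ (a - 1) * (Real.exp (-t * D) * (1 - Real.exp (-t))) := by
      unfold gg
      rw [show -t * (D + 1) = -t * D + -t by ring, Real.exp_add]; ring
    have hm : (D + 1) ^ (a - 1) ≤ D ^ (a - 1) := Real.rpow_le_rpow_of_nonpos hD0 (by linarith) (by linarith)
    have b4 : (D ^ (a - 1) - (D + 1) ^ (a - 1)) * Real.exp (-t * D) ≤ D ^ (a - 2) := by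
      refine le_trans (mul_le_of_le_one_right (by linarith) ?_) b1
      rw [Real.exp_le_one_iff]; nlinarith
    have b5 : (D + 1) ^ (a - 1) * (Real.exp (-t * D) * (1 - Real.exp (-t))) ≤ D ^ (a - 2) := by
      have : Real.exp (-t * D) * (1 - Real.exp (-t)) ≤ 1 / D := by
        refine le_trans ?_ b2
        rw [mul_comm]; gcongr
      calc _ ≤ (D + 1) ^ (a - 1) * (1 / D) := by gcongr
        _ ≤ D ^ (a - 1) * (1 / D) := by gcongr
        _ = _ := by rw [e1]; ring
    linarith
  rw [qq, ← hD, hD2, Real.norm_eq_abs, abs_le]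
  have : 0 ≤ D ^ (a - 2) := by positivity
  constructor <;> linarith

lemma qq_hasSum {a t : ℝ} (ha : 0 < a) (ha1 : a < 1) (ht : 0 < t) :
    ∑' d, qq a t d = (∑' d : ℕ+, (d : ℝ) ^ (a - 1) * Real.exp (-t * d) - Real.Gamma a * t ^ (-a)) + ∫ x in (0:ℝ)..1, gg a t x := by
  have hs : Summable (qq a t) := by
    refine Summable.of_norm_bounded ?_ (qq_bound ha ha1 ht)
    exact (summable_succ_rpow (by linarith)).mul_left _
  have hsg : Summable (fun d : ℕ => gg a t ((d:ℝ) + 1)) := by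
    have hg := (summable_geometric_of_lt_one (Real.exp_pos (-t)).le (Real.exp_lt_one_iff.2 (by linarith)))
    refine Summable.of_nonneg_of_le (fun d => ?_) (fun d => ?_) hg
    · unfold gg; positivity
    · unfold gg
      have h1 : ((d:ℝ) + 1) ^ (a - 1) ≤ 1 := Real.rpow_le_one_of_one_le_of_nonpos (by linarith [Nat.cast_nonneg (α := ℝ) d]) (by linarith)
      have h2 : Real.exp (-t * ((d:ℝ) + 1)) ≤ Real.exp (-t) ^ d := by
        rw [← Real.exp_nat_mul]
        apply Real.exp_le_exp.2; nlinarith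
      calc _ ≤ 1 * Real.exp (-t) ^ d := by gcongr
        _ = _ := one_mul _
  have e1 : ∑' d : ℕ+, (d : ℝ) ^ (a - 1) * Real.exp (-t * d) = ∑' d : ℕ, gg a t ((d:ℝ) + 1) := by
    rw [tsum_pnat_eq_tsum_succ (f := fun d : ℕ => (d : ℝ) ^ (a - 1) * Real.exp (-t * d))]
    simp [gg]
  have hG : ∫ x in Set.Ioi 0, gg a t x = Real.Gamma a * t ^ (-a) := by
    have := Real.integral_rpow_mul_exp_neg_mul_Ioi ha ht
    unfold gg
    rw [Real.rpow_neg ht.le, ← Real.inv_rpow ht.le, ← one_div, mul_comm, ← this]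
    simp
  have hp : ∀ N : ℕ, ∑ d ∈ range N, qq a t d = ∑ d ∈ range N, gg a t ((d:ℝ) + 1) - (∫ x in (0:ℝ)..((N:ℝ) + 1), gg a t x) + ∫ x in (0:ℝ)..1, gg a t x := by
    intro N
    induction N with
    | zero => simp
    | succ N ih =>
      rw [sum_range_succ, ih, sum_range_succ, qq]
      push_cast
      rw [show (N:ℝ) + 1 + 1 = N + 2 by ring]
      have := intervalIntegral.integral_add_adjacent_intervals (gg_intv ha ht (le_refl 0) (show 0 ≤ (N:ℝ) + 1 by positivity)) (gg_intv ha ht (show 0 ≤ (N:ℝ) + 1 by positivity) (show (N:ℝ) + 1 ≤ N + 2 by linarith))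
      rw [← this]; ring
  refine tendsto_nhds_unique hs.hasSum.tendsto_sum_nat ?_
  simp only [hp]
  rw [e1, ← hG]
  refine ((hsg.hasSum.tendsto_sum_nat).sub ?_).add_const _
  exact MeasureTheory.intervalIntegral_tendsto_integral_Ioi 0 (gg_intOn ha ht)
    ((tendsto_natCast_atTop_atTop).atTop_add tendsto_const_nhds)

lemma L3_lt {a : ℝ} (ha : 0 < a) (ha1 : a < 1) :
    Filter.Tendsto (fun y : ℝ => lam (a - 1) (y * Complex.I) - cG a * pw a (y * Complex.I))
      (nhdsWithin 0 (Set.Ioi 0)) (nhds (riemannZeta (1 - a))) := by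
  have hz := zt_hasSum (s := ((1 - a : ℝ) : ℂ)) (by rw [Complex.ofReal_re]; linarith)
  set q0 : ℕ → ℝ := fun d => ((d:ℝ) + 1) ^ (a - 1) - (((d:ℝ) + 2) ^ a - ((d:ℝ) + 1) ^ a) / a with hq0
  have e : ∀ d, zt ((1 - a : ℝ) : ℂ) d = ((-a : ℝ) : ℂ) * ((q0 d : ℝ) : ℂ) := by
    intro d
    rw [zt, hq0]
    have h1 : ((d:ℂ) + 1) ^ (-((1 - a : ℝ) : ℂ)) = ((((d:ℝ) + 1) ^ (a - 1) : ℝ) : ℂ) := by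
      rw [Complex.ofReal_cpow (by positivity)]; push_cast; congr 1; ring
    have h2 : ((d:ℂ) + 2) ^ (1 - ((1 - a : ℝ) : ℂ)) = ((((d:ℝ) + 2) ^ a : ℝ) : ℂ) := by
      rw [Complex.ofReal_cpow (by positivity)]; push_cast; congr 1; ring
    have h3 : ((d:ℂ) + 1) ^ (1 - ((1 - a : ℝ) : ℂ)) = ((((d:ℝ) + 1) ^ a : ℝ) : ℂ) := by
      rw [Complex.ofReal_cpow (by positivity)]; push_cast; congr 1; ring
    rw [h1, h2, h3]
    norm_cast
    field_simp; ring
  have hz' : HasSum (fun d => ((-a : ℝ) : ℂ) * ((q0 d : ℝ) : ℂ)) (riemannZeta₁ ((1 - a : ℝ) : ℂ) - 1) := by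
    simpa only [← e] using hz
  have ha' : ((-a : ℝ) : ℂ) ≠ 0 := by rw [Complex.ofReal_ne_zero]; linarith
  have hne : ((1 - a : ℝ) : ℂ) ≠ 1 := by
    intro h
    have : 1 - a = 1 := by exact_mod_cast h
    linarith
  have hz2 := hz'.mul_left (((-a : ℝ) : ℂ))⁻¹
  simp only [← mul_assoc, inv_mul_cancel₀ ha', one_mul] at hz2
  have hv : (((-a : ℝ) : ℂ))⁻¹ * (riemannZeta₁ ((1 - a : ℝ) : ℂ) - 1) = riemannZeta (1 - a) + ((1 / a : ℝ) : ℂ) := by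
    have := riemannZeta_eq_inv_sub_mul hne
    rw [show (((1 - a : ℝ) : ℂ) - 1) = ((-a : ℝ) : ℂ) by push_cast; ring] at this
    rw [mul_sub, ← this]
    push_cast
    field_simp; ring
  rw [hv] at hz2
  set Lr : ℝ := ∑' d, q0 d - 1 / a with hLr
  have hL : riemannZeta (1 - a) = (Lr : ℂ) := by
    rw [hLr]; push_cast; rw [hz2.tsum_eq]; push_cast; ring
  rw [hL]
  refine L3_of_real ?_
  have h1 : Filter.Tendsto (fun t => ∑' d, qq a t d - ∫ x in (0:ℝ)..1, gg a t x) (nhdsWithin 0 (Set.Ioi 0)) (nhds Lr) := by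
    refine Filter.Tendsto.sub ?_ ?_
    · refine tendsto_tsum_of_dominated_convergence (bound := fun d : ℕ => 2 * ((d:ℝ) + 1) ^ (a - 2))
        ((summable_succ_rpow (by linarith)).mul_left _) ?_ ?_
      · intro d
        refine Filter.Tendsto.sub ?_ (gg_tendsto ha (by positivity) (by linarith))
        refine Filter.Tendsto.mono_left ?_ nhdsWithin_le_nhds
        have := Continuous.tendsto (f := fun t : ℝ => gg a t ((d:ℝ) + 1)) (by unfold gg; fun_prop) 0
        simpa [gg] using this
      · filter_upwards [self_mem_nhdsWithin] with t ht d using qq_bound ha ha1 ht d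
    · have := gg_tendsto ha (le_refl 0) zero_le_one
      simpa [Real.zero_rpow ha.ne'] using this
  refine h1.congr' ?_
  filter_upwards [self_mem_nhdsWithin] with t ht
  rw [qq_hasSum ha ha1 ht]; ring

lemma L3 {a : ℝ} (ha : 0 < a) :
    Filter.Tendsto (fun y : ℝ => lam (a - 1) (y * Complex.I) - cG a * pw a (y * Complex.I))
      (nhdsWithin 0 (Set.Ioi 0)) (nhds (riemannZeta (1 - a))) := by
  rcases lt_trichotomy a 1 with h | rfl | h
  · exact L3_lt ha h
  · exact L3_one
  · exact L3_gt h


lemma summable_pnat_exp (s : ℝ) {c : ℝ} (hc : 0 < c) :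
    Summable (fun d : ℕ+ => (d : ℝ) ^ s * Real.exp (-(c * d))) := by
  have h1 := Real.summable_pow_mul_exp_neg_nat_mul ⌈s⌉₊ hc
  have h2 : Summable (fun d : ℕ+ => ((d:ℕ):ℝ) ^ ⌈s⌉₊ * Real.exp (-c * (d:ℕ))) :=
    h1.comp_injective (i := fun d : ℕ+ => (d:ℕ)) PNat.coe_injective
  refine Summable.of_nonneg_of_le (fun d => by positivity) (fun d => ?_) h2
  rw [neg_mul]
  refine mul_le_mul_of_nonneg_right ?_ (Real.exp_pos _).le
  rw [← Real.rpow_natCast]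
  exact Real.rpow_le_rpow_of_exponent_le (by exact_mod_cast d.pos) (Nat.le_ceil s)

lemma lam_term_norm (s : ℝ) (z : ℂ) (d : ℕ+) :
    ‖(((d : ℝ) ^ s : ℝ) : ℂ) * ee (d * z)‖ = (d:ℝ) ^ s * Real.exp (-(2 * Real.pi * z.im * d)) := by
  rw [norm_mul, norm_ee, Complex.norm_real, Real.norm_of_nonneg (by positivity)]
  congr 2
  simp; ring

lemma lam_summable (s : ℝ) {z : ℂ} (hz : 0 < z.im) :
    Summable (fun d : ℕ+ => (((d : ℝ) ^ s : ℝ) : ℂ) * ee (d * z)) := by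
  refine Summable.of_norm ?_
  simp only [lam_term_norm]
  exact summable_pnat_exp s (by positivity)

lemma ee_hasDeriv (c z : ℂ) : HasDerivAt (fun z => ee (c * z)) (2 * Real.pi * Complex.I * c * ee (c * z)) z := by
  have h1 : HasDerivAt (fun z : ℂ => 2 * Real.pi * Complex.I * (c * z)) (2 * Real.pi * Complex.I * c) z := by
    have := ((hasDerivAt_id' z).const_mul c).const_mul (2 * Real.pi * Complex.I)
    simpa only [mul_one] using this
  have h2 := h1.cexp
  unfold ee
  refine h2.congr_deriv ?_
  ring

lemma lam_hasDeriv (s : ℝ) {z : ℂ} (hz : 0 < z.im) :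
    HasDerivAt (lam (s - 1)) (2 * Real.pi * Complex.I * lam s z) z := by
  have h := hasDerivAt_tsum_of_isPreconnected
    (u := fun d : ℕ+ => (2 * Real.pi) * ((d:ℝ) ^ s * Real.exp (-(2 * Real.pi * (z.im / 2) * d))))
    (t := {w : ℂ | z.im / 2 < w.im})
    (g := fun (d : ℕ+) w => (((d : ℝ) ^ (s - 1) : ℝ) : ℂ) * ee (d * w))
    (g' := fun (d : ℕ+) w => (((d : ℝ) ^ (s - 1) : ℝ) : ℂ) * (2 * Real.pi * Complex.I * d * ee (d * w)))
    (y₀ := z) (y := z)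
    ((summable_pnat_exp s (by positivity)).mul_left _)
    (isOpen_lt continuous_const Complex.continuous_im)
    (convex_halfSpace_im_gt _).isPreconnected
    (fun d w hw => (ee_hasDeriv d w).const_mul _)
    (by
      intro d w hw
      have hw' : z.im / 2 < w.im := hw
      have e1 : (((d : ℝ) ^ (s - 1) : ℝ) : ℂ) * (2 * Real.pi * Complex.I * d * ee (d * w))
        = 2 * Real.pi * Complex.I * ((((d : ℝ) ^ s : ℝ) : ℂ) * ee (d * w)) := by
        have : (d:ℝ) ^ s = (d:ℝ) ^ (s - 1) * d := by
          rw [Real.rpow_sub_one (by positivity)]; field_simp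
        rw [this]; push_cast; ring
      rw [e1, norm_mul, lam_term_norm]
      have : ‖2 * (Real.pi : ℂ) * Complex.I‖ = 2 * Real.pi := by simp [abs_of_pos Real.pi_pos]
      rw [this]
      gcongr)
    (by simp; linarith) (lam_summable _ hz) (by simp; linarith)
  have e2 : (∑' d : ℕ+, (((d : ℝ) ^ (s - 1) : ℝ) : ℂ) * (2 * Real.pi * Complex.I * d * ee (d * z)))
      = 2 * Real.pi * Complex.I * lam s z := by
    rw [lam, ← tsum_mul_left]
    refine tsum_congr (fun d => ?_)
    have : (d:ℝ) ^ s = (d:ℝ) ^ (s - 1) * d := by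
      rw [Real.rpow_sub_one (by positivity)]; field_simp
    rw [this]; push_cast; ring
  rw [e2] at h
  exact h

noncomputable def Pp (a : ℝ) (u : ℂ) : ℂ := lam a u - cG (a + 1) * pw (a + 1) u
noncomputable def KK (a : ℝ) (u : ℂ) : ℂ := lam (a - 1) u - cG a * pw a u

lemma cG_succ {s : ℝ} (hs : 0 < s) : s * cG s = 2 * Real.pi * cG (s + 1) := by
  unfold cG
  rw [Real.Gamma_add_one hs.ne', show -(s + 1) = -s - 1 by ring, Real.rpow_sub_one (by positivity)]
  have := Real.pi_pos
  field_simp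

lemma cG_pos {s : ℝ} (hs : 0 < s) : 0 < cG s := by
  unfold cG
  have := Real.Gamma_pos_of_pos hs
  positivity

lemma KK_hasDeriv {a : ℝ} (ha : 0 < a) {u : ℂ} (hu : 0 < u.im) :
    HasDerivAt (KK a) (2 * Real.pi * Complex.I * Pp a u) u := by
  have hu0 : u ≠ 0 := by rintro rfl; simp at hu
  have h := (lam_hasDeriv a hu).sub ((pw_hasDeriv a hu.le hu0).const_mul (cG a : ℂ))
  refine h.congr_deriv ?_
  have hc : (a:ℂ) * cG a = 2 * Real.pi * cG (a + 1) := by exact_mod_cast cG_succ ha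
  rw [Pp]
  linear_combination (-Complex.I * pw (a+1) u) * hc

lemma Pp_hasSum {a : ℝ} (ha : 0 < a) {u : ℂ} (hu : 0 < u.im) :
    HasSum (fun l : ℤ => if l = 0 then 0 else (cG (a+1) : ℂ) * pw (a+1) (u + l)) (Pp a u) := by
  have h := lipschitz (s := a + 1) (by linarith) hu
  have h2 := hasSum_ite_sub_hasSum h 0
  simpa [Pp] using h2

lemma norm_add_int {u : ℂ} (hu : ‖u‖ ≤ 1/2) {l : ℤ} (hl : l ≠ 0) : |(l:ℝ)| / 2 ≤ ‖u + l‖ := by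
  have h1 : (1:ℝ) ≤ |(l:ℝ)| := by
    have := Int.one_le_abs hl
    exact_mod_cast this
  have h2 := norm_sub_norm_le (l:ℂ) (-u)
  rw [norm_neg, sub_neg_eq_add, add_comm] at h2
  have h3 : ‖(l:ℂ)‖ = |(l:ℝ)| := by simp
  rw [h3] at h2
  linarith

lemma Pp_bdd {a : ℝ} (ha : 0 < a) : ∃ C : ℝ, 0 ≤ C ∧ ∀ u : ℂ, 0 < u.im → ‖u‖ ≤ 1/2 → ‖Pp a u‖ ≤ C := by
  have hs : Summable (fun l : ℤ => cG (a+1) * ((2:ℝ) ^ (a+1) * |(l:ℝ)| ^ (-(a+1)))) :=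
    ((Real.summable_abs_int_rpow (show 1 < a + 1 by linarith)).mul_left _).mul_left _
  have hc := cG_pos (show 0 < a + 1 by linarith)
  refine ⟨∑' l : ℤ, cG (a+1) * ((2:ℝ) ^ (a+1) * |(l:ℝ)| ^ (-(a+1))), tsum_nonneg (fun l => by positivity), fun u hu hu2 => ?_⟩
  rw [← (Pp_hasSum ha hu).tsum_eq]
  refine tsum_of_norm_bounded hs.hasSum (fun l => ?_)
  by_cases hl : l = 0
  · simp only [hl, if_true, norm_zero]; positivity
  · simp only [hl, if_false, norm_mul, Complex.norm_real, norm_pw]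
    rw [Real.norm_of_nonneg hc.le]
    refine mul_le_mul_of_nonneg_left ?_ hc.le
    have hl' : 0 < |(l:ℝ)| := by positivity
    refine (Real.rpow_le_rpow_of_nonpos (by positivity) (norm_add_int hu2 hl) (by linarith)).trans (le_of_eq ?_)
    rw [Real.div_rpow hl'.le (by norm_num), Real.rpow_neg (by norm_num : (0:ℝ) ≤ 2)]
    field_simp

lemma KK_tendsto_zero {a : ℝ} (ha : 0 < a) :
    Filter.Tendsto (KK a) (nhdsWithin 0 {u : ℂ | 0 < u.im}) (nhds (riemannZeta (1 - a))) := by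
  obtain ⟨C, hC0, hC⟩ := Pp_bdd ha
  have hn : Filter.Tendsto (fun u : ℂ => ‖u‖) (nhdsWithin 0 {u : ℂ | 0 < u.im}) (nhdsWithin 0 (Set.Ioi 0)) := by
    refine tendsto_nhdsWithin_iff.2 ⟨?_, ?_⟩
    · refine Filter.Tendsto.mono_left ?_ nhdsWithin_le_nhds
      have := Continuous.tendsto (f := fun u : ℂ => ‖u‖) (by fun_prop) 0
      simpa using this
    · filter_upwards [self_mem_nhdsWithin] with u hu
      have hu' : 0 < u.im := hu
      exact norm_pos_iff.2 (by rintro rfl; simp at hu')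
  have h1 : Filter.Tendsto (fun u : ℂ => KK a ((‖u‖ : ℝ) * Complex.I)) (nhdsWithin 0 {u : ℂ | 0 < u.im}) (nhds (riemannZeta (1 - a))) :=
    (L3 ha).comp hn
  have h2 : Filter.Tendsto (fun u : ℂ => KK a u - KK a ((‖u‖ : ℝ) * Complex.I)) (nhdsWithin 0 {u : ℂ | 0 < u.im}) (nhds 0) := by
    refine squeeze_zero_norm' (a := fun u : ℂ => (2 * Real.pi * C) * (2 * ‖u‖)) ?_ ?_
    · have hb : Metric.ball (0:ℂ) (1/2) ∈ nhdsWithin (0:ℂ) {u : ℂ | 0 < u.im} :=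
        mem_nhdsWithin_of_mem_nhds (Metric.ball_mem_nhds _ (by norm_num))
      filter_upwards [self_mem_nhdsWithin, hb] with u hu hub
      have hu' : 0 < u.im := hu
      have hub' : ‖u‖ < 1/2 := by simpa using hub
      have hup : 0 < ‖u‖ := norm_pos_iff.2 (by rintro rfl; simp at hu')
      have := Convex.norm_image_sub_le_of_norm_hasDerivWithin_le (𝕜 := ℂ) (f := KK a)
        (f' := fun u => 2 * Real.pi * Complex.I * Pp a u)
        (s := {w : ℂ | 0 < w.im} ∩ Metric.closedBall 0 (1/2)) (C := 2 * Real.pi * C)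
        (x := (‖u‖ : ℝ) * Complex.I) (y := u)
        (fun w hw => (KK_hasDeriv ha hw.1).hasDerivWithinAt)
        (by
          intro w hw
          have h3 : ‖2 * (Real.pi : ℂ) * Complex.I‖ = 2 * Real.pi := by simp [abs_of_pos Real.pi_pos]
          rw [norm_mul, h3]
          have := hC w hw.1 (by simpa using hw.2)
          have := Real.pi_pos
          gcongr)
        ((convex_halfSpace_im_gt 0).inter (convex_closedBall _ _))
        ⟨by simpa using hup, by simpa using hub'.le⟩ ⟨hu', by simpa using hub'.le⟩
      refine this.trans ?_
      refine mul_le_mul_of_nonneg_left ?_ (by positivity)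
      refine (norm_sub_le _ _).trans ?_
      simp; linarith
    · refine Filter.Tendsto.mono_left ?_ nhdsWithin_le_nhds
      have := Continuous.tendsto (f := fun u : ℂ => (2 * Real.pi * C) * (2 * ‖u‖)) (by fun_prop) 0
      simpa using this
  have := h2.add h1
  simpa using this

lemma KK_tendsto_inf {a : ℝ} (ha : 0 < a) {v : ℂ} (hv : 0 < v.im) :
    Filter.Tendsto (fun N : ℕ => KK a ((N:ℝ) * v)) Filter.atTop (nhds 0) := by
  have hv0 : v ≠ 0 := by rintro rfl; simp at hv
  have h1 : Filter.Tendsto (fun N : ℕ => lam (a - 1) ((N:ℝ) * v)) Filter.atTop (nhds 0) := by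
    set S := ∑' d : ℕ+, (d:ℝ) ^ (a - 1) * Real.exp (-(2 * Real.pi * v.im * d)) with hS
    refine squeeze_zero_norm' (a := fun N : ℕ => Real.exp (-(2 * Real.pi * v.im * ((N:ℝ) - 1))) * S) ?_ ?_
    · filter_upwards [Filter.eventually_ge_atTop 1] with N hN
      have hN' : (1:ℝ) ≤ N := by exact_mod_cast hN
      have hs := (summable_pnat_exp (a - 1) (show 0 < 2 * Real.pi * v.im by positivity)).hasSum.mul_left (Real.exp (-(2 * Real.pi * v.im * ((N:ℝ) - 1))))
      refine tsum_of_norm_bounded hs (fun d => ?_)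
      rw [lam_term_norm, mul_left_comm, ← Real.exp_add]
      refine mul_le_mul_of_nonneg_left ?_ (by positivity)
      apply Real.exp_le_exp.2
      have e1 : (((N:ℝ):ℂ) * v).im = N * v.im := by simp
      rw [e1]
      have hd : (1:ℝ) ≤ d := by exact_mod_cast d.pos
      have : 0 ≤ (2 * Real.pi * v.im) * (((N:ℝ) - 1) * (d - 1)) := by
        have := Real.pi_pos
        have h3 : 0 ≤ ((N:ℝ) - 1) * (d - 1) := mul_nonneg (by linarith) (by linarith)
        positivity
      nlinarith
    · have h4 : Filter.Tendsto (fun N : ℕ => (2 * Real.pi * v.im * ((N:ℝ) - 1))) Filter.atTop Filter.atTop := by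
        refine Filter.Tendsto.const_mul_atTop (by positivity) ?_
        exact Filter.tendsto_atTop_add_const_right _ (-1) tendsto_natCast_atTop_atTop
      have := (Real.tendsto_exp_neg_atTop_nhds_zero.comp h4).mul_const S
      simpa using this
  have h2 : Filter.Tendsto (fun N : ℕ => (cG a : ℂ) * pw a ((N:ℝ) * v)) Filter.atTop (nhds 0) := by
    have h3 : Filter.Tendsto (fun N : ℕ => pw a ((N:ℝ) * v)) Filter.atTop (nhds 0) := by
      rw [tendsto_zero_iff_norm_tendsto_zero]
      have h4 := ((tendsto_rpow_neg_atTop ha).comp tendsto_natCast_atTop_atTop).mul_const (‖v‖ ^ (-a))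
      rw [zero_mul] at h4
      refine h4.congr (fun N => ?_)
      rw [norm_pw, norm_mul, Complex.norm_real, Real.norm_of_nonneg (by positivity), Real.mul_rpow (by positivity) (norm_nonneg _)]
      rfl
    have := h3.const_mul (cG a : ℂ)
    simpa using this
  have := h1.sub h2
  simpa [KK] using this

lemma Pp_cont (a : ℝ) : ContinuousOn (Pp a) {u : ℂ | 0 < u.im} := by
  intro u hu
  have hu' : 0 < u.im := hu
  have hu0 : u ≠ 0 := by rintro rfl; simp at hu'
  have h1 := lam_hasDeriv (a + 1) hu'
  rw [add_sub_cancel_right] at h1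
  have := h1.continuousAt.sub ((pw_hasDeriv (a+1) hu'.le hu0).continuousAt.const_mul (cG (a+1) : ℂ))
  exact this.continuousWithinAt

lemma Pp_intv {a : ℝ} (ha : 0 < a) {v : ℂ} (hv : 0 < v.im) {N : ℝ} (hN : 0 ≤ N) :
    IntervalIntegrable (fun t : ℝ => Pp a (t * v)) MeasureTheory.volume 0 N := by
  have hv0 : v ≠ 0 := by rintro rfl; simp at hv
  have hvp : 0 < ‖v‖ := norm_pos_iff.2 hv0
  obtain ⟨C, hC0, hC⟩ := Pp_bdd ha
  have hcont : ContinuousOn (fun t : ℝ => Pp a (t * v)) (Set.Ioi 0) := by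
    refine (Pp_cont a).comp (by fun_prop) (fun t ht => ?_)
    have ht' : 0 < t := ht
    simp only [Set.mem_ofPred_eq, Complex.mul_im, Complex.ofReal_re, Complex.ofReal_im, zero_mul, add_zero]
    positivity
  set δ : ℝ := 1 / (2 * ‖v‖) with hδ
  have hδ0 : 0 < δ := by positivity
  have i1 : IntervalIntegrable (fun t : ℝ => Pp a (t * v)) MeasureTheory.volume 0 δ := by
    rw [intervalIntegrable_iff_integrableOn_Ioc_of_le hδ0.le]
    refine MeasureTheory.Integrable.mono' (g := fun _ => C) (MeasureTheory.integrable_const C) ?_ ?_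
    · exact (hcont.mono (fun t ht => ht.1)).aestronglyMeasurable measurableSet_Ioc
    · refine (MeasureTheory.ae_restrict_iff' measurableSet_Ioc).2 (Filter.Eventually.of_forall (fun t ht => ?_))
      refine hC _ ?_ ?_
      · have := ht.1
        simp only [Complex.mul_im, Complex.ofReal_re, Complex.ofReal_im, zero_mul, add_zero]
        positivity
      · rw [norm_mul, Complex.norm_real, Real.norm_of_nonneg ht.1.le]
        have := ht.2
        rw [hδ, le_div_iff₀ (by positivity)] at this
        linarith
  rcases hN.eq_or_lt with rfl | hN
  · simp
  refine i1.trans (ContinuousOn.intervalIntegrable (hcont.mono ?_))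
  intro t ht
  rw [Set.mem_uIcc] at ht
  simp only [Set.mem_Ioi]
  rcases ht with h | h <;> linarith [h.1]

lemma L2 {a : ℝ} (ha : 0 < a) {v : ℂ} (hv : 0 < v.im) {N : ℕ} (hN : 0 < N) :
    ∫ t in (0:ℝ)..N, Pp a (t * v) = (KK a ((N:ℝ) * v) - riemannZeta (1 - a)) / (2 * Real.pi * Complex.I * v) := by
  have hN' : (0:ℝ) < N := by exact_mod_cast hN
  have hv0 : v ≠ 0 := by rintro rfl; simp at hv
  have him : ∀ t : ℝ, 0 < t → 0 < ((t:ℂ) * v).im := by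
    intro t ht
    simp only [Complex.mul_im, Complex.ofReal_re, Complex.ofReal_im, zero_mul, add_zero]
    positivity
  have hI := intervalIntegral.integral_eq_sub_of_hasDerivAt_of_le
    (f := fun t : ℝ => if t = 0 then riemannZeta (1 - a) else KK a (t * v))
    (f' := fun t : ℝ => 2 * Real.pi * Complex.I * v * Pp a (t * v))
    (a := 0) (b := N) hN'.le
    (by
      intro t ht
      rcases ht.1.eq_or_lt with h0 | h0
      · rw [← h0]
        refine ContinuousWithinAt.mono (t := insert 0 (Set.Ioi 0)) ?_ (by
          intro x hx
          rcases hx.1.eq_or_lt with h | h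
          · left; exact h.symm
          · right; exact h)
        rw [continuousWithinAt_insert_self]
        show Filter.Tendsto _ _ _
        simp only [if_true]
        have hm : Filter.Tendsto (fun t : ℝ => (t:ℂ) * v) (nhdsWithin 0 (Set.Ioi 0)) (nhdsWithin 0 {u : ℂ | 0 < u.im}) := by
          refine tendsto_nhdsWithin_iff.2 ⟨?_, ?_⟩
          · refine Filter.Tendsto.mono_left ?_ nhdsWithin_le_nhds
            have := Continuous.tendsto (f := fun t : ℝ => (t:ℂ) * v) (by fun_prop) 0
            simpa using this
          · filter_upwards [self_mem_nhdsWithin] with t ht using him t ht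
        refine ((KK_tendsto_zero ha).comp hm).congr' ?_
        filter_upwards [self_mem_nhdsWithin] with t ht
        have : t ≠ 0 := ne_of_gt ht
        simp [this]
      · have hc : ContinuousAt (fun t : ℝ => KK a (t * v)) t := by
          refine ContinuousAt.comp (f := fun t : ℝ => (t:ℂ) * v) (g := KK a) (KK_hasDeriv ha (him t h0)).continuousAt (by fun_prop)
        refine (hc.congr ?_).continuousWithinAt
        filter_upwards [eventually_ne_nhds h0.ne'] with x hx
        simp [hx])
    (by
      intro t ht
      have h1 : HasDerivAt (fun t : ℝ => KK a (t * v)) (2 * Real.pi * Complex.I * v * Pp a (t * v)) t := by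
        have h2 : HasDerivAt (fun t : ℝ => (t:ℂ) * v) v t := by
          simpa using (Complex.ofRealCLM.hasDerivAt (x := t)).mul_const v
        have h3 := (KK_hasDeriv ha (him t ht.1)).comp t h2
        refine h3.congr_deriv ?_
        ring
      refine h1.congr_of_eventuallyEq ?_
      filter_upwards [eventually_ne_nhds ht.1.ne'] with x hx
      simp [hx])
    ((Pp_intv ha hv hN'.le).const_mul _)
  rw [intervalIntegral.integral_const_mul] at hI
  simp only [if_true, hN'.ne', if_false] at hI
  rw [← hI]
  have : (2 * Real.pi * Complex.I * v) ≠ 0 := by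
    have : (Real.pi : ℂ) ≠ 0 := by exact_mod_cast Real.pi_ne_zero
    simp [this, hv0, Complex.I_ne_zero]
  rw [mul_div_cancel_left₀ _ this]


noncomputable def JJ (p : ℝ) : ℝ := ∫ s : ℝ, (1 + s ^ 2) ^ (-p / 2)

lemma JJ_nonneg (p : ℝ) : 0 ≤ JJ p :=
  MeasureTheory.integral_nonneg (fun s => by positivity)

lemma J_int {p : ℝ} (hp : 1 < p) (w v : ℂ) (hv : v ≠ 0) (hd : (w * (starRingEnd ℂ) v).im ≠ 0) :
    MeasureTheory.Integrable (fun t : ℝ => ‖w + t * v‖ ^ (-p)) ∧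
    ∫ t : ℝ, ‖w + t * v‖ ^ (-p) = JJ p * ((|(w * (starRingEnd ℂ) v).im| / ‖v‖) ^ (1 - p) / ‖v‖) := by
  have hV : 0 < ‖v‖ := norm_pos_iff.2 hv
  set V := ‖v‖ with hVdef
  set d := |(w * (starRingEnd ℂ) v).im| / V with hddef
  have hd0 : 0 < d := by rw [hddef]; have := abs_pos.2 hd; positivity
  set t0 : ℝ := -(w * (starRingEnd ℂ) v).re / V ^ 2 with ht0
  have hsq : ∀ t : ℝ, ‖w + t * v‖ ^ 2 = d ^ 2 * (1 + (V / d * (t - t0)) ^ 2) := by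
    intro t
    have h1 : ‖w + t * v‖ ^ 2 * V ^ 2 = ((w * (starRingEnd ℂ) v).re + t * V ^ 2) ^ 2 + (w * (starRingEnd ℂ) v).im ^ 2 := by
      rw [hVdef, ← Complex.normSq_eq_norm_sq, ← Complex.normSq_eq_norm_sq]
      simp only [Complex.normSq_apply, Complex.add_re, Complex.add_im, Complex.mul_re, Complex.mul_im, Complex.ofReal_re, Complex.ofReal_im, Complex.conj_re, Complex.conj_im]
      ring
    have h2 : d ^ 2 * V ^ 2 = (w * (starRingEnd ℂ) v).im ^ 2 := by
      rw [hddef, div_pow, sq_abs]; field_simp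
    have h3 : (w * (starRingEnd ℂ) v).re = - t0 * V ^ 2 := by rw [ht0]; field_simp
    have hV2 : V ^ 2 ≠ 0 := by positivity
    apply mul_right_cancel₀ hV2
    rw [h1, ← h2, h3]; field_simp; ring
  have hf : ∀ t : ℝ, ‖w + t * v‖ ^ (-p) = d ^ (-p) * (1 + (V / d * (t - t0)) ^ 2) ^ (-p / 2) := by
    intro t
    rw [show (-p : ℝ) = 2 * (-p / 2) by ring, Real.rpow_mul (norm_nonneg _), Real.rpow_mul hd0.le]
    norm_num only [Real.rpow_ofNat]
    rw [hsq t, Real.mul_rpow (by positivity) (by positivity)]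
    congr 2 <;> ring
  have hc : V / d ≠ 0 := by positivity
  have hi0 : MeasureTheory.Integrable (fun s : ℝ => (1 + s ^ 2) ^ (-p / 2)) := by
    have := integrable_rpow_neg_one_add_norm_sq (E := ℝ) (μ := MeasureTheory.volume) (r := p) (by simpa using hp)
    simpa using this
  have hi1 : MeasureTheory.Integrable (fun t : ℝ => (1 + (V / d * (t - t0)) ^ 2) ^ (-p / 2)) :=
    (hi0.comp_mul_left' hc).comp_sub_right t0
  simp only [hf]
  refine ⟨hi1.const_mul _, ?_⟩
  rw [MeasureTheory.integral_const_mul,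
    MeasureTheory.integral_sub_right_eq_self (fun t : ℝ => (1 + (V / d * t) ^ 2) ^ (-p / 2)) t0,
    MeasureTheory.Measure.integral_comp_mul_left (fun t : ℝ => (1 + t ^ 2) ^ (-p / 2))]
  rw [smul_eq_mul, ← JJ, abs_of_pos (by positivity), sub_eq_neg_add, Real.rpow_add_one hd0.ne']
  field_simp

lemma J_real {p : ℝ} (hp : 1 < p) {r : ℝ} (hr : r ≠ 0) {v : ℂ} (hv : 0 < v.im) :
    MeasureTheory.Integrable (fun t : ℝ => ‖(r:ℂ) + t * v‖ ^ (-p)) ∧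
    ∫ t : ℝ, ‖(r:ℂ) + t * v‖ ^ (-p) = JJ p * ((|r| * (v.im / ‖v‖)) ^ (1 - p) / ‖v‖) := by
  have e : ((r:ℂ) * (starRingEnd ℂ) v).im = -(r * v.im) := by simp
  have hv0 : v ≠ 0 := by rintro rfl; simp at hv
  have := J_int hp r v hv0 (by rw [e]; simp [hr, hv.ne'])
  rw [e, abs_neg, abs_mul, abs_of_pos hv, mul_div_assoc] at this
  exact this

lemma J_line {p : ℝ} (hp : 1 < p) {y : ℝ} (hy : 0 < y) :
    MeasureTheory.Integrable (fun t : ℝ => ‖(t:ℂ) + y * Complex.I‖ ^ (-p)) ∧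
    ∫ t : ℝ, ‖(t:ℂ) + y * Complex.I‖ ^ (-p) = JJ p * y ^ (1 - p) := by
  have := J_int hp (y * Complex.I) 1 one_ne_zero (by simpa using hy.ne')
  simpa [add_comm, abs_of_pos hy] using this

lemma row_equiv (q : ℕ) (hq : 0 < q) (h : ℤ) (hc : IsCoprime h (q:ℤ)) (j : ℕ) :
    ∃ e : Fin q × ℤ ≃ ℤ, (∀ x, e x = ((q:ℤ) * j + x.1 + 1) * h + x.2 * q) ∧
      (∀ x, e x = 0 → (x.1 : ℕ) + 1 = q) := by
  have hq' : (0:ℤ) < q := by exact_mod_cast hq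
  have hbij : Function.Bijective (fun x : Fin q × ℤ => ((q:ℤ) * j + x.1 + 1) * h + x.2 * q) := by
    constructor
    · rintro ⟨c, l⟩ ⟨c', l'⟩ hE
      simp only at hE
      have hd : (q:ℤ) ∣ ((c:ℤ) - c') := by
        have h1 : (q:ℤ) ∣ ((c:ℤ) - c') * h := ⟨l' - l, by linear_combination hE⟩
        exact hc.symm.dvd_of_dvd_mul_right h1
      have hcc : (c:ℤ) = c' := by
        have h1 := c.2; have h2 := c'.2
        have h3 := Int.eq_zero_of_abs_lt_dvd hd (by rw [abs_lt]; constructor <;> omega)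
        linarith
      have hll : l = l' := by
        rw [hcc] at hE
        have : l * (q:ℤ) = l' * q := by linarith
        exact mul_right_cancel₀ hq'.ne' this
      ext
      · exact_mod_cast hcc
      · simpa using hll
    · intro r
      obtain ⟨x, y, hxy⟩ := hc
      have h0 : 0 ≤ (r * x - 1) % (q:ℤ) := Int.emod_nonneg _ hq'.ne'
      have h1 : (r * x - 1) % (q:ℤ) < q := Int.emod_lt_of_pos _ hq'
      refine ⟨(⟨((r * x - 1) % (q:ℤ)).toNat, by omega⟩, r * y + ((r * x - 1) / (q:ℤ)) * h - j * h), ?_⟩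
      simp only [Int.toNat_of_nonneg h0]
      have h2 := Int.emod_add_mul_ediv (r * x - 1) q
      linear_combination r * hxy + h * h2
  refine ⟨Equiv.ofBijective _ hbij, fun x => rfl, ?_⟩
  intro x hx
  have hx' : ((q:ℤ) * j + x.1 + 1) * h + x.2 * q = 0 := hx
  have hd : (q:ℤ) ∣ ((x.1:ℤ) + 1) := by
    have h1 : (q:ℤ) ∣ ((x.1:ℤ) + 1) * h := ⟨-x.2 - j * h, by linear_combination hx'⟩
    exact hc.symm.dvd_of_dvd_mul_right h1
  have h1 := Int.le_of_dvd (by positivity) hd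
  have h2 := x.1.2
  omega

lemma row_id (q : ℕ) (hq : 0 < q) (h : ℤ) (z : ℂ) (m l : ℂ) :
    m * z + l = ((q:ℝ)⁻¹ : ℝ) * ((m * h + l * q) + (m / q) * (q * (q * z - h))) := by
  have : (q:ℂ) ≠ 0 := by exact_mod_cast hq.ne'
  push_cast
  field_simp; ring


lemma osc_bound {f f' : ℝ → ℂ} {j x : ℝ} (hx : x ∈ Set.Icc j (j + 1))
    (hf : ∀ t ∈ Set.Icc j (j + 1), HasDerivAt f (f' t) t) (hf' : ContinuousOn f' (Set.Icc j (j + 1))) :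
    ‖f x - ∫ t in j..(j + 1), f t‖ ≤ ∫ t in j..(j + 1), ‖f' t‖ := by
  have hj : j ≤ j + 1 := by linarith
  have hu : Set.uIcc j (j + 1) = Set.Icc j (j + 1) := Set.uIcc_of_le hj
  have hcf : ContinuousOn f (Set.Icc j (j + 1)) := fun t ht => (hf t ht).continuousAt.continuousWithinAt
  have hif : IntervalIntegrable f MeasureTheory.volume j (j + 1) := (hu ▸ hcf : ContinuousOn f (Set.uIcc j (j+1))).intervalIntegrable
  have hin : IntervalIntegrable (fun t => ‖f' t‖) MeasureTheory.volume j (j + 1) :=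
    (hu ▸ hf'.norm : ContinuousOn (fun t => ‖f' t‖) (Set.uIcc j (j+1))).intervalIntegrable
  have e1 : f x - ∫ t in j..(j + 1), f t = ∫ t in j..(j + 1), (f x - f t) := by
    rw [intervalIntegral.integral_sub intervalIntegrable_const hif]; simp
  rw [e1]
  have h1 : ∀ t ∈ Set.uIoc j (j + 1), ‖f x - f t‖ ≤ ∫ t in j..(j + 1), ‖f' t‖ := by
    intro t ht
    rw [Set.uIoc_of_le hj] at ht
    have ht' : t ∈ Set.Icc j (j+1) := ⟨ht.1.le, ht.2⟩
    have hsub : Set.uIcc t x ⊆ Set.Icc j (j + 1) := Set.uIcc_subset_Icc ht' hx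
    have h2 : ∫ s in t..x, f' s = f x - f t :=
      intervalIntegral.integral_eq_sub_of_hasDerivAt (fun s hs => hf s (hsub hs)) ((hf'.mono hsub).intervalIntegrable)
    rw [← h2]
    refine (intervalIntegral.norm_integral_le_integral_norm_uIoc).trans ?_
    rw [intervalIntegral.integral_of_le hj]
    refine MeasureTheory.setIntegral_mono_set ((intervalIntegrable_iff_integrableOn_Ioc_of_le hj).1 hin) (Filter.Eventually.of_forall (fun s => norm_nonneg _)) ?_
    refine Filter.Eventually.of_forall ?_
    intro s hs
    have hs' : s ∈ Set.uIoc t x := hs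
    rw [Set.mem_uIoc] at hs'
    show s ∈ Set.Ioc j (j+1)
    rcases hs' with h | h
    · exact ⟨lt_of_le_of_lt ht.1.le h.1, h.2.trans hx.2⟩
    · exact ⟨lt_of_le_of_lt hx.1 h.1, h.2.trans ht.2⟩
  have := intervalIntegral.norm_integral_le_of_norm_le_const h1
  simpa using this

lemma fin_prod_hasSum {q : ℕ} {f : Fin q × ℤ → ℂ} {g : Fin q → ℂ} (h : ∀ c, HasSum (fun l => f (c, l)) (g c))
    (hn : ∀ c, Summable (fun l => ‖f (c, l)‖)) : HasSum f (∑ c, g c) := by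
  have hs : Summable f := by
    refine Summable.of_norm ?_
    rw [summable_prod_of_nonneg (fun x => norm_nonneg _)]
    exact ⟨hn, Summable.of_finite⟩
  have h2 := hs.hasSum.prod_fiberwise h
  have h3 := h2.unique (hasSum_fintype g)
  rw [← h3]
  exact hs.hasSum

lemma line_ne {v : ℂ} (hv : 0 < v.im) {r : ℤ} (hr : r ≠ 0) {t : ℝ} (ht : 0 ≤ t) :
    0 ≤ ((t:ℂ) * v + r).im ∧ (t:ℂ) * v + r ≠ 0 := by
  have him : ((t:ℂ) * v + r).im = t * v.im := by simp
  refine ⟨by rw [him]; positivity, fun h => ?_⟩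
  have h1 := congrArg Complex.im h
  rw [him] at h1
  have h2 : t = 0 := by
    rcases mul_eq_zero.1 (by simpa using h1 : t * v.im = 0) with h | h
    · exact h
    · linarith
  rw [h2] at h
  simp at h
  exact hr h

lemma line_deriv (s : ℝ) {v : ℂ} (hv : 0 < v.im) {r : ℤ} (hr : r ≠ 0) {t : ℝ} (ht : 0 ≤ t) :
    HasDerivAt (fun t : ℝ => pw s (t * v + r)) (Complex.I * s * pw (s + 1) (t * v + r) * v) t := by
  have h := line_ne hv hr ht
  have h2 : HasDerivAt (fun t : ℝ => (t:ℂ) * v + r) v t := by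
    simpa using ((Complex.ofRealCLM.hasDerivAt (x := t)).mul_const v).add_const (r:ℂ)
  exact (pw_hasDeriv s h.1 h.2).comp t h2

lemma line_cont (s : ℝ) {v : ℂ} (hv : 0 < v.im) {r : ℤ} (hr : r ≠ 0) :
    ContinuousOn (fun t : ℝ => pw s (t * v + r)) (Set.Ici 0) :=
  fun _ ht => (line_deriv s hv hr ht).continuousAt.continuousWithinAt

lemma line_lower {v : ℂ} (hv : 0 < v.im) (r : ℤ) (t : ℝ) :
    |(r:ℝ)| * (v.im / ‖v‖) ≤ ‖(t:ℂ) * v + r‖ := by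
  have := dist_line r t v hv
  rw [add_comm]
  simpa using this

/-- oscillation integral -/
noncomputable def oscI (s : ℝ) (v : ℂ) (r : ℤ) (j : ℕ) : ℝ :=
  if r = 0 then 0 else ∫ t in (j:ℝ)..((j:ℝ) + 1), s * ‖v‖ * ‖(r:ℝ) + (t:ℂ) * v‖ ^ (-(s + 1))

lemma oscI_sum {s : ℝ} (hs : 1 < s) {v : ℂ} (hv : 0 < v.im) (r : ℤ) (N : ℕ) :
    ∑ j ∈ range N, oscI s v r j ≤ s * JJ (s + 1) * ((v.im / ‖v‖) ^ (-s) * |(r:ℝ)| ^ (-s)) := by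
  have hv0 : v ≠ 0 := by rintro rfl; simp at hv
  have hV : 0 < ‖v‖ := norm_pos_iff.2 hv0
  have hJ := JJ_nonneg (s + 1)
  by_cases hr : r = 0
  · simp only [oscI, hr, if_true, sum_const_zero]; positivity
  · simp only [oscI, hr, if_false]
    have hr' : (r:ℝ) ≠ 0 := by exact_mod_cast hr
    obtain ⟨hi, hI⟩ := J_real (p := s + 1) (by linarith) hr' hv
    have hi' := hi.const_mul (s * ‖v‖)
    have e := intervalIntegral.sum_integral_adjacent_intervals (n := N) (a := fun k : ℕ => (k:ℝ))
      (f := fun t : ℝ => s * ‖v‖ * ‖((r:ℝ):ℂ) + (t:ℂ) * v‖ ^ (-(s + 1))) (μ := MeasureTheory.volume)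
      (fun k hk => hi'.intervalIntegrable)
    simp only [Nat.cast_add, Nat.cast_one] at e
    rw [e, intervalIntegral.integral_of_le (by simp)]
    have h1 := MeasureTheory.setIntegral_le_integral (s := Set.Ioc ((0:ℕ):ℝ) N) hi' (Filter.Eventually.of_forall (fun t => by simp only [Pi.zero_apply]; positivity))
    refine h1.trans (le_of_eq ?_)
    rw [MeasureTheory.integral_const_mul, hI, show 1 - (s + 1) = -s by ring, Real.mul_rpow (by positivity) (by positivity)]
    field_simp

lemma oscI_nonneg {s : ℝ} (hs : 1 < s) (v : ℂ) (r : ℤ) (j : ℕ) : 0 ≤ oscI s v r j := by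
  unfold oscI
  split_ifs
  · rfl
  · exact intervalIntegral.integral_nonneg (by linarith) (fun t _ => by positivity)

lemma oscI_summable {s : ℝ} (hs : 1 < s) {v : ℂ} (hv : 0 < v.im) (j : ℕ) :
    Summable (fun r : ℤ => oscI s v r j) := by
  refine Summable.of_nonneg_of_le (fun r => oscI_nonneg hs v r j) (fun r => ?_)
    (((Real.summable_abs_int_rpow hs).mul_left ((v.im / ‖v‖) ^ (-s))).mul_left (s * JJ (s + 1)))
  refine le_trans ?_ (oscI_sum hs hv r (j + 1))
  exact single_le_sum (f := fun j => oscI s v r j) (fun i _ => oscI_nonneg hs v r i) (by simp)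

lemma osc_term {s : ℝ} (hs : 1 < s) {v : ℂ} (hv : 0 < v.im) {r : ℤ} (hr : r ≠ 0) (j : ℕ) {θ : ℝ} (h0 : 0 ≤ θ) (h1 : θ ≤ 1) :
    ‖pw s (((j + θ : ℝ) : ℂ) * v + r) - ∫ t in (j:ℝ)..((j:ℝ) + 1), pw s (t * v + r)‖ ≤ oscI s v r j := by
  have hj : (0:ℝ) ≤ j := by positivity
  have := osc_bound (f := fun t : ℝ => pw s (t * v + r)) (f' := fun t : ℝ => Complex.I * s * pw (s + 1) (t * v + r) * v)
    (j := j) (x := j + θ) ⟨by linarith, by linarith⟩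
    (fun t ht => line_deriv s hv hr (hj.trans ht.1))
    (((continuousOn_const.mul ((line_cont (s + 1) hv hr).mono (fun t ht => hj.trans ht.1))).mul continuousOn_const))
  refine this.trans (le_of_eq ?_)
  simp only [oscI, hr, if_false]
  refine intervalIntegral.integral_congr (fun t _ => ?_)
  simp only [norm_mul, norm_pw, Complex.norm_I, one_mul, Complex.norm_real]
  rw [Real.norm_of_nonneg (by linarith), add_comm ((t:ℂ) * v)]
  push_cast; ring

/-- integral of Pp over a block as a sum -/
lemma Pp_block {a : ℝ} (ha : 0 < a) {v : ℂ} (hv : 0 < v.im) (j : ℕ) :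
    HasSum (fun r : ℤ => if r = 0 then 0 else (cG (a+1) : ℂ) * ∫ t in (j:ℝ)..((j:ℝ) + 1), pw (a+1) (t * v + r))
      (∫ t in (j:ℝ)..((j:ℝ) + 1), Pp a (t * v)) := by
  have hv0 : v ≠ 0 := by rintro rfl; simp at hv
  have hV : 0 < ‖v‖ := norm_pos_iff.2 hv0
  have hc := cG_pos (show 0 < a + 1 by linarith)
  have hj : (0:ℝ) ≤ j := by positivity
  have hjj : (j:ℝ) ≤ j + 1 := by linarith
  have h := intervalIntegral.hasSum_integral_of_dominated_convergence (μ := MeasureTheory.volume)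
    (a := (j:ℝ)) (b := (j:ℝ) + 1)
    (F := fun (r : ℤ) (t : ℝ) => if r = 0 then 0 else (cG (a+1) : ℂ) * pw (a+1) (t * v + r))
    (f := fun t : ℝ => Pp a (t * v))
    (fun r _ => cG (a+1) * ((v.im / ‖v‖) ^ (-(a+1)) * |(r:ℝ)| ^ (-(a+1))))
    (by
      intro r
      by_cases hr : r = 0
      · simp only [hr, if_true]; exact MeasureTheory.aestronglyMeasurable_const
      · simp only [hr, if_false]
        refine ContinuousOn.aestronglyMeasurable ?_ measurableSet_uIoc
        refine continuousOn_const.mul ((line_cont (a+1) hv hr).mono ?_)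
        intro t ht
        rw [Set.uIoc_of_le hjj] at ht
        exact hj.trans ht.1.le)
    (by
      intro r
      refine Filter.Eventually.of_forall (fun t ht => ?_)
      by_cases hr : r = 0
      · simp only [hr, if_true, norm_zero]; positivity
      · simp only [hr, if_false, norm_mul, Complex.norm_real, norm_pw]
        rw [Real.norm_of_nonneg hc.le, ← Real.mul_rpow (by positivity) (by positivity)]
        refine mul_le_mul_of_nonneg_left ?_ hc.le
        have hl' : 0 < |(r:ℝ)| := by positivity
        refine Real.rpow_le_rpow_of_nonpos (by positivity) ?_ (by linarith)
        rw [mul_comm]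
        exact line_lower hv r t)
    (Filter.Eventually.of_forall (fun t ht => ((Real.summable_abs_int_rpow (show 1 < a + 1 by linarith)).mul_left _).mul_left _))
    (by simp)
    (by
      refine Filter.Eventually.of_forall (fun t ht => ?_)
      rw [Set.uIoc_of_le hjj] at ht
      refine Pp_hasSum ha ?_
      have : 0 < t := lt_of_le_of_lt hj ht.1
      simp only [Complex.mul_im, Complex.ofReal_re, Complex.ofReal_im, zero_mul, add_zero]
      positivity)
  refine h.congr_fun (fun r => ?_) |> fun h => h
  by_cases hr : r = 0
  · simp [hr]
  · simp only [hr, if_false, intervalIntegral.integral_const_mul]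

lemma block_hasSum {a : ℝ} (ha : 0 < a) {z : ℂ} (hz : 0 < z.im) {q : ℕ} (hq : 0 < q) {h : ℤ} (hc : IsCoprime h (q:ℤ)) (j : ℕ) :
    ∃ θ : ℤ → ℝ, (∀ r, 0 ≤ θ r ∧ θ r ≤ 1) ∧ θ 0 = 1 ∧
      HasSum (fun r : ℤ => (cG (a+1) : ℂ) * ((((q:ℝ) ^ (a+1) : ℝ) : ℂ) * pw (a+1) (((j + θ r : ℝ) : ℂ) * (q * (q * z - h)) + r)))
        (∑ c ∈ range q, lam a (((q * j + c + 1 : ℕ) : ℂ) * z)) := by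
  have hq' : (0:ℝ) < q := by exact_mod_cast hq
  obtain ⟨e, he, he0⟩ := row_equiv q hq h hc j
  have hm : ∀ c : ℕ, 0 < (((q * j + c + 1 : ℕ) : ℂ) * z).im := by
    intro c
    have : (((q * j + c + 1 : ℕ) : ℂ) * z).im = ((q * j + c + 1 : ℕ) : ℝ) * z.im := by
      rw [← Complex.ofReal_natCast]; simp only [Complex.mul_im, Complex.ofReal_re, Complex.ofReal_im, zero_mul, add_zero]
    rw [this]; positivity
  have hs : ∀ c : Fin q, HasSum (fun l : ℤ => (cG (a+1) : ℂ) * pw (a+1) (((q * j + c + 1 : ℕ) : ℂ) * z + l)) (lam a (((q * j + c + 1 : ℕ) : ℂ) * z)) := by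
    intro c
    have := lipschitz (s := a + 1) (by linarith) (hm c)
    rwa [add_sub_cancel_right] at this
  have h1 := fin_prod_hasSum (f := fun x : Fin q × ℤ => (cG (a+1) : ℂ) * pw (a+1) (((q * j + x.1 + 1 : ℕ) : ℂ) * z + x.2)) hs
    (by
      intro c
      simp only [norm_mul, norm_pw]
      exact (summable_pw_norm (by linarith) (hm c)).mul_left _)
  rw [Fin.sum_univ_eq_sum_range (fun c => lam a (((q * j + c + 1 : ℕ) : ℂ) * z))] at h1
  rw [← e.symm.hasSum_iff] at h1
  refine ⟨fun r => (((e.symm r).1 : ℕ) + 1) / q, ?_, ?_, ?_⟩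
  · intro r
    refine ⟨by positivity, ?_⟩
    rw [div_le_one hq']
    exact_mod_cast (e.symm r).1.2
  · have := he0 (e.symm 0) (by simp)
    rw [div_eq_one_iff_eq hq'.ne']
    exact_mod_cast this
  · refine h1.congr_fun (fun r => ?_) |> fun h => h
    simp only [Function.comp]
    congr 1
    rw [row_id q hq h z, pw_smul (by linarith) (by positivity), Real.inv_rpow hq'.le, Real.rpow_neg hq'.le, inv_inv]
    congr 2
    have hr := he (e.symm r)
    rw [Equiv.apply_symm_apply] at hr
    have hr' : (r:ℂ) = ((q:ℂ) * j + ((e.symm r).1 : ℕ) + 1) * h + (e.symm r).2 * q := by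
      exact_mod_cast congrArg (fun x : ℤ => (x:ℂ)) hr
    have hq0 : (q:ℂ) ≠ 0 := by exact_mod_cast hq.ne'
    rw [hr']
    push_cast
    field_simp
    ring


lemma dsum_summable (α β : ℝ) {c : ℝ} (hc : 0 < c) :
    Summable (fun p : ℕ+ × ℕ+ => (p.1:ℝ) ^ α * ((p.2:ℝ) ^ β * Real.exp (-(c * p.1 * p.2)))) := by
  have h1 := summable_pnat_exp α (c := c / 2) (by positivity)
  have h2 := summable_pnat_exp β (c := c / 2) (by positivity)
  have h3 := h1.mul_of_nonneg h2 (fun _ => by positivity) (fun _ => by positivity)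
  refine Summable.of_nonneg_of_le (fun _ => by positivity) (fun p => ?_) h3
  have hm : (1:ℝ) ≤ p.1 := by exact_mod_cast p.1.pos
  have hd : (1:ℝ) ≤ p.2 := by exact_mod_cast p.2.pos
  have : Real.exp (-(c * p.1 * p.2)) ≤ Real.exp (-(c / 2 * p.1)) * Real.exp (-(c / 2 * p.2)) := by
    rw [← Real.exp_add]
    apply Real.exp_le_exp.2
    nlinarith [mul_nonneg hc.le (mul_nonneg (sub_nonneg.2 hm) (sub_nonneg.2 hd)), mul_nonneg hc.le (sub_nonneg.2 hm), mul_nonneg hc.le (sub_nonneg.2 hd), mul_nonneg hc.le (mul_nonneg (by linarith : (0:ℝ) ≤ p.1) (sub_nonneg.2 hd)), mul_nonneg hc.le (mul_nonneg (by linarith : (0:ℝ) ≤ p.2) (sub_nonneg.2 hm))]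
  calc _ ≤ (p.1:ℝ) ^ α * ((p.2:ℝ) ^ β * (Real.exp (-(c / 2 * p.1)) * Real.exp (-(c / 2 * p.2)))) := by gcongr
    _ = _ := by ring

noncomputable def dterm (α β : ℝ) (z : ℂ) (p : ℕ+ × ℕ+) : ℂ :=
  (((p.1:ℝ) ^ α : ℝ) : ℂ) * ((((p.2:ℝ) ^ β : ℝ) : ℂ) * ee (p.2 * (p.1 * z)))

lemma pnat_im (m : ℕ+) (z : ℂ) : ((m:ℂ) * z).im = (m:ℝ) * z.im := by
  simp

lemma dterm_norm (α β : ℝ) (z : ℂ) (p : ℕ+ × ℕ+) :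
    ‖dterm α β z p‖ = (p.1:ℝ) ^ α * ((p.2:ℝ) ^ β * Real.exp (-(2 * Real.pi * z.im * p.1 * p.2))) := by
  rw [dterm, norm_mul, lam_term_norm, Complex.norm_real, Real.norm_of_nonneg (by positivity), pnat_im]
  congr 4; ring

lemma dterm_summable (α β : ℝ) {z : ℂ} (hz : 0 < z.im) : Summable (fun p => ‖dterm α β z p‖) := by
  simp only [dterm_norm]
  exact dsum_summable α β (by positivity)

/-- `∑ m^α λ_β(m z)` -/
noncomputable def LL (α β : ℝ) (z : ℂ) : ℂ := ∑' m : ℕ+, (((m:ℝ) ^ α : ℝ) : ℂ) * lam β (m * z)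

lemma dterm_fiber (α β : ℝ) {z : ℂ} (hz : 0 < z.im) (m : ℕ+) :
    HasSum (fun d : ℕ+ => dterm α β z (m, d)) ((((m:ℝ) ^ α : ℝ) : ℂ) * lam β (m * z)) := by
  have : 0 < ((m:ℂ) * z).im := by rw [pnat_im]; have := m.pos; positivity
  have h := (lam_summable β this).hasSum
  have h2 := h.mul_left (((m:ℝ) ^ α : ℝ) : ℂ)
  simp only [dterm, lam]
  exact h2

lemma dterm_hasSum (α β : ℝ) {z : ℂ} (hz : 0 < z.im) : HasSum (dterm α β z) (LL α β z) := by
  have h := (dterm_summable α β hz).of_norm.hasSum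
  have h2 := h.prod_fiberwise (dterm_fiber α β hz)
  rwa [LL, h2.tsum_eq]

lemma LL_hasSum (α β : ℝ) {z : ℂ} (hz : 0 < z.im) :
    HasSum (fun m : ℕ+ => (((m:ℝ) ^ α : ℝ) : ℂ) * lam β (m * z)) (LL α β z) :=
  (dterm_hasSum α β hz).prod_fiberwise (dterm_fiber α β hz)

lemma LL_hasSum_nat (α β : ℝ) {z : ℂ} (hz : 0 < z.im) :
    HasSum (fun m : ℕ => ((((m + 1 : ℕ):ℝ) ^ α : ℝ) : ℂ) * lam β (((m + 1 : ℕ):ℂ) * z)) (LL α β z) := by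
  have h := LL_hasSum α β hz
  rw [← Equiv.pnatEquivNat.symm.hasSum_iff] at h
  exact h

lemma sum_blocks {M : Type*} [AddCommMonoid M] (f : ℕ → M) (q N : ℕ) :
    ∑ j ∈ range N, ∑ c ∈ range q, f (q * j + c) = ∑ m ∈ range (q * N), f m := by
  induction N with
  | zero => simp
  | succ N ih => rw [sum_range_succ, ih, Nat.mul_succ, sum_range_add]

lemma LL_blocks (α β : ℝ) {z : ℂ} (hz : 0 < z.im) {q : ℕ} (hq : 0 < q) :
    Filter.Tendsto (fun N : ℕ => ∑ j ∈ range N, ∑ c ∈ range q,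
      ((((q * j + c + 1 : ℕ):ℝ) ^ α : ℝ) : ℂ) * lam β (((q * j + c + 1 : ℕ):ℂ) * z)) Filter.atTop (nhds (LL α β z)) := by
  have h := (LL_hasSum_nat α β hz).tendsto_sum_nat
  have h2 : Filter.Tendsto (fun N : ℕ => q * N) Filter.atTop Filter.atTop :=
    Filter.tendsto_id.const_mul_atTop' hq
  have h3 := h.comp h2
  refine h3.congr (fun N => ?_)
  simp only [Function.comp]
  rw [← sum_blocks]

lemma pw_succ_tendsto {s : ℝ} (hs : 1 < s) (w : ℂ) :
    Filter.Tendsto (fun N : ℕ => ∑ j ∈ range N, pw s (((j:ℝ) + 1 : ℝ) * w)) Filter.atTop (nhds (riemannZeta s * pw s w)) := by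
  have h := pw_nat_hasSum hs w
  have h1 := (hasSum_nat_add_iff' 1).2 h
  simp only [range_one, sum_singleton, if_true, sub_zero, Nat.add_eq_zero_iff, one_ne_zero, and_false, if_false] at h1
  refine h1.tendsto_sum_nat.congr (fun N => ?_)
  refine sum_congr rfl (fun j _ => ?_)
  push_cast; rfl

lemma L1_block {a : ℝ} (ha : 0 < a) {z : ℂ} (hz : 0 < z.im) {q : ℕ} (hq : 0 < q) {h : ℤ} (hc : IsCoprime h (q:ℤ)) (j : ℕ) :
    ‖(∑ c ∈ range q, lam a (((q * j + c + 1 : ℕ) : ℂ) * z))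
      - (cG (a+1) : ℂ) * ((((q:ℝ) ^ (a+1) : ℝ) : ℂ) * pw (a+1) (((j + 1 : ℝ) : ℂ) * (q * (q * z - h))))
      - (((q:ℝ) ^ (a+1) : ℝ) : ℂ) * ∫ t in (j:ℝ)..((j:ℝ) + 1), Pp a (t * (q * (q * z - h)))‖
    ≤ cG (a+1) * (q:ℝ) ^ (a+1) * ∑' r : ℤ, oscI (a+1) (q * (q * z - h)) r j := by
  have hq' : (0:ℝ) < q := by exact_mod_cast hq
  have hv : 0 < ((q:ℂ) * (q * z - h)).im := by simp; positivity
  have hcp := cG_pos (show 0 < a + 1 by linarith)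
  obtain ⟨θ, hθ, hθ0, hs⟩ := block_hasSum ha hz hq hc j
  set v : ℂ := (q:ℂ) * (q * z - h) with hvd
  have h1 := hasSum_ite_sub_hasSum hs 0
  have h2 := (Pp_block ha hv j).mul_left (((q:ℝ) ^ (a+1) : ℝ) : ℂ)
  have h3 := h1.sub h2
  rw [hθ0] at h3
  simp only [Int.cast_zero, add_zero] at h3
  rw [← h3.tsum_eq]
  refine tsum_of_norm_bounded ((oscI_summable (by linarith) hv j).hasSum.mul_left _) (fun r => ?_)
  by_cases hr : r = 0
  · simp only [hr, if_true, mul_zero, sub_zero, norm_zero]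
    exact mul_nonneg (by positivity) (oscI_nonneg (by linarith) _ _ _)
  · simp only [hr, if_false]
    have := osc_term (s := a + 1) (by linarith) hv hr j (hθ r).1 (hθ r).2
    rw [mul_left_comm (((q:ℝ) ^ (a+1) : ℝ) : ℂ), ← mul_sub, ← mul_sub, norm_mul, norm_mul, Complex.norm_real, Complex.norm_real,
      Real.norm_of_nonneg (by positivity), Real.norm_of_nonneg (by positivity), mul_assoc]
    gcongr

lemma L1_osc {s : ℝ} (hs : 1 < s) {v : ℂ} (hv : 0 < v.im) (N : ℕ) :
    ∑ j ∈ range N, ∑' r : ℤ, oscI s v r j ≤ s * JJ (s + 1) * ((v.im / ‖v‖) ^ (-s) * ∑' r : ℤ, |(r:ℝ)| ^ (-s)) := by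
  rw [← Summable.tsum_finsetSum (fun j _ => oscI_summable hs hv j), ← tsum_mul_left, ← tsum_mul_left]
  have h := ((Real.summable_abs_int_rpow hs).mul_left ((v.im / ‖v‖) ^ (-s))).mul_left (s * JJ (s + 1))
  refine Summable.tsum_le_tsum (fun r => oscI_sum hs hv r N) ?_ h
  exact summable_sum (fun j _ => oscI_summable hs hv j)

noncomputable def CL (a : ℝ) : ℝ := cG (a+1) * ((a+1) * JJ (a + 1 + 1) * ∑' r : ℤ, |(r:ℝ)| ^ (-(a+1)))

lemma CL_nonneg {a : ℝ} (ha : 0 < a) : 0 ≤ CL a := by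
  have := cG_pos (show 0 < a + 1 by linarith)
  have := JJ_nonneg (a + 1 + 1)
  have : 0 ≤ ∑' r : ℤ, |(r:ℝ)| ^ (-(a+1)) := tsum_nonneg (fun _ => by positivity)
  unfold CL; positivity

theorem L1 {a : ℝ} (ha : 0 < a) {z : ℂ} (hz : 0 < z.im) {q : ℕ} (hq : 0 < q) {h : ℤ} (hc : IsCoprime h (q:ℤ)) :
    ‖LL 0 a z - (cG (a+1) : ℂ) * (riemannZeta ((a+1 : ℝ):ℂ) * pw (a+1) (q * z - h))
      - (((q:ℝ) ^ a : ℝ) : ℂ) * (-riemannZeta (1 - a)) / (2 * Real.pi * Complex.I * (q * z - h))‖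
    ≤ CL a * (‖q * z - h‖ / z.im) ^ (a + 1) := by
  have hq' : (0:ℝ) < q := by exact_mod_cast hq
  have hq0 : (q:ℂ) ≠ 0 := by exact_mod_cast hq.ne'
  have hcp := cG_pos (show 0 < a + 1 by linarith)
  have hv : 0 < ((q:ℂ) * (q * z - h)).im := by simp; positivity
  have hXim : ((q:ℂ) * z - h).im = q * z.im := by simp
  have hX0 : (q:ℂ) * z - h ≠ 0 := by
    intro h0
    have := hXim; rw [h0] at this; simp at this
    rcases this with h1 | h1
    · exact hq.ne' h1
    · exact hz.ne' h1
  set X : ℂ := (q:ℂ) * z - h with hX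
  have hXp : 0 < ‖X‖ := norm_pos_iff.2 hX0
  have t1 := LL_blocks 0 a hz hq
  simp only [Real.rpow_zero, Complex.ofReal_one, one_mul] at t1
  have t2 := ((pw_succ_tendsto (s := a + 1) (by linarith) (q * X)).const_mul (((q:ℝ) ^ (a+1) : ℝ) : ℂ)).const_mul (cG (a+1) : ℂ)
  have e2 : (((q:ℝ) ^ (a+1) : ℝ) : ℂ) * (riemannZeta ((a+1:ℝ):ℂ) * pw (a+1) (q * X)) = riemannZeta ((a+1:ℝ):ℂ) * pw (a+1) X := by
    have := pw_smul (s := a + 1) (by linarith) hq' X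
    rw [Complex.ofReal_natCast] at this
    rw [this, mul_left_comm, ← mul_assoc (((q:ℝ) ^ (a+1) : ℝ) : ℂ), ← Complex.ofReal_mul, ← Real.rpow_add hq']
    simp
  rw [e2] at t2
  have t3 : Filter.Tendsto (fun N : ℕ => (((q:ℝ) ^ (a+1) : ℝ) : ℂ) * ∫ t in (0:ℝ)..N, Pp a (t * (q * X))) Filter.atTop
      (nhds ((((q:ℝ) ^ a : ℝ) : ℂ) * (-riemannZeta (1 - a)) / (2 * Real.pi * Complex.I * X))) := by
    have k := (((KK_tendsto_inf ha hv).sub_const (riemannZeta (1 - a))).div_const (2 * Real.pi * Complex.I * (q * X))).const_mul (((q:ℝ) ^ (a+1) : ℝ) : ℂ)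
    have e3 : (((q:ℝ) ^ (a+1) : ℝ) : ℂ) * ((0 - riemannZeta (1 - a)) / (2 * Real.pi * Complex.I * (q * X))) = (((q:ℝ) ^ a : ℝ) : ℂ) * (-riemannZeta (1 - a)) / (2 * Real.pi * Complex.I * X) := by
      rw [Real.rpow_add hq', Real.rpow_one]
      have := Complex.I_ne_zero
      have : (Real.pi:ℂ) ≠ 0 := by exact_mod_cast Real.pi_ne_zero
      push_cast
      field_simp
      ring
    rw [e3] at k
    refine k.congr' ?_
    filter_upwards [Filter.eventually_gt_atTop 0] with N hN
    rw [L2 ha hv hN]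
  have T := ((t1.sub t2).sub t3).norm
  refine le_of_tendsto T (Filter.Eventually.of_forall (fun N => ?_))
  have es := intervalIntegral.sum_integral_adjacent_intervals (n := N) (a := fun k : ℕ => (k:ℝ))
      (f := fun t : ℝ => Pp a (t * (q * X))) (μ := MeasureTheory.volume)
      (fun k hk => ((Pp_intv ha hv (N := k + 1) (by positivity)).mono_set (by
        rw [Set.uIcc_of_le (by simp), Set.uIcc_of_le (by positivity)]
        intro t ht
        exact ⟨le_trans (by positivity) ht.1, by simpa using ht.2⟩)))
  simp only [Nat.cast_add, Nat.cast_one, Nat.cast_zero] at es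
  rw [← es, mul_sum, mul_sum, mul_sum, ← sum_sub_distrib, ← sum_sub_distrib]
  refine (norm_sum_le _ _).trans ((sum_le_sum (fun j _ => L1_block ha hz hq hc j)).trans ?_)
  rw [← mul_sum]
  refine (mul_le_mul_of_nonneg_left (L1_osc (by linarith) hv N) (by positivity)).trans (le_of_eq ?_)
  have him : ((q:ℂ) * X).im = q * (q * z.im) := by rw [← Complex.ofReal_natCast]; simp [hXim]
  have hk : ((q:ℂ) * X).im / ‖(q:ℂ) * X‖ = q * (‖X‖ / z.im)⁻¹ := by
    rw [him, norm_mul, Complex.norm_natCast]; field_simp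
  rw [hk, Real.mul_rpow hq'.le (by positivity), Real.rpow_neg (by positivity) (a + 1), Real.inv_rpow (by positivity), Real.rpow_neg (by positivity), inv_inv, CL]
  have : (q:ℝ) ^ (a+1) ≠ 0 := by positivity
  field_simp


lemma block_hasSum_w {a : ℝ} (ha : 0 < a) (α : ℝ) {z : ℂ} (hz : 0 < z.im) {q : ℕ} (hq : 0 < q) {h : ℤ} (hc : IsCoprime h (q:ℤ)) (j : ℕ) :
    ∃ θ : ℤ → ℝ, (∀ r, 0 ≤ θ r ∧ θ r ≤ 1) ∧ θ 0 = 1 ∧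
      HasSum (fun r : ℤ => (((q * (j + θ r)) ^ α : ℝ) : ℂ) * ((cG (a+1) : ℂ) * ((((q:ℝ) ^ (a+1) : ℝ) : ℂ) * pw (a+1) (((j + θ r : ℝ) : ℂ) * (q * (q * z - h)) + r))))
        (∑ c ∈ range q, ((((q * j + c + 1 : ℕ):ℝ) ^ α : ℝ) : ℂ) * lam a (((q * j + c + 1 : ℕ) : ℂ) * z)) := by
  have hq' : (0:ℝ) < q := by exact_mod_cast hq
  obtain ⟨e, he, he0⟩ := row_equiv q hq h hc j
  have hm : ∀ c : ℕ, 0 < (((q * j + c + 1 : ℕ) : ℂ) * z).im := by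
    intro c
    have : (((q * j + c + 1 : ℕ) : ℂ) * z).im = ((q * j + c + 1 : ℕ) : ℝ) * z.im := by
      rw [← Complex.ofReal_natCast]; simp only [Complex.mul_im, Complex.ofReal_re, Complex.ofReal_im, zero_mul, add_zero]
    rw [this]; positivity
  have hs : ∀ c : Fin q, HasSum (fun l : ℤ => ((((q * j + c + 1 : ℕ):ℝ) ^ α : ℝ) : ℂ) * ((cG (a+1) : ℂ) * pw (a+1) (((q * j + c + 1 : ℕ) : ℂ) * z + l))) (((((q * j + c + 1 : ℕ):ℝ) ^ α : ℝ) : ℂ) * lam a (((q * j + c + 1 : ℕ) : ℂ) * z)) := by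
    intro c
    have := lipschitz (s := a + 1) (by linarith) (hm c)
    rw [add_sub_cancel_right] at this
    exact this.mul_left _
  have h1 := fin_prod_hasSum (f := fun x : Fin q × ℤ => ((((q * j + x.1 + 1 : ℕ):ℝ) ^ α : ℝ) : ℂ) * ((cG (a+1) : ℂ) * pw (a+1) (((q * j + x.1 + 1 : ℕ) : ℂ) * z + x.2))) hs
    (by
      intro c
      simp only [norm_mul, norm_pw]
      exact ((summable_pw_norm (by linarith) (hm c)).mul_left _).mul_left _)
  rw [Fin.sum_univ_eq_sum_range (fun c => ((((q * j + c + 1 : ℕ):ℝ) ^ α : ℝ) : ℂ) * lam a (((q * j + c + 1 : ℕ) : ℂ) * z))] at h1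
  rw [← e.symm.hasSum_iff] at h1
  refine ⟨fun r => (((e.symm r).1 : ℕ) + 1) / q, ?_, ?_, ?_⟩
  · intro r
    refine ⟨by positivity, ?_⟩
    rw [div_le_one hq']
    exact_mod_cast (e.symm r).1.2
  · have := he0 (e.symm 0) (by simp)
    rw [div_eq_one_iff_eq hq'.ne']
    exact_mod_cast this
  · refine h1.congr_fun (fun r => ?_) |> fun h => h
    simp only [Function.comp]
    have e1 : (q:ℝ) * (j + (((e.symm r).1 : ℕ) + 1) / q) = ((q * j + (e.symm r).1 + 1 : ℕ):ℝ) := by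
      push_cast; field_simp; ring
    rw [e1]
    congr 2
    rw [row_id q hq h z, pw_smul (by linarith) (by positivity), Real.inv_rpow hq'.le, Real.rpow_neg hq'.le, inv_inv]
    congr 2
    have hr := he (e.symm r)
    rw [Equiv.apply_symm_apply] at hr
    have hr' : (r:ℂ) = ((q:ℂ) * j + ((e.symm r).1 : ℕ) + 1) * h + (e.symm r).2 * q := by
      exact_mod_cast congrArg (fun x : ℤ => (x:ℂ)) hr
    have hq0 : (q:ℂ) ≠ 0 := by exact_mod_cast hq.ne'
    rw [hr']
    push_cast
    field_simp
    ring

lemma tail_term {p : ℝ} (hp : 2 < p) {v : ℂ} (hv : 0 < v.im) (hv2 : ‖v‖ ≤ 2 * (v.im / ‖v‖)) {r : ℤ} (hr : r ≠ 0) (j : ℕ) {θ : ℝ}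
    (h0 : 0 ≤ θ) (h1 : θ ≤ 1) :
    ‖((j + θ : ℝ) : ℂ) * v + r‖ ^ (-p) ≤ 3 ^ p * ((p - 1) * ‖v‖)⁻¹ * oscI (p - 1) v r j := by
  have hv0 : v ≠ 0 := by rintro rfl; simp at hv
  have hV : 0 < ‖v‖ := norm_pos_iff.2 hv0
  have hr' : (r:ℝ) ≠ 0 := by exact_mod_cast hr
  have hr1 : (1:ℝ) ≤ |(r:ℝ)| := by exact_mod_cast Int.one_le_abs hr
  obtain ⟨hi, -⟩ := J_real (p := p) (by linarith) hr' hv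
  have hk : 0 < v.im / ‖v‖ := by positivity
  have hlow := line_lower hv r (j + θ)
  set A := ‖((j + θ : ℝ) : ℂ) * v + r‖ with hA
  have hkA : v.im / ‖v‖ ≤ A := le_trans (by nlinarith) hlow
  have hA0 : 0 < A := hk.trans_le hkA
  rw [oscI, if_neg hr]
  simp only [sub_add_cancel]
  rw [intervalIntegral.integral_const_mul]
  have key : A ^ (-p) ≤ 3 ^ p * ∫ t in (j:ℝ)..((j:ℝ) + 1), ‖((r:ℝ):ℂ) + (t:ℂ) * v‖ ^ (-p) := by
    rw [← intervalIntegral.integral_const_mul]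
    have hm := intervalIntegral.integral_mono_on (a := (j:ℝ)) (b := (j:ℝ) + 1) (μ := MeasureTheory.volume) (f := fun _ => A ^ (-p))
      (g := fun t : ℝ => 3 ^ p * ‖((r:ℝ):ℂ) + (t:ℂ) * v‖ ^ (-p)) (by linarith) (by simp) (hi.const_mul _).intervalIntegrable (by
        intro t ht
        have hB : ‖((r:ℝ):ℂ) + (t:ℂ) * v‖ ≤ 3 * A := by
          have e : ((r:ℝ):ℂ) + (t:ℂ) * v = (((j + θ : ℝ) : ℂ) * v + r) + ((t - (j + θ) : ℝ):ℂ) * v := by push_cast; ring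
          rw [e]
          refine (norm_add_le _ _).trans ?_
          rw [norm_mul, Complex.norm_real, Real.norm_eq_abs]
          have : |t - (j + θ)| ≤ 1 := by rw [abs_le]; constructor <;> linarith [ht.1, ht.2]
          nlinarith
        have hB0 : 0 < ‖((r:ℝ):ℂ) + (t:ℂ) * v‖ := by
          have := line_lower hv r t
          rw [add_comm]
          simp only [Complex.ofReal_intCast]
          exact lt_of_lt_of_le (by positivity) this
        have e3 : (3:ℝ) ^ p * (3 * A) ^ (-p) = A ^ (-p) := by
          rw [Real.mul_rpow (by norm_num) hA0.le, ← mul_assoc, ← Real.rpow_add (by norm_num)]; simp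
        rw [← e3]
        gcongr ?_ * ?_
        exact Real.rpow_le_rpow_of_nonpos hB0 hB (by linarith))
    simpa using hm
  refine key.trans (le_of_eq ?_)
  generalize (∫ t in (j:ℝ)..((j:ℝ) + 1), ‖((r:ℝ):ℂ) + (t:ℂ) * v‖ ^ (-p)) = I
  have : p - 1 ≠ 0 := by linarith
  field_simp

lemma zeta_succ_tendsto {p : ℝ} (hp : 1 < p) :
    HasSum (fun j : ℕ => ((((j:ℝ) + 1) ^ (-p) : ℝ) : ℂ)) (riemannZeta p) := by
  have h1 : Summable (fun j : ℕ => ((((j:ℝ) + 1) ^ (-p) : ℝ) : ℂ)) :=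
    Complex.summable_ofReal.2 (summable_succ_rpow (by linarith))
  convert h1.hasSum using 1
  rw [zeta_eq_tsum_one_div_nat_add_one_cpow (by simpa using hp)]
  refine tsum_congr (fun j => ?_)
  rw [Real.rpow_neg (by positivity), Complex.ofReal_inv, Complex.ofReal_cpow (by positivity)]
  push_cast; rw [one_div]

lemma tail_block {a : ℝ} (ha : 0 < a) {α : ℝ} (hα : 0 ≤ α) (hp : 2 < a + 1 - α) {z : ℂ} (hz : 0 < z.im) {q : ℕ} (hq : 0 < q) {h : ℤ} (hc : IsCoprime h (q:ℤ))
    (hX2 : ‖q * z - h‖ ^ 2 ≤ 2 * z.im) (j : ℕ) :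
    ‖(∑ c ∈ range q, ((((q * j + c + 1 : ℕ):ℝ) ^ α : ℝ) : ℂ) * lam a (((q * j + c + 1 : ℕ) : ℂ) * z))
      - ((((j:ℝ) + 1) ^ (-(a + 1 - α)) : ℝ) : ℂ) * (cG (a+1) * ((((q:ℝ) ^ α : ℝ) : ℂ) * pw (a+1) (q * z - h)))‖
    ≤ cG (a+1) * (q:ℝ) ^ (a + 1 - α) * z.im ^ (-α) * (3 ^ (a + 1 - α) * ((a + 1 - α - 1) * ‖q * (q * z - h)‖)⁻¹) * ∑' r : ℤ, oscI (a + 1 - α - 1) (q * (q * z - h)) r j := by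
  have hq' : (0:ℝ) < q := by exact_mod_cast hq
  have hv : 0 < ((q:ℂ) * (q * z - h)).im := by simp; positivity
  have him : ((q:ℂ) * (q * z - h)).im = q * (q * z.im) := by simp
  have hcp := cG_pos (show 0 < a + 1 by linarith)
  obtain ⟨θ, hθ, hθ0, hs⟩ := block_hasSum_w ha α hz hq hc j
  have hXim : ((q:ℂ) * z - h).im = q * z.im := by simp
  set X : ℂ := (q:ℂ) * z - h with hX
  have hXp : 0 < ‖X‖ := norm_pos_iff.2 (by
    intro h0; rw [h0] at hXim; simp at hXim
    rcases hXim with h1 | h1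
    · exact hq.ne' h1
    · exact hz.ne' h1)
  have hv2 : ‖(q:ℂ) * X‖ ≤ 2 * (((q:ℂ) * X).im / ‖(q:ℂ) * X‖) := by
    rw [him, norm_mul, Complex.norm_natCast, ← mul_div_assoc, le_div_iff₀ (by positivity)]
    nlinarith [mul_le_mul_of_nonneg_left hX2 (mul_pos hq' hq').le]
  have h1 := hasSum_ite_sub_hasSum hs 0
  rw [hθ0] at h1
  have e0 : (((q * ((j:ℝ) + 1)) ^ α : ℝ) : ℂ) * ((cG (a+1) : ℂ) * ((((q:ℝ) ^ (a+1) : ℝ) : ℂ) * pw (a+1) (((j + 1 : ℝ) : ℂ) * (q * X) + (0:ℤ))))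
      = ((((j:ℝ) + 1) ^ (-(a + 1 - α)) : ℝ) : ℂ) * (cG (a+1) * ((((q:ℝ) ^ α : ℝ) : ℂ) * pw (a+1) X)) := by
    have := pw_smul (s := a + 1) (c := (j + 1) * q) (by linarith) (by positivity) X
    have e : ((((j:ℝ) + 1) * q : ℝ):ℂ) * X = ((j + 1 : ℝ) : ℂ) * (q * X) + (0:ℤ) := by push_cast; ring
    rw [← e, this]
    have e1 : (q * ((j:ℝ) + 1)) ^ α * ((q:ℝ) ^ (a+1) * ((j + 1) * q) ^ (-(a+1))) = ((j:ℝ) + 1) ^ (-(a + 1 - α)) * (q:ℝ) ^ α := by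
      rw [Real.mul_rpow (by positivity) (by positivity), Real.mul_rpow (by positivity) (by positivity), show -(a + 1 - α) = α + -(a+1) by ring, Real.rpow_add (by positivity) α (-(a+1)), Real.rpow_neg hq'.le]
      have : (q:ℝ) ^ (a+1) ≠ 0 := by positivity
      field_simp
    have e2 := congrArg (fun x : ℝ => (x:ℂ)) e1
    simp only [Complex.ofReal_mul] at e2 ⊢
    linear_combination (cG (a+1) * pw (a+1) X) * e2
  rw [e0] at h1
  rw [← h1.tsum_eq]
  refine tsum_of_norm_bounded ((oscI_summable (by linarith) hv j).hasSum.mul_left _) (fun r => ?_)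
  have hP : 0 < a + 1 - α - 1 := by linarith
  by_cases hr : r = 0
  · simp only [hr, if_true, norm_zero]
    exact mul_nonneg (by positivity) (oscI_nonneg (by linarith) _ _ _)
  · simp only [hr, if_false]
    have ht := tail_term hp hv hv2 hr j (hθ r).1 (hθ r).2
    have hlow := line_lower hv r (j + θ r)
    set W := ((j + θ r : ℝ) : ℂ) * (q * X) + r with hW
    have hr1 : (1:ℝ) ≤ |(r:ℝ)| := by exact_mod_cast Int.one_le_abs hr
    have hXq : 0 < ‖(q:ℂ) * X‖ := by rw [norm_mul, Complex.norm_natCast]; positivity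
    have hW0 : 0 < ‖W‖ := lt_of_lt_of_le (by positivity) hlow
    have hWim : W.im = (j + θ r) * (q * (q * z.im)) := by
      rw [hW, Complex.add_im, Complex.intCast_im, add_zero, Complex.im_ofReal_mul, him]
    have hnn : 0 ≤ j + θ r := by have := (hθ r).1; positivity
    have hle : q * (j + θ r) ≤ ‖W‖ * (q * z.im)⁻¹ := by
      rw [← div_eq_mul_inv, le_div_iff₀ (by positivity)]
      have := Complex.abs_im_le_norm W
      rw [hWim] at this
      linarith [le_abs_self ((j + θ r) * (q * (q * z.im)))]
    have hpow : (q * (j + θ r)) ^ α ≤ ‖W‖ ^ α * ((q:ℝ) ^ (-α) * z.im ^ (-α)) := by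
      refine (Real.rpow_le_rpow (by positivity) hle hα).trans (le_of_eq ?_)
      rw [Real.mul_rpow hW0.le (by positivity), Real.inv_rpow (by positivity), Real.mul_rpow hq'.le hz.le, Real.rpow_neg hq'.le, Real.rpow_neg hz.le, mul_inv]
    rw [norm_mul, norm_mul, norm_mul, norm_pw, Complex.norm_real, Complex.norm_real, Complex.norm_real,
      Real.norm_of_nonneg (by positivity), Real.norm_of_nonneg (by positivity), Real.norm_of_nonneg (by positivity)]
    calc _ ≤ (‖W‖ ^ α * ((q:ℝ) ^ (-α) * z.im ^ (-α))) * (cG (a+1) * ((q:ℝ) ^ (a+1) * ‖W‖ ^ (-(a+1)))) := by gcongr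
      _ = cG (a+1) * (q:ℝ) ^ (a + 1 - α) * z.im ^ (-α) * ‖W‖ ^ (-(a + 1 - α)) := by
        rw [show -(a+1-α) = α + -(a+1) by ring, show a + 1 - α = -α + (a+1) by ring, Real.rpow_add hW0, Real.rpow_add hq' (-α) (a+1)]
        ring
      _ ≤ cG (a+1) * (q:ℝ) ^ (a + 1 - α) * z.im ^ (-α) * (3 ^ (a + 1 - α) * ((a + 1 - α - 1) * ‖q * X‖)⁻¹ * oscI (a + 1 - α - 1) (q * X) r j) := by gcongr
      _ = _ := by ring

theorem tail {a : ℝ} (ha : 0 < a) {α : ℝ} (hα : 0 ≤ α) (hp : 2 < a + 1 - α) :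
    ∃ C : ℝ, 0 ≤ C ∧ ∀ (z : ℂ) (_ : 0 < z.im) (q : ℕ) (_ : 0 < q) (h : ℤ) (_ : IsCoprime h (q:ℤ))
    (_ : ‖q * z - h‖ ^ 2 ≤ 2 * z.im),
    ‖LL α a z - riemannZeta ((a + 1 - α : ℝ):ℂ) * (cG (a+1) * ((((q:ℝ) ^ α : ℝ) : ℂ) * pw (a+1) (q * z - h)))‖
      ≤ C * z.im ^ (-((a + 1 + α) / 2)) := by
  set p := a + 1 - α with hpd
  have hcp := cG_pos (show 0 < a + 1 by linarith)
  have hJ := JJ_nonneg (p - 1 + 1)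
  have hT : 0 ≤ ∑' r : ℤ, |(r:ℝ)| ^ (-(p - 1)) := tsum_nonneg (fun _ => by positivity)
  refine ⟨cG (a+1) * 3 ^ p * JJ (p - 1 + 1) * (∑' r : ℤ, |(r:ℝ)| ^ (-(p - 1))) * 2 ^ ((p - 2) / 2), by positivity, ?_⟩
  intro z hz q hq h hc hX2
  have hq' : (0:ℝ) < q := by exact_mod_cast hq
  have hv : 0 < ((q:ℂ) * (q * z - h)).im := by simp; positivity
  have him : ((q:ℂ) * (q * z - h)).im = q * (q * z.im) := by simp
  have hXim : ((q:ℂ) * z - h).im = q * z.im := by simp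
  have hB := fun j => tail_block ha hα hp hz hq hc hX2 j
  simp only [← hpd] at hB
  set X : ℂ := (q:ℂ) * z - h with hX
  have hXp : 0 < ‖X‖ := norm_pos_iff.2 (by
    intro h0; rw [h0] at hXim; simp at hXim
    rcases hXim with h1 | h1
    · exact hq.ne' h1
    · exact hz.ne' h1)
  have t1 := LL_blocks α a hz hq
  have t2 := ((zeta_succ_tendsto (p := p) (by linarith)).mul_right (cG (a+1) * ((((q:ℝ) ^ α : ℝ) : ℂ) * pw (a+1) X))).tendsto_sum_nat
  refine le_of_tendsto (t1.sub t2).norm (Filter.Eventually.of_forall (fun N => ?_))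
  rw [← sum_sub_distrib]
  refine (norm_sum_le _ _).trans ((sum_le_sum (fun j _ => hB j)).trans ?_)
  rw [← mul_sum]
  have hP : 0 < p - 1 := by linarith
  refine (mul_le_mul_of_nonneg_left (L1_osc (by linarith) hv N) (by positivity)).trans ?_
  have hk : ((q:ℂ) * X).im / ‖(q:ℂ) * X‖ = q * (z.im / ‖X‖) := by
    rw [him, norm_mul, Complex.norm_natCast]; field_simp
  rw [hk, norm_mul, Complex.norm_natCast]
  have hlam : ‖X‖ ^ (p - 2) ≤ (2 * z.im) ^ ((p - 2) / 2) := by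
    have e : ‖X‖ ^ (p - 2) = (‖X‖ ^ 2) ^ ((p - 2) / 2) := by
      rw [← Real.rpow_natCast, ← Real.rpow_mul hXp.le]; congr 1; push_cast; ring
    rw [e]
    exact Real.rpow_le_rpow (by positivity) hX2 (by linarith)
  have e5 : (q:ℝ) ^ p * z.im ^ (-α) * (q * ‖X‖)⁻¹ * (q * (z.im / ‖X‖)) ^ (-(p - 1)) = z.im ^ (-α) * z.im ^ (1 - p) * ‖X‖ ^ (p - 2) := by
    rw [Real.mul_rpow hq'.le (by positivity), Real.div_rpow hz.le hXp.le, show -(p - 1) = 1 - p by ring, mul_inv, ← Real.rpow_neg_one (q:ℝ), ← Real.rpow_neg_one ‖X‖, div_eq_mul_inv, ← Real.rpow_neg hXp.le]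
    have e6 : (q:ℝ) ^ p * (q:ℝ) ^ (-1:ℝ) * (q:ℝ) ^ (1 - p) = 1 := by
      rw [← Real.rpow_add hq', ← Real.rpow_add hq', show p + -1 + (1 - p) = 0 by ring, Real.rpow_zero]
    have e7 : ‖X‖ ^ (-1:ℝ) * ‖X‖ ^ (-(1 - p)) = ‖X‖ ^ (p - 2) := by
      rw [← Real.rpow_add hXp]; congr 1; ring
    rw [← e7]
    linear_combination (z.im ^ (-α) * ‖X‖ ^ (-1:ℝ) * (z.im ^ (1 - p) * ‖X‖ ^ (-(1 - p)))) * e6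
  have e8 : z.im ^ (-α) * z.im ^ (1 - p) * (2 * z.im) ^ ((p - 2) / 2) = 2 ^ ((p - 2) / 2) * z.im ^ (-((a + 1 + α) / 2)) := by
    rw [Real.mul_rpow (by norm_num) hz.le, show -((a + 1 + α) / 2) = -α + (1 - p) + (p - 2) / 2 by rw [hpd]; ring, Real.rpow_add hz, Real.rpow_add hz]
    ring
  calc _ = cG (a+1) * 3 ^ p * JJ (p - 1 + 1) * (∑' r : ℤ, |(r:ℝ)| ^ (-(p - 1))) * ((q:ℝ) ^ p * z.im ^ (-α) * (q * ‖X‖)⁻¹ * (q * (z.im / ‖X‖)) ^ (-(p - 1))) := by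
        field_simp
    _ ≤ cG (a+1) * 3 ^ p * JJ (p - 1 + 1) * (∑' r : ℤ, |(r:ℝ)| ^ (-(p - 1))) * (z.im ^ (-α) * z.im ^ (1 - p) * (2 * z.im) ^ ((p - 2) / 2)) := by
        rw [e5]; gcongr
    _ = _ := by rw [e8]; ring


lemma ee_add (z w : ℂ) : ee (z + w) = ee z * ee w := by
  rw [ee, ee, ee, ← Complex.exp_add]; congr 1; ring

lemma div_fiber (α β : ℝ) (z : ℂ) (n : ℕ+) :
    ∑ x : Nat.divisorsAntidiagonal (n:ℕ), dterm α β z (sigmaAntidiagonalEquivProd ⟨n, x⟩)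
      = ((((n:ℕ):ℝ) ^ α * sigmaR (β - α) n : ℝ) : ℂ) * ee ((n:ℕ) * z) := by
  have hn : (n:ℕ) ≠ 0 := n.ne_zero
  have e1 : ∀ x : Nat.divisorsAntidiagonal (n:ℕ), dterm α β z (sigmaAntidiagonalEquivProd ⟨n, x⟩)
      = (fun (x : ℕ × ℕ) => ((((x.1:ℝ) ^ α * (x.2:ℝ) ^ β : ℝ)):ℂ) * ee ((n:ℕ) * z)) x.1 := by
    intro x
    have hx := (Nat.mem_divisorsAntidiagonal.1 x.2).1
    simp only [dterm, sigmaAntidiagonalEquivProd, divisorsAntidiagonalFactors, Equiv.coe_fn_mk, PNat.mk_coe]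
    have hx2 : (x.1.1:ℂ) * x.1.2 = ((n:ℕ):ℂ) := by exact_mod_cast congrArg (fun t : ℕ => (t:ℂ)) hx
    rw [show (x.1.2:ℂ) * (x.1.1 * z) = x.1.1 * x.1.2 * z by ring, hx2, Complex.ofReal_mul, mul_assoc]
  rw [sum_congr rfl (fun x _ => e1 x), sum_coe_sort (Nat.divisorsAntidiagonal (n:ℕ)) (fun (x : ℕ × ℕ) => ((((x.1:ℝ) ^ α * (x.2:ℝ) ^ β : ℝ)):ℂ) * ee ((n:ℕ) * z)),
    ← sum_mul, ← Complex.ofReal_sum, Nat.sum_divisorsAntidiagonal' (f := fun i j : ℕ => (i:ℝ) ^ α * (j:ℝ) ^ β), sigmaR, mul_sum]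
  congr 2
  refine sum_congr rfl (fun d hd => ?_)
  have hdv := Nat.dvd_of_mem_divisors hd
  have hd0 : (0:ℝ) < d := by exact_mod_cast Nat.pos_of_mem_divisors hd
  rw [Nat.cast_div hdv hd0.ne', Real.div_rpow (by positivity) hd0.le, Real.rpow_sub hd0]
  field_simp

lemma LL_coef (α β : ℝ) {z : ℂ} (hz : 0 < z.im) :
    HasSum (fun k : ℕ => (((k:ℝ) ^ α * sigmaR (β - α) k : ℝ) : ℂ) * ee (k * z)) (LL α β z) := by
  have h := dterm_hasSum α β hz
  rw [← sigmaAntidiagonalEquivProd.hasSum_iff] at h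
  have h2 := h.sigma (fun n => hasSum_fintype _)
  simp only [Function.comp, div_fiber] at h2
  have h3 := (hasSum_subtype_iff_of_support_subset (f := fun k : ℕ => (((k:ℝ) ^ α * sigmaR (β - α) k : ℝ) : ℂ) * ee (k * z)) (s := {k : ℕ | 0 < k}) (a := LL α β z) (by
    intro k hk
    rcases Nat.eq_zero_or_pos k with rfl | h
    · simp [sigmaR] at hk
    · exact h)).1
  exact h3 h2

lemma sigma_coef (a : ℝ) {z : ℂ} (hz : 0 < z.im) :
    HasSum (fun k : ℕ => ((sigmaR a k : ℝ) : ℂ) * ee (k * z)) (LL 0 a z) := by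
  have := LL_coef 0 a hz
  simpa using this

lemma SR_coef (a b : ℝ) {z : ℂ} (hz : 0 < z.im) :
    HasSum (fun k : ℕ => ((SR a b k : ℝ) : ℂ) * ee (k * z)) (LL 0 a z * LL 0 b z) := by
  have h1 := sigma_coef a hz
  have h2 := sigma_coef b hz
  have s := (summable_norm_sum_mul_antidiagonal_of_summable_norm h1.summable.norm h2.summable.norm).of_norm.hasSum
  rw [← tsum_mul_tsum_eq_tsum_sum_antidiagonal_of_summable_norm h1.summable.norm h2.summable.norm, h1.tsum_eq, h2.tsum_eq] at s
  refine s.congr_fun (fun n => ?_) |> fun h => h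
  rw [Finset.Nat.sum_antidiagonal_eq_sum_range_succ_mk, SR]
  push_cast
  rw [sum_mul]
  have hsub : Finset.Ico 1 n ⊆ range n.succ := by
    intro k hk; simp at hk ⊢; omega
  rw [← sum_subset hsub]
  · refine sum_congr rfl (fun k hk => ?_)
    simp only [Finset.mem_Ico] at hk
    have : ee (n * z) = ee (k * z) * ee ((n - k : ℕ) * z) := by
      rw [← ee_add, ← add_mul, ← Nat.cast_add, Nat.add_sub_cancel' hk.2.le]
    rw [this]; ring
  · intro k hk hk2
    simp only [Finset.mem_Ico, mem_range] at hk hk2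
    have : k = 0 ∨ n - k = 0 := by omega
    rcases this with h | h <;> simp [h, sigmaR]

lemma F_coef (a b C1 C2 : ℝ) {z : ℂ} (hz : 0 < z.im) :
    HasSum (fun k : ℕ => ((SR a b k - C1 * sigmaR (a + b + 1) k - C2 * (k:ℝ) ^ a * sigmaR (b - a + 1) k : ℝ) : ℂ) * ee (k * z))
      (LL 0 a z * LL 0 b z - C1 * LL 0 (a + b + 1) z - C2 * LL a (b + 1) z) := by
  have h1 := SR_coef a b hz
  have h2 := (sigma_coef (a + b + 1) hz).mul_left (C1:ℂ)
  have h3 := (LL_coef a (b + 1) hz).mul_left (C2:ℂ)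
  refine ((h1.sub h2).sub h3).congr_fun (fun n => ?_) |> fun h => h
  rw [show b + 1 - a = b - a + 1 by ring]
  push_cast; ring

lemma orth (m : ℤ) : ∫ x in (0:ℝ)..1, ee ((m:ℂ) * x) = if m = 0 then 1 else 0 := by
  split_ifs with h
  · simp [h, ee]
  · have hc : 2 * (Real.pi:ℂ) * Complex.I * m ≠ 0 := by
      simp [Real.pi_ne_zero, h, Complex.I_ne_zero]
    have := integral_exp_mul_complex (a := 0) (b := 1) hc
    have e : ∀ x : ℝ, ee ((m:ℂ) * x) = Complex.exp (2 * (Real.pi:ℂ) * Complex.I * m * x) := by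
      intro x; rw [ee]; congr 1; ring
    simp only [e]
    rw [this]
    have : Complex.exp (2 * (Real.pi:ℂ) * Complex.I * m * (1:ℝ)) = 1 := by
      rw [Complex.exp_eq_one_iff]; exact ⟨m, by push_cast; ring⟩
    rw [this]; simp

lemma coef_bound {c : ℕ → ℂ} {F : ℂ → ℂ} {y : ℝ} (hy : 0 < y) (hF : ∀ z : ℂ, 0 < z.im → HasSum (fun k : ℕ => c k * ee (k * z)) (F z))
    {G : ℝ → ℝ} (hG : IntervalIntegrable G MeasureTheory.volume 0 1) (hFG : ∀ x ∈ Set.Ioc (0:ℝ) 1, ‖F (x + y * Complex.I)‖ ≤ G x) (n : ℕ) :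
    ‖c n‖ * Real.exp (-(2 * Real.pi * (n * y))) ≤ ∫ x in (0:ℝ)..1, G x := by
  have him : ∀ x : ℝ, ((x:ℂ) + y * Complex.I).im = y := by intro x; simp
  have hnorm : ∀ k : ℕ, ∀ x : ℝ, ‖c k * ee (k * ((x:ℂ) + y * Complex.I))‖ = ‖c k * ee (k * (((0:ℝ):ℂ) + y * Complex.I))‖ := by
    intro k x
    rw [norm_mul, norm_mul, norm_ee, norm_ee]
    simp
  have hs := (hF ((0:ℝ) + y * Complex.I) (by rw [him]; exact hy)).summable.norm
  have hen : ∀ x : ℝ, ‖ee (((-n : ℤ):ℂ) * x)‖ = 1 := by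
    intro x; rw [norm_ee]; simp
  have hsum : HasSum (fun k : ℕ => ∫ x in (0:ℝ)..1, c k * ee (k * ((x:ℂ) + y * Complex.I)) * ee (((-n : ℤ):ℂ) * x))
      (∫ x in (0:ℝ)..1, F (x + y * Complex.I) * ee (((-n : ℤ):ℂ) * x)) := by
    refine intervalIntegral.hasSum_integral_of_dominated_convergence (fun k _ => ‖c k * ee (k * (((0:ℝ):ℂ) + y * Complex.I))‖) ?_ ?_ ?_ ?_ ?_
    · intro k
      refine Continuous.aestronglyMeasurable ?_
      unfold ee; fun_prop
    · intro k
      refine Filter.Eventually.of_forall (fun x _ => ?_)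
      rw [norm_mul, hen, mul_one, hnorm]
    · exact Filter.Eventually.of_forall (fun x _ => hs)
    · simp
    · refine Filter.Eventually.of_forall (fun x _ => ?_)
      exact (hF _ (by rw [him]; exact hy)).mul_right _
  have hterm : ∀ k : ℕ, (∫ x in (0:ℝ)..1, c k * ee (k * ((x:ℂ) + y * Complex.I)) * ee (((-n : ℤ):ℂ) * x)) = if k = n then c n * ee (n * (y * Complex.I)) else 0 := by
    intro k
    have e : ∀ x : ℝ, c k * ee (k * ((x:ℂ) + y * Complex.I)) * ee (((-n : ℤ):ℂ) * x) = c k * ee (k * (y * Complex.I)) * ee (((k - n : ℤ):ℂ) * x) := by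
      intro x
      rw [mul_assoc, mul_assoc, ← ee_add, ← ee_add]
      congr 2; push_cast; ring
    simp only [e]
    rw [intervalIntegral.integral_const_mul, orth]
    by_cases h : k = n
    · simp [h]
    · have : (k:ℤ) - n ≠ 0 := by omega
      simp [h, this]
  simp only [hterm] at hsum
  have h1 := (hasSum_ite_eq n (c n * ee (n * (y * Complex.I)))).unique hsum
  have h2 : ‖c n‖ * Real.exp (-(2 * Real.pi * (n * y))) = ‖c n * ee (n * (y * Complex.I))‖ := by
    rw [norm_mul, norm_ee]; simp
  rw [h2, h1]
  refine intervalIntegral.norm_integral_le_of_norm_le (by norm_num) ?_ hG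
  refine Filter.Eventually.of_forall (fun x hx => ?_)
  rw [norm_mul, hen, mul_one]
  exact hFG x hx


lemma zetaR_cast (x : ℝ) : ((zetaR x : ℝ) : ℂ) = riemannZeta (x:ℂ) := by
  have h := riemannZeta_conj (x:ℂ)
  rw [Complex.conj_ofReal] at h
  exact (Complex.conj_eq_iff_re.1 h.symm)

lemma pw_add (s t : ℝ) {X : ℂ} (hX : X ≠ 0) : pw s X * pw t X = pw (s + t) X := by
  unfold pw
  rw [← Complex.cpow_add _ _ (mul_ne_zero (neg_ne_zero.2 Complex.I_ne_zero) hX)]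
  congr 1; push_cast; ring

lemma pw_one (X : ℂ) : pw 1 X = (-Complex.I * X)⁻¹ := by
  unfold pw
  rw [Complex.ofReal_neg, Complex.ofReal_one, Complex.cpow_neg_one]

lemma lam_pow {l y e f E0 κ : ℝ} (hl : 0 < l) (hy : 0 < y) (h2 : l ^ 2 ≤ 2 * y) (he : 0 ≤ e) (hE : e ≤ E0) (hk : e / 2 - f = κ) :
    l ^ e * y ^ (-f) ≤ 2 ^ (E0 / 2) * y ^ κ := by
  have e1 : l ^ e = (l ^ 2) ^ (e / 2) := by
    rw [← Real.rpow_natCast, ← Real.rpow_mul hl.le]; congr 1; push_cast; ring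
  have e2 : l ^ e ≤ (2 * y) ^ (e / 2) := by
    rw [e1]; exact Real.rpow_le_rpow (by positivity) h2 (by linarith)
  calc l ^ e * y ^ (-f) ≤ (2 * y) ^ (e / 2) * y ^ (-f) := by gcongr
    _ = 2 ^ (e / 2) * y ^ κ := by
      rw [Real.mul_rpow (by norm_num) hy.le, ← hk, sub_eq_add_neg, Real.rpow_add hy]; ring
    _ ≤ _ := by
      gcongr
      norm_num

lemma C1_id {a b : ℝ} (ha : 0 < a) (hb : 0 < b) {X : ℂ} (hX : X ≠ 0) :
    ((cG (a+1) : ℂ) * (riemannZeta ((a+1 : ℝ):ℂ) * pw (a+1) X)) * ((cG (b+1) : ℂ) * (riemannZeta ((b+1 : ℝ):ℂ) * pw (b+1) X))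
      = (((Real.Gamma (a + 1) * Real.Gamma (b + 1) / Real.Gamma (a + b + 2))
            * (zetaR (a + 1) * zetaR (b + 1) / zetaR (a + b + 2)) : ℝ) : ℂ) *
        (riemannZeta ((a + b + 1 + 1 - 0 : ℝ):ℂ) * (cG (a + b + 1 + 1) * ((((1:ℝ) : ℝ) : ℂ) * pw (a + b + 1 + 1) X))) := by
  have hz : riemannZeta ((a + b + 2 : ℝ):ℂ) ≠ 0 := riemannZeta_ne_zero_of_one_lt_re (by simp; linarith)
  have hG : (Real.Gamma (a + b + 2) : ℂ) ≠ 0 := by exact_mod_cast (Real.Gamma_pos_of_pos (by linarith)).ne'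
  have hp : pw (a + b + 2) X = pw (a+1) X * pw (b+1) X := by rw [pw_add _ _ hX]; congr 1; ring
  have h2 : (2 * Real.pi) ^ (-(a + b + 2)) = (2 * Real.pi) ^ (-(a + 1)) * (2 * Real.pi) ^ (-(b + 1)) := by
    rw [← Real.rpow_add (by positivity)]; congr 1; ring
  rw [sub_zero, show a + b + 1 + 1 = a + b + 2 by ring, hp]
  unfold cG
  rw [h2]
  simp only [Complex.ofReal_mul, Complex.ofReal_div, zetaR_cast, Complex.ofReal_one]
  field_simp

lemma C2_id {a b : ℝ} (ha : 0 < a) (hb : a < b) {X : ℂ} (hX : X ≠ 0) (qa : ℝ) :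
    ((qa : ℂ) * (-riemannZeta (1 - a)) / (2 * Real.pi * Complex.I * X)) * ((cG (b+1) : ℂ) * (riemannZeta ((b+1 : ℝ):ℂ) * pw (b+1) X))
      = ((zetaR (1 - a) * zetaR (b + 1) / ((b + 1) * zetaR (b - a + 2)) : ℝ) : ℂ) *
        (riemannZeta ((b + 1 + 1 - a : ℝ):ℂ) * (cG (b + 1 + 1) * ((qa : ℂ) * pw (b + 1 + 1) X))) := by
  have hz : riemannZeta ((b - a + 2 : ℝ):ℂ) ≠ 0 := riemannZeta_ne_zero_of_one_lt_re (by simp; linarith)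
  have hp : pw (b + 1 + 1) X = (-Complex.I * X)⁻¹ * pw (b+1) X := by rw [← pw_one, pw_add _ _ hX]; congr 1; ring
  have hc := congrArg (fun x : ℝ => (x:ℂ)) (cG_succ (s := b + 1) (by linarith))
  have hpi : (Real.pi:ℂ) ≠ 0 := by exact_mod_cast Real.pi_ne_zero
  have hb1 : (b:ℂ) + 1 ≠ 0 := by
    have : b + 1 ≠ 0 := by linarith
    exact_mod_cast this
  have hI := Complex.I_ne_zero
  rw [hp, show b + 1 + 1 - a = b - a + 2 by ring]
  push_cast [zetaR_cast] at hc ⊢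
  have hc2 : (cG (b+1+1):ℂ) = (b + 1) * cG (b+1) / (2 * Real.pi) := by
    rw [eq_div_iff (by simp [hpi])]; linear_combination -hc
  push_cast at hz
  rw [hc2]
  field_simp

lemma seven {F A B M N R M' N' R' L1 L2 m1 m2 : ℂ} (hF : F = A * B - L1 - L2) (hR : R = A - M - N) (hR' : R' = B - M' - N')
    (h1 : M * M' = m1) (h2 : N * M' = m2) :
    ‖F‖ ≤ ‖M‖ * ‖N'‖ + ‖M‖ * ‖R'‖ + ‖N‖ * ‖N'‖ + ‖N‖ * ‖R'‖ + ‖R‖ * ‖M'‖ + ‖R‖ * ‖N'‖ + ‖R‖ * ‖R'‖ + ‖L1 - m1‖ + ‖L2 - m2‖ := by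
  have e : F = M * N' + M * R' + N * N' + N * R' + R * M' + R * N' + R * R' - (L1 - m1) - (L2 - m2) := by
    rw [hF, ← h1, ← h2, hR, hR']; ring
  rw [e]
  simp only [← norm_mul]
  refine (norm_sub_le _ _).trans (add_le_add ((norm_sub_le _ _).trans (add_le_add ?_ le_rfl)) le_rfl)
  refine (norm_add_le _ _).trans (add_le_add ?_ le_rfl)
  refine (norm_add_le _ _).trans (add_le_add ?_ le_rfl)
  refine (norm_add_le _ _).trans (add_le_add ?_ le_rfl)
  refine (norm_add_le _ _).trans (add_le_add ?_ le_rfl)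
  refine (norm_add_le _ _).trans (add_le_add ?_ le_rfl)
  exact norm_add_le _ _

noncomputable def c1 (a b : ℝ) : ℝ := (Real.Gamma (a + 1) * Real.Gamma (b + 1) / Real.Gamma (a + b + 2))
            * (zetaR (a + 1) * zetaR (b + 1) / zetaR (a + b + 2))
noncomputable def c2 (a b : ℝ) : ℝ := zetaR (1 - a) * zetaR (b + 1) / ((b + 1) * zetaR (b - a + 2))

noncomputable def FF (a b : ℝ) (z : ℂ) : ℂ := LL 0 a z * LL 0 b z - c1 a b * LL 0 (a + b + 1) z - c2 a b * LL a (b + 1) z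

lemma terms_bd {a b : ℝ} (ha : 0 < a) (hab : a < b) (hb2 : b ≤ a + 3 / 2) {l y q m nM nN nR nM' nN' nR' e1 e2 K1 K2 : ℝ}
    (hl : 0 < l) (hy : 0 < y) (hq : 0 < q) (h2 : l ^ 2 ≤ 2 * y) (hql : q * y ≤ l) (hm : 0 ≤ m)
    (z1 : 0 ≤ nM) (z2 : 0 ≤ nN) (z3 : 0 ≤ nR) (z4 : 0 ≤ nM') (z5 : 0 ≤ nN') (z6 : 0 ≤ nR')
    (hM : nM ≤ m * l ^ (-(a + 1))) (hN : nN ≤ m * (q ^ a * l ^ (-1:ℝ))) (hR : nR ≤ m * (l / y) ^ (a + 1))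
    (hM' : nM' ≤ m * l ^ (-(b + 1))) (hN' : nN' ≤ m * (q ^ b * l ^ (-1:ℝ))) (hR' : nR' ≤ m * (l / y) ^ (b + 1))
    (he1 : e1 ≤ K1 * y ^ (-((a + b) / 2 + 1))) (he2 : e2 ≤ K2 * y ^ (-((a + b) / 2 + 1))) (hK1 : 0 ≤ K1) (hK2 : 0 ≤ K2) :
    nM * nN' + nM * nR' + nN * nN' + nN * nR' + nR * nM' + nR * nN' + nR * nR' + e1 + e2
     ≤ (m ^ 2 * 4 * 2 ^ ((a + b + 3) / 2) + m ^ 2 + K1 + K2) * (y ^ (-((a + b) / 2 + 1)) + q ^ b * l ^ (-(a + 2)) + q ^ (a + b) * l ^ (-2 : ℝ)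
        + y ^ (3 / 4 - ((a + b) / 2 + 1)) * l ^ (-(3 / 2) : ℝ)) := by
  set κ := (a + b) / 2 + 1 with hκ
  set P : ℝ := 2 ^ ((a + b + 3) / 2) with hP
  have hu : ∀ e : ℝ, (l / y) ^ e = l ^ e * y ^ (-e) := by
    intro e; rw [Real.div_rpow hl.le hy.le, Real.rpow_neg hy.le, div_eq_mul_inv]
  have hqu : q ≤ l / y := by rw [le_div_iff₀ hy]; exact hql
  have hqa : ∀ e : ℝ, 0 ≤ e → q ^ e ≤ l ^ e * y ^ (-e) := by
    intro e he; rw [← hu]; exact Real.rpow_le_rpow hq.le hqu he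
  rw [hu] at hR hR'
  have b1 : nM * nN' ≤ m ^ 2 * (q ^ b * l ^ (-(a + 2))) := by
    refine (mul_le_mul hM hN' z5 (by positivity)).trans (le_of_eq ?_)
    rw [show -(a + 2) = -(a+1) + -1 by ring, Real.rpow_add hl]; ring
  have b3 : nN * nN' ≤ m ^ 2 * (q ^ (a + b) * l ^ (-2:ℝ)) := by
    refine (mul_le_mul hN hN' z5 (by positivity)).trans (le_of_eq ?_)
    rw [show (-2:ℝ) = -1 + -1 by ring, Real.rpow_add hl, Real.rpow_add hq]; ring
  have b2 : nM * nR' ≤ m ^ 2 * (P * y ^ (-κ)) := by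
    refine (mul_le_mul hM hR' z6 (by positivity)).trans ?_
    have := lam_pow (e := b - a) (f := b + 1) (E0 := a + b + 3) (κ := -κ) hl hy h2 (by linarith) (by linarith) (by rw [hκ]; ring)
    calc _ = m ^ 2 * (l ^ (b - a) * y ^ (-(b + 1))) := by
          rw [show b - a = -(a+1) + (b + 1) by ring, Real.rpow_add hl (-(a+1)) (b+1)]; ring
      _ ≤ _ := by gcongr
  have hlam4 := lam_pow (e := a + b) (f := a + b + 1) (E0 := a + b + 3) (κ := -κ) hl hy h2 (by linarith) (by linarith) (by rw [hκ]; ring)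
  have b4 : nN * nR' ≤ m ^ 2 * (P * y ^ (-κ)) := by
    refine (mul_le_mul hN hR' z6 (by positivity)).trans ?_
    calc _ ≤ m * ((l ^ a * y ^ (-a)) * l ^ (-1:ℝ)) * (m * (l ^ (b+1) * y ^ (-(b+1)))) := by gcongr; exact hqa a ha.le
      _ = m ^ 2 * (l ^ (a + b) * y ^ (-(a + b + 1))) := by
          rw [show a + b = a + -1 + (b + 1) by ring, show -(a + -1 + (b + 1) + 1) = -a + -(b+1) by ring, Real.rpow_add hl (a + -1) (b+1), Real.rpow_add hl a (-1), Real.rpow_add hy (-a) (-(b+1))]; ring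
      _ ≤ _ := by gcongr
  have b6 : nR * nN' ≤ m ^ 2 * (P * y ^ (-κ)) := by
    refine (mul_le_mul hR hN' z5 (by positivity)).trans ?_
    calc _ ≤ (m * (l ^ (a+1) * y ^ (-(a+1)))) * (m * ((l ^ b * y ^ (-b)) * l ^ (-1:ℝ))) := by gcongr; exact hqa b (by linarith)
      _ = m ^ 2 * (l ^ (a + b) * y ^ (-(a + b + 1))) := by
          rw [show a + b = b + -1 + (a + 1) by ring, show -(b + -1 + (a + 1) + 1) = -b + -(a+1) by ring, Real.rpow_add hl (b + -1) (a+1), Real.rpow_add hl b (-1), Real.rpow_add hy (-b) (-(a+1))]; ring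
      _ ≤ _ := by gcongr
  have b7 : nR * nR' ≤ m ^ 2 * (P * y ^ (-κ)) := by
    refine (mul_le_mul hR hR' z6 (by positivity)).trans ?_
    have := lam_pow (e := a + b + 2) (f := a + b + 2) (E0 := a + b + 3) (κ := -κ) hl hy h2 (by linarith) (by linarith) (by rw [hκ]; ring)
    calc _ = m ^ 2 * (l ^ (a + b + 2) * y ^ (-(a + b + 2))) := by
          rw [show a + b + 2 = (a + 1) + (b + 1) by ring, show -((a + 1) + (b + 1)) = -(a + 1) + -(b+1) by ring, Real.rpow_add hl (a+1) (b+1), Real.rpow_add hy (-(a+1)) (-(b+1))]; ring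
      _ ≤ _ := by gcongr
  have b5 : nR * nM' ≤ m ^ 2 * (P * (y ^ (3 / 4 - κ) * l ^ (-(3/2):ℝ))) := by
    refine (mul_le_mul hR hM' z4 (by positivity)).trans ?_
    have := lam_pow (e := 3 / 2 - (b - a)) (f := a + 1) (E0 := a + b + 3) (κ := 3 / 4 - κ) hl hy h2 (by linarith) (by linarith) (by rw [hκ]; ring)
    calc _ = m ^ 2 * ((l ^ (3 / 2 - (b - a)) * y ^ (-(a + 1))) * l ^ (-(3/2):ℝ)) := by
          have : l ^ (a + 1) * l ^ (-(b+1)) = l ^ (3 / 2 - (b - a)) * l ^ (-(3/2):ℝ) := by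
            rw [← Real.rpow_add hl, ← Real.rpow_add hl]; congr 1; ring
          linear_combination m ^ 2 * y ^ (-(a + 1)) * this
      _ ≤ m ^ 2 * ((P * y ^ (3 / 4 - κ)) * l ^ (-(3/2):ℝ)) := by gcongr
      _ = _ := by ring
  have p1 : 0 ≤ y ^ (-κ) := by positivity
  have p2 : 0 ≤ q ^ b * l ^ (-(a + 2)) := by positivity
  have p3 : 0 ≤ q ^ (a + b) * l ^ (-2:ℝ) := by positivity
  have p4 : 0 ≤ y ^ (3 / 4 - κ) * l ^ (-(3/2):ℝ) := by positivity
  have pP : 0 ≤ m ^ 2 * P := by positivity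
  have pm : 0 ≤ m ^ 2 := by positivity
  set Y1 := y ^ (-κ)
  set Y2 := q ^ b * l ^ (-(a + 2))
  set Y3 := q ^ (a + b) * l ^ (-2:ℝ)
  set Y4 := y ^ (3 / 4 - κ) * l ^ (-(3/2):ℝ)
  nlinarith [mul_nonneg pP p1, mul_nonneg pP p2, mul_nonneg pP p3, mul_nonneg pP p4, mul_nonneg pm p1, mul_nonneg pm p4, mul_nonneg pm p2, mul_nonneg pm p3, mul_nonneg hK1 p2, mul_nonneg hK1 p3, mul_nonneg hK1 p4, mul_nonneg hK2 p2, mul_nonneg hK2 p3, mul_nonneg hK2 p4]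

lemma scale_le {x c Y m : ℝ} (hx : x = c * Y) (hc : c ≤ m) (hY : 0 ≤ Y) : x ≤ m * Y := by
  rw [hx]; gcongr

theorem pointwise {a b : ℝ} (ha : 0 < a) (hab : a < b) (hb2 : b ≤ a + 3 / 2) :
    ∃ C : ℝ, 0 ≤ C ∧ ∀ (z : ℂ) (_ : 0 < z.im) (q : ℕ) (_ : 0 < q) (h : ℤ) (_ : IsCoprime h (q:ℤ))
    (_ : ‖q * z - h‖ ^ 2 ≤ 2 * z.im),
    ‖FF a b z‖ ≤ C * (z.im ^ (-((a + b) / 2 + 1)) + (q:ℝ) ^ b * ‖q * z - h‖ ^ (-(a + 2)) + (q:ℝ) ^ (a + b) * ‖q * z - h‖ ^ (-2 : ℝ)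
        + z.im ^ (3 / 4 - ((a + b) / 2 + 1)) * ‖q * z - h‖ ^ (-(3 / 2) : ℝ)) := by
  have hb : 0 < b := by linarith
  obtain ⟨K1, hK1, hT1⟩ := tail (a := a + b + 1) (α := 0) (by linarith) le_rfl (by linarith)
  obtain ⟨K2, hK2, hT2⟩ := tail (a := b + 1) (α := a) (by linarith) ha.le (by linarith)
  set mM := ‖(cG (a+1) : ℂ) * riemannZeta ((a+1 : ℝ):ℂ)‖ with hmM
  set mM' := ‖(cG (b+1) : ℂ) * riemannZeta ((b+1 : ℝ):ℂ)‖ with hmM'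
  set mN := ‖(-riemannZeta (1 - a)) / (2 * Real.pi * Complex.I)‖ with hmN
  set mN' := ‖(-riemannZeta (1 - b)) / (2 * Real.pi * Complex.I)‖ with hmN'
  have n1 : 0 ≤ mM := norm_nonneg _
  have n2 : 0 ≤ mM' := norm_nonneg _
  have n3 : 0 ≤ mN := norm_nonneg _
  have n4 : 0 ≤ mN' := norm_nonneg _
  have n5 := CL_nonneg ha
  have n6 := CL_nonneg hb
  set m := mM + mM' + mN + mN' + CL a + CL b with hm
  refine ⟨m ^ 2 * 4 * 2 ^ ((a + b + 3) / 2) + m ^ 2 + |c1 a b| * K1 + |c2 a b| * K2, by positivity, ?_⟩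
  intro z hz q hq h hc hX2
  have hq' : (0:ℝ) < q := by exact_mod_cast hq
  have hXim : ((q:ℂ) * z - h).im = q * z.im := by simp
  have hA := L1 ha hz hq hc
  have hB := L1 hb hz hq hc
  have hT1' := hT1 z hz q hq h hc hX2
  have hT2' := hT2 z hz q hq h hc hX2
  set X : ℂ := (q:ℂ) * z - h with hX
  have hX0 : X ≠ 0 := by
    intro h0; rw [h0] at hXim; simp at hXim
    rcases hXim with h1 | h1
    · exact hq.ne' h1
    · exact hz.ne' h1
  have hXp : 0 < ‖X‖ := norm_pos_iff.2 hX0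
  have hql : q * z.im ≤ ‖X‖ := by rw [← hXim]; exact (le_abs_self _).trans (Complex.abs_im_le_norm X)
  have i1 := C1_id ha hb hX0
  have i2 := C2_id ha hab hX0 ((q:ℝ) ^ a)
  rw [Real.rpow_zero] at hT1'
  refine (seven (F := FF a b z) (N' := (((q:ℝ) ^ b : ℝ) : ℂ) * (-riemannZeta (1 - b)) / (2 * Real.pi * Complex.I * X)) rfl rfl rfl i1 i2).trans ?_
  have eM : ∀ (c w p : ℂ), ‖c * (w * p)‖ = ‖c * w‖ * ‖p‖ := by intro c w p; rw [← norm_mul]; congr 1; ring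
  have eN : ∀ (e : ℝ) (w : ℂ), ‖(((q:ℝ) ^ e : ℝ) : ℂ) * w / (2 * Real.pi * Complex.I * X)‖ = ‖w / (2 * Real.pi * Complex.I)‖ * ((q:ℝ) ^ e * ‖X‖ ^ (-1:ℝ)) := by
    intro e w
    rw [Real.rpow_neg_one, norm_div, norm_mul, norm_mul _ X, norm_div, Complex.norm_real, Real.norm_of_nonneg (by positivity)]
    rw [div_eq_mul_inv, mul_inv, div_eq_mul_inv]; ring
  refine terms_bd (m := m) ha hab hb2 hXp hz hq' hX2 hql (by positivity) (norm_nonneg _) (norm_nonneg _) (norm_nonneg _) (norm_nonneg _) (norm_nonneg _) (norm_nonneg _)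
    ?_ ?_ ?_ ?_ ?_ ?_ ?_ ?_ (by positivity) (by positivity)
  · exact scale_le (by rw [eM, norm_pw]) (by linarith) (by positivity)
  · exact scale_le (eN a _) (by linarith) (by positivity)
  · refine hA.trans ?_; gcongr; linarith
  · exact scale_le (by rw [eM, norm_pw]) (by linarith) (by positivity)
  · exact scale_le (eN b _) (by linarith) (by positivity)
  · refine hB.trans ?_; gcongr; linarith
  · rw [show ((Real.Gamma (a + 1) * Real.Gamma (b + 1) / Real.Gamma (a + b + 2))
            * (zetaR (a + 1) * zetaR (b + 1) / zetaR (a + b + 2))) = c1 a b from rfl, ← mul_sub, norm_mul, Complex.norm_real, Real.norm_eq_abs, mul_assoc]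
    rw [show (a + b + 1 + 1 + 0) / 2 = (a + b) / 2 + 1 by ring] at hT1'
    gcongr
  · rw [show zetaR (1 - a) * zetaR (b + 1) / ((b + 1) * zetaR (b - a + 2)) = c2 a b from rfl, ← mul_sub, norm_mul, Complex.norm_real, Real.norm_eq_abs, mul_assoc]
    rw [show (b + 1 + 1 + a) / 2 = (a + b) / 2 + 1 by ring] at hT2'
    gcongr


lemma pow_sum {r : ℝ} (hr : 0 < r) : ∃ C : ℝ, 0 ≤ C ∧ ∀ Q : ℕ, ∑ q ∈ Icc 1 Q, (q:ℝ) ^ (r - 1) ≤ C * (Q:ℝ) ^ r := by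
  refine ⟨1 + 1 / r, by positivity, ?_⟩
  rcases le_total 1 r with h1 | h1
  · intro Q
    rcases Nat.eq_zero_or_pos Q with h0 | h0
    · subst h0; simp; positivity
    have hQ : (0:ℝ) < Q := by exact_mod_cast h0
    calc ∑ q ∈ Icc 1 Q, (q:ℝ) ^ (r - 1) ≤ ∑ q ∈ Icc 1 Q, (Q:ℝ) ^ (r - 1) := by
          refine Finset.sum_le_sum fun q hq => ?_
          have := (Finset.mem_Icc.1 hq).2
          exact Real.rpow_le_rpow (by positivity) (by exact_mod_cast this) (by linarith)
      _ = (Q:ℝ) ^ r := by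
          rw [Finset.sum_const, Nat.card_Icc, nsmul_eq_mul, Nat.add_sub_cancel]
          nth_rewrite 1 [← Real.rpow_one (Q:ℝ)]
          rw [← Real.rpow_add hQ]; congr 1; ring
      _ ≤ _ := by
          have : 0 ≤ (Q:ℝ) ^ r := by positivity
          have h2 : 0 < 1 / r := by positivity
          nlinarith
  · have key : ∀ Q : ℕ, ∑ q ∈ Icc 1 Q, (q:ℝ) ^ (r - 1) ≤ 1 / r * (Q:ℝ) ^ r := by
      intro Q
      induction Q with
      | zero => simp; positivity
      | succ Q ih =>
        rw [Finset.sum_Icc_succ_top (by omega)]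
        have hN : (0:ℝ) < ((Q + 1 : ℕ):ℝ) := by positivity
        set N : ℝ := ((Q + 1 : ℕ):ℝ) with hNd
        have hN1 : 1 ≤ N := by rw [hNd]; push_cast; linarith [(Nat.cast_nonneg Q : (0:ℝ) ≤ Q)]
        have hQ : (Q:ℝ) = N * (1 + -(1 / N)) := by
          rw [mul_add, mul_neg, mul_one_div_cancel hN.ne', hNd]; push_cast; ring
        have h1N : 1 / N ≤ 1 := by rw [div_le_one hN]; exact hN1
        have hb := rpow_one_add_le_one_add_mul_self (s := -(1 / N)) (p := r) (by linarith) hr.le h1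
        have h3 : (Q:ℝ) ^ r ≤ N ^ r * (1 + r * -(1 / N)) := by
          rw [hQ, Real.mul_rpow hN.le (by linarith)]; gcongr
        have h4 : N ^ r = N ^ (r - 1) * N := by rw [← Real.rpow_add_one hN.ne']; congr 1; ring
        have h5 : N ^ r * (1 + r * -(1 / N)) = N ^ r - r * N ^ (r - 1) := by
          rw [h4]; field_simp
          ring
        have h6 : 1 / r * (Q:ℝ) ^ r ≤ 1 / r * (N ^ r - r * N ^ (r - 1)) := by
          rw [← h5]; gcongr
        have h7 : 1 / r * (N ^ r - r * N ^ (r - 1)) = 1 / r * N ^ r - N ^ (r - 1) := by field_simp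
        linarith
    intro Q
    have : 0 ≤ (Q:ℝ) ^ r := by positivity
    linarith [key Q]

noncomputable def GG (s p y : ℝ) (Q : ℕ) (x : ℝ) : ℝ :=
  ∑ q ∈ Icc 1 Q, ∑ h ∈ Icc (-1:ℤ) (q + 1), (q:ℝ) ^ s * ‖((x - h / q : ℝ) : ℂ) + y * Complex.I‖ ^ (-p)

lemma GG_nonneg (s p y : ℝ) (Q : ℕ) (x : ℝ) : 0 ≤ GG s p y Q x := by
  unfold GG; positivity

lemma GG_le (s p y : ℝ) {Q q : ℕ} (hq : q ∈ Icc 1 Q) {h : ℤ} (hh : h ∈ Icc (-1:ℤ) (q + 1)) (x : ℝ) :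
    (q:ℝ) ^ s * ‖((x - h / q : ℝ) : ℂ) + y * Complex.I‖ ^ (-p) ≤ GG s p y Q x := by
  unfold GG
  refine le_trans ?_ (Finset.single_le_sum (f := fun q : ℕ => ∑ h ∈ Icc (-1:ℤ) (q + 1), (q:ℝ) ^ s * ‖((x - h / q : ℝ) : ℂ) + y * Complex.I‖ ^ (-p)) (fun i _ => by positivity) hq)
  exact Finset.single_le_sum (f := fun h : ℤ => (q:ℝ) ^ s * ‖((x - h / q : ℝ) : ℂ) + y * Complex.I‖ ^ (-p)) (fun i _ => by positivity) hh

lemma GG_int {s p : ℝ} (hs : 0 < s + 2) (hp : 1 < p) : ∃ C : ℝ, 0 ≤ C ∧ ∀ (y : ℝ) (_ : 0 < y) (Q : ℕ) (_ : (Q:ℝ) ^ 2 * y ≤ 1),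
    IntervalIntegrable (GG s p y Q) MeasureTheory.volume 0 1 ∧ ∫ x in (0:ℝ)..1, GG s p y Q x ≤ C * y ^ (1 - p - (s + 2) / 2) := by
  obtain ⟨K, hK, hs2⟩ := pow_sum hs
  have hJ := JJ_nonneg p
  refine ⟨4 * JJ p * K, by positivity, fun y hy Q hQ => ?_⟩
  obtain ⟨j1, j2⟩ := J_line hp hy
  have i1 : ∀ (q : ℕ) (h : ℤ), MeasureTheory.Integrable (fun x : ℝ => (q:ℝ) ^ s * ‖((x - h / q : ℝ) : ℂ) + y * Complex.I‖ ^ (-p)) := by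
    intro q h
    exact (j1.comp_sub_right ((h:ℝ) / q)).const_mul _
  have ii : ∀ (q : ℕ) (h : ℤ), IntervalIntegrable (fun x : ℝ => (q:ℝ) ^ s * ‖((x - h / q : ℝ) : ℂ) + y * Complex.I‖ ^ (-p)) MeasureTheory.volume 0 1 :=
    fun q h => (i1 q h).intervalIntegrable
  have iv : ∀ (q : ℕ) (h : ℤ), ∫ x in (0:ℝ)..1, (q:ℝ) ^ s * ‖((x - h / q : ℝ) : ℂ) + y * Complex.I‖ ^ (-p) ≤ (q:ℝ) ^ s * (JJ p * y ^ (1 - p)) := by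
    intro q h
    rw [intervalIntegral.integral_of_le zero_le_one]
    refine (MeasureTheory.setIntegral_le_integral (i1 q h) (Filter.Eventually.of_forall fun x => by positivity)).trans (le_of_eq ?_)
    rw [MeasureTheory.integral_const_mul, ← j2]
    congr 1
    exact MeasureTheory.integral_sub_right_eq_self (fun t : ℝ => ‖(t:ℂ) + y * Complex.I‖ ^ (-p)) ((h:ℝ) / q)
  have isum : ∀ q : ℕ, IntervalIntegrable (fun x : ℝ => ∑ h ∈ Icc (-1:ℤ) (q + 1), (q:ℝ) ^ s * ‖((x - h / q : ℝ) : ℂ) + y * Complex.I‖ ^ (-p)) MeasureTheory.volume 0 1 := by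
    intro q
    have := IntervalIntegrable.sum (μ := MeasureTheory.volume) (a := 0) (b := 1) (Icc (-1:ℤ) (q + 1)) (f := fun (h : ℤ) (x : ℝ) => (q:ℝ) ^ s * ‖((x - h / q : ℝ) : ℂ) + y * Complex.I‖ ^ (-p)) (fun h _ => ii q h)
    refine this.congr ?_
    exact fun x _ => by simp
  constructor
  · have := IntervalIntegrable.sum (μ := MeasureTheory.volume) (a := 0) (b := 1) (Icc 1 Q) (f := fun (q : ℕ) (x : ℝ) => ∑ h ∈ Icc (-1:ℤ) (q + 1), (q:ℝ) ^ s * ‖((x - h / q : ℝ) : ℂ) + y * Complex.I‖ ^ (-p)) (fun q _ => isum q)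
    refine this.congr ?_
    exact fun x _ => by simp [GG]
  · unfold GG
    rw [intervalIntegral.integral_finset_sum (fun q _ => isum q)]
    have hYp : 0 ≤ JJ p * y ^ (1 - p) := by positivity
    calc _ ≤ ∑ q ∈ Icc 1 Q, 4 * (JJ p * y ^ (1 - p)) * (q:ℝ) ^ (s + 2 - 1) := by
          refine Finset.sum_le_sum fun q hq => ?_
          have hq1 := (Finset.mem_Icc.1 hq).1
          have hq' : (1:ℝ) ≤ q := by exact_mod_cast hq1
          rw [intervalIntegral.integral_finset_sum (fun h _ => ii q h)]
          refine (Finset.sum_le_sum fun h _ => iv q h).trans ?_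
          rw [Finset.sum_const, nsmul_eq_mul, Int.card_Icc]
          have hc : (((q:ℤ) + 1 + 1 - -1).toNat : ℝ) ≤ 4 * q := by
            have : ((q:ℤ) + 1 + 1 - -1).toNat = q + 3 := by omega
            rw [this]; push_cast; linarith
          calc _ ≤ (4 * (q:ℝ)) * ((q:ℝ) ^ s * (JJ p * y ^ (1 - p))) := by gcongr
            _ = _ := by
              rw [show s + 2 - 1 = s + 1 by ring, Real.rpow_add_one (by positivity)]; ring
      _ = 4 * (JJ p * y ^ (1 - p)) * ∑ q ∈ Icc 1 Q, (q:ℝ) ^ (s + 2 - 1) := by rw [Finset.mul_sum]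
      _ ≤ 4 * (JJ p * y ^ (1 - p)) * (K * (Q:ℝ) ^ (s + 2)) := by gcongr; exact hs2 Q
      _ ≤ 4 * (JJ p * y ^ (1 - p)) * (K * y ^ (-((s + 2) / 2))) := by
          gcongr
          have e : (Q:ℝ) ^ (s + 2) = ((Q:ℝ) ^ 2) ^ ((s + 2) / 2) := by
            rw [← Real.rpow_natCast, ← Real.rpow_mul (by positivity)]; congr 1; push_cast; ring
          rw [e, Real.rpow_neg hy.le, ← Real.inv_rpow hy.le]
          refine Real.rpow_le_rpow (by positivity) ?_ (by linarith)
          rwa [← one_div, le_div_iff₀ hy]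
      _ = _ := by
          rw [sub_eq_add_neg (1 - p), Real.rpow_add hy]; ring

lemma dirichlet (n : ℕ) (hn : 0 < n) (x : ℝ) (hx : x ∈ Set.Ioc (0:ℝ) 1) : ∃ (q : ℕ) (h : ℤ), q ∈ Icc 1 n.sqrt ∧ h ∈ Icc (-1:ℤ) (q + 1) ∧ IsCoprime h (q:ℤ) ∧
    ‖(q:ℂ) * ((x:ℂ) + ((1 / n : ℝ):ℂ) * Complex.I) - h‖ ^ 2 ≤ 2 * (1 / n : ℝ) := by
  have hs : 0 < n.sqrt := Nat.sqrt_pos.2 hn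
  obtain ⟨r, h1, h2⟩ := Real.exists_rat_abs_sub_le_and_den_le x hs
  have hn' : (0:ℝ) < n := by exact_mod_cast hn
  have hd : (0:ℝ) < r.den := by exact_mod_cast r.den_pos
  have hd1 : (1:ℝ) ≤ r.den := by exact_mod_cast r.den_pos
  have hr : (r:ℝ) = r.num / r.den := by exact_mod_cast (Rat.num_div_den r).symm
  have hss : (0:ℝ) < (n.sqrt:ℝ) + 1 := by positivity
  have h3 : |r.den * x - r.num| ≤ 1 / ((n.sqrt:ℝ) + 1) := by
    have : (r.den:ℝ) * x - r.num = r.den * (x - r) := by rw [hr]; field_simp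
    rw [this, abs_mul, abs_of_pos hd]
    calc _ ≤ (r.den:ℝ) * (1 / (((n.sqrt:ℝ) + 1) * r.den)) := by gcongr
      _ = _ := by field_simp
  have h3' : |r.den * x - r.num| ≤ 1 := h3.trans (by rw [div_le_one hss]; linarith [(Nat.cast_nonneg n.sqrt : (0:ℝ) ≤ n.sqrt)])
  have hab := abs_le.1 h3'
  refine ⟨r.den, r.num, Finset.mem_Icc.2 ⟨r.den_pos, h2⟩, Finset.mem_Icc.2 ⟨?_, ?_⟩, ?_, ?_⟩
  · have : (-1:ℝ) ≤ r.num := by nlinarith [mul_pos hd hx.1]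
    exact_mod_cast this
  · have : (r.num:ℝ) ≤ r.den + 1 := by nlinarith [mul_le_mul_of_nonneg_left hx.2 hd.le]
    exact_mod_cast this
  · rw [Int.isCoprime_iff_gcd_eq_one]; exact r.reduced
  · have e : (r.den:ℂ) * ((x:ℂ) + ((1 / n : ℝ):ℂ) * Complex.I) - r.num = ((r.den * x - r.num : ℝ):ℂ) + ((r.den * (1 / n) : ℝ):ℂ) * Complex.I := by
      push_cast; ring
    rw [e, ← Complex.normSq_eq_norm_sq, Complex.normSq_add_mul_I]
    have g1 : (r.den * x - r.num : ℝ) ^ 2 ≤ 1 / n := by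
      rw [← sq_abs]
      calc _ ≤ (1 / ((n.sqrt:ℝ) + 1)) ^ 2 := by gcongr
        _ ≤ 1 / n := by
          rw [div_pow, one_pow]
          have : (n:ℝ) ≤ ((n.sqrt:ℝ) + 1) ^ 2 := by
            have := (Nat.lt_succ_sqrt n).le
            rw [sq]; exact_mod_cast this
          gcongr
    have g2 : (r.den * (1 / n) : ℝ) ^ 2 ≤ 1 / n := by
      have : (r.den:ℝ) ^ 2 ≤ n := by
        have : r.den ^ 2 ≤ n := (Nat.pow_le_pow_left h2 2).trans (Nat.sqrt_le' n)
        exact_mod_cast this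
      calc ((r.den:ℝ) * (1 / (n:ℝ))) ^ 2 = (r.den:ℝ) ^ 2 * (1 / (n:ℝ)) ^ 2 := by ring
        _ ≤ n * (1 / (n:ℝ)) ^ 2 := by gcongr
        _ = 1 / (n:ℝ) := by field_simp
    linarith

theorem final {a b : ℝ} (ha : 0 < a) (hab : a < b) (hb2 : b ≤ a + 3 / 2) : ∃ C : ℝ, 0 ≤ C ∧ ∀ n : ℕ, 0 < n →
    |SR a b n - c1 a b * sigmaR (a + b + 1) n - c2 a b * (n:ℝ) ^ a * sigmaR (b - a + 1) n| ≤ C * (n:ℝ) ^ ((a + b) / 2 + 1) := by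
  obtain ⟨C, hC, hpt⟩ := pointwise ha hab hb2
  obtain ⟨K1, hK1, g1⟩ := GG_int (s := b - a - 2) (p := a + 2) (by linarith) (by linarith)
  obtain ⟨K2, hK2, g2⟩ := GG_int (s := a + b - 2) (p := 2) (by linarith) (by linarith)
  obtain ⟨K3, hK3, g3⟩ := GG_int (s := -(3 / 2)) (p := 3 / 2) (by norm_num) (by norm_num)
  refine ⟨C * (1 + K1 + K2 + K3) * Real.exp (2 * Real.pi), by positivity, fun n hn => ?_⟩
  have hn' : (0:ℝ) < n := by exact_mod_cast hn
  set κ := (a + b) / 2 + 1 with hκ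
  obtain ⟨y, hyd⟩ : ∃ y : ℝ, y = 1 / n := ⟨_, rfl⟩
  have hy : 0 < y := by rw [hyd]; positivity
  have hQ : ((n.sqrt : ℕ):ℝ) ^ 2 * y ≤ 1 := by
    have : ((n.sqrt : ℕ):ℝ) ^ 2 ≤ n := by exact_mod_cast Nat.sqrt_le' n
    rw [hyd, mul_one_div, div_le_one hn']; exact this
  obtain ⟨f1, v1⟩ := g1 y hy n.sqrt hQ
  obtain ⟨f2, v2⟩ := g2 y hy n.sqrt hQ
  obtain ⟨f3, v3⟩ := g3 y hy n.sqrt hQ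
  set G1 := GG (b - a - 2) (a + 2) y n.sqrt with hG1
  set G2 := GG (a + b - 2) 2 y n.sqrt with hG2
  set G3 := GG (-(3 / 2)) (3 / 2) y n.sqrt with hG3
  have fc : IntervalIntegrable (fun _ : ℝ => y ^ (-κ)) MeasureTheory.volume 0 1 := intervalIntegrable_const
  have F2 := (fc.add f1).add f2
  have F3 := F2.add (f3.const_mul (y ^ (3 / 4 - κ)))
  have key := coef_bound (c := fun k => ((SR a b k - c1 a b * sigmaR (a + b + 1) k - c2 a b * (k:ℝ) ^ a * sigmaR (b - a + 1) k : ℝ) : ℂ)) (F := FF a b) hy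
    (fun z hz => F_coef a b (c1 a b) (c2 a b) hz)
    (G := fun x => C * (y ^ (-κ) + G1 x + G2 x + y ^ (3 / 4 - κ) * G3 x)) (F3.const_mul C) ?_ n
  · rw [Complex.norm_real, Real.norm_eq_abs, intervalIntegral.integral_const_mul,
      intervalIntegral.integral_add F2 (f3.const_mul _), intervalIntegral.integral_add (fc.add f1) f2,
      intervalIntegral.integral_add fc f1, intervalIntegral.integral_const_mul, intervalIntegral.integral_const] at key
    have e0 : (2 * Real.pi * (n * y)) = 2 * Real.pi := by rw [hyd]; field_simp
    rw [e0] at key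
    have u1 : ∫ x in (0:ℝ)..1, G1 x ≤ K1 * y ^ (-κ) := by convert v1 using 3; rw [hκ]; ring
    have u2 : ∫ x in (0:ℝ)..1, G2 x ≤ K2 * y ^ (-κ) := by convert v2 using 3; rw [hκ]; ring
    have u3 : y ^ (3 / 4 - κ) * ∫ x in (0:ℝ)..1, G3 x ≤ K3 * y ^ (-κ) := by
      calc _ ≤ y ^ (3 / 4 - κ) * (K3 * y ^ (1 - (3/2) - (-(3 / 2) + 2) / 2 : ℝ)) := by gcongr
        _ = K3 * (y ^ (3 / 4 - κ) * y ^ (1 - (3/2) - (-(3 / 2) + 2) / 2 : ℝ)) := by ring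
        _ = _ := by rw [← Real.rpow_add hy]; congr 2; ring
    have hyk : y ^ (-κ) = (n:ℝ) ^ κ := by
      rw [hyd, one_div, Real.inv_rpow hn'.le, Real.rpow_neg hn'.le, inv_inv]
    have hle : C * ((1 - 0 : ℝ) • y ^ (-κ) + (∫ x in (0:ℝ)..1, G1 x) + (∫ x in (0:ℝ)..1, G2 x) + y ^ (3 / 4 - κ) * ∫ x in (0:ℝ)..1, G3 x) ≤ C * ((1 + K1 + K2 + K3) * y ^ (-κ)) := by
      gcongr
      rw [smul_eq_mul]; linarith
    have k2 := key.trans hle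
    rw [Real.exp_neg, ← div_eq_mul_inv, div_le_iff₀ (Real.exp_pos _), hyk] at k2
    refine k2.trans (le_of_eq ?_)
    ring
  · intro x hx
    obtain ⟨q, h, hq, hh, hc, hX⟩ := dirichlet n hn x hx
    rw [← hyd] at hX
    have him : ((x:ℂ) + (y:ℂ) * Complex.I).im = y := by simp
    have hq1 : 0 < q := (Finset.mem_Icc.1 hq).1
    have hq' : (0:ℝ) < q := by exact_mod_cast hq1
    have := hpt (x + y * Complex.I) (by rw [him]; exact hy) q hq1 h hc (by rw [him]; exact hX)
    refine this.trans ?_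
    rw [him]
    have eX : ‖(q:ℂ) * ((x:ℂ) + y * Complex.I) - h‖ = q * ‖((x - h / q : ℝ) : ℂ) + y * Complex.I‖ := by
      have : (q:ℂ) * ((x:ℂ) + y * Complex.I) - h = (q:ℂ) * (((x - h / q : ℝ) : ℂ) + y * Complex.I) := by
        have : (q:ℂ) ≠ 0 := by exact_mod_cast hq1.ne'
        push_cast; field_simp
        ring
      rw [this, norm_mul, Complex.norm_natCast]
    rw [eX]
    have r1 := GG_le (b - a - 2) (a + 2) y hq hh x
    have r2 := GG_le (a + b - 2) 2 y hq hh x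
    have r3 := GG_le (-(3 / 2)) (3 / 2) y hq hh x
    rw [← hG1] at r1
    rw [← hG2] at r2
    rw [← hG3] at r3
    set W := ‖((x - h / q : ℝ) : ℂ) + y * Complex.I‖ with hW
    have hW0 : 0 ≤ W := norm_nonneg _
    have m : ∀ e : ℝ, ((q:ℝ) * W) ^ e = (q:ℝ) ^ e * W ^ e := fun e => Real.mul_rpow hq'.le hW0
    rw [m, m, m, ← mul_assoc ((q:ℝ) ^ b), ← mul_assoc ((q:ℝ) ^ (a+b)), ← Real.rpow_add hq', ← Real.rpow_add hq',
      show b + -(a + 2) = b - a - 2 by ring, show a + b + -2 = a + b - 2 by ring]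
    gcongr

theorem stmt2 (a b : ℝ) (ha : 0 < a) (hb1 : max a (2 - a) < b) (hb2 : b ≤ a + 3 / 2) :
    ∀ ε > 0, ∃ C : ℝ, ∀ n : ℕ, 0 < n →
      |SR a b n
        - (Real.Gamma (a + 1) * Real.Gamma (b + 1) / Real.Gamma (a + b + 2))
            * (zetaR (a + 1) * zetaR (b + 1) / zetaR (a + b + 2)) * sigmaR (a + b + 1) n
        - zetaR (1 - a) * zetaR (b + 1) / ((b + 1) * zetaR (b - a + 2))
            * (n : ℝ) ^ a * sigmaR (b - a + 1) n|
      ≤ C * (n : ℝ) ^ ((a + b) / 2 + 1 + ε) := by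
  intro ε hε
  obtain ⟨C, hC, h⟩ := final ha (lt_of_le_of_lt (le_max_left _ _) hb1) hb2
  refine ⟨C, fun n hn => (h n hn).trans ?_⟩
  have hn' : (1:ℝ) ≤ n := by exact_mod_cast hn
  exact mul_le_mul_of_nonneg_left (Real.rpow_le_rpow_of_exponent_le hn' (by linarith)) hC
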